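/- Let n ≥ 1, Q = 4n+6 and 2* = 2Q/(Q−2). For every u ∈ C_c^∞(ℝ^{4n+3}) one has (∫_{ℝ^{4n+3}} |u|^{2*} dH)^{1/2*} ≤ S₂ (∫_{ℝ^{4n+3}} |∇u|² dH)^{1/2}, where S₂ = [2^{−2n} ω_{4n+3}]^{−1/(4n+6)} / (2√(n(n+1))) and ω_{4n+3} = 2π^{2n+2}/(2n+1)!. -/

import Mathlib

open MeasureTheory Real

/-- The quaternionic Heisenberg group `G(ℍ) = ℍⁿ × Im ℍ`, identified with `ℝ^{4n+3}`:
a point is `(q, ω)` where `q α = (t_α, x_α, y_α, z_α)` are the coordinates of the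
quaternion `q_α = t_α + i x_α + j y_α + k z_α`, and `ω = (x, y, z)` are the coordinates
of `ω = ix + jy + kz ∈ Im ℍ`. -/
abbrev QH (n : ℕ) : Type := (Fin n → ℝ × ℝ × ℝ × ℝ) × (ℝ × ℝ × ℝ)

namespace QH

/-- `t`-coordinate of a quaternion quadruple. -/
def tC (a : ℝ × ℝ × ℝ × ℝ) : ℝ := a.1
/-- `x`-coordinate of a quaternion quadruple. -/
def xC (a : ℝ × ℝ × ℝ × ℝ) : ℝ := a.2.1
/-- `y`-coordinate of a quaternion quadruple. -/
def yC (a : ℝ × ℝ × ℝ × ℝ) : ℝ := a.2.2.1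
/-- `z`-coordinate of a quaternion quadruple. -/
def zC (a : ℝ × ℝ × ℝ × ℝ) : ℝ := a.2.2.2

/-- The value at `g` of the left-invariant vector field
`T_α = ∂_{t_α} + 2x_α ∂_x + 2y_α ∂_y + 2z_α ∂_z`, as a tangent vector. -/
def Tvec (n : ℕ) (α : Fin n) (g : QH n) : QH n :=
  (Pi.single α (1, 0, 0, 0),
    (2 * xC (g.1 α), 2 * yC (g.1 α), 2 * zC (g.1 α)))

/-- The value at `g` of `X_α = ∂_{x_α} − 2t_α ∂_x − 2z_α ∂_y + 2y_α ∂_z`. -/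
def Xvec (n : ℕ) (α : Fin n) (g : QH n) : QH n :=
  (Pi.single α (0, 1, 0, 0),
    (-2 * tC (g.1 α), -2 * zC (g.1 α), 2 * yC (g.1 α)))

/-- The value at `g` of `Y_α = ∂_{y_α} + 2z_α ∂_x − 2t_α ∂_y − 2x_α ∂_z`. -/
def Yvec (n : ℕ) (α : Fin n) (g : QH n) : QH n :=
  (Pi.single α (0, 0, 1, 0),
    (2 * zC (g.1 α), -2 * tC (g.1 α), -2 * xC (g.1 α)))

/-- The value at `g` of `Z_α = ∂_{z_α} − 2y_α ∂_x + 2x_α ∂_y − 2t_α ∂_z`. -/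
def Zvec (n : ℕ) (α : Fin n) (g : QH n) : QH n :=
  (Pi.single α (0, 0, 0, 1),
    (-2 * yC (g.1 α), 2 * xC (g.1 α), -2 * tC (g.1 α)))

/-- Derivative of `u` along `T_α`. -/
noncomputable def TD (n : ℕ) (α : Fin n) (u : QH n → ℝ) (g : QH n) : ℝ :=
  fderiv ℝ u g (Tvec n α g)
/-- Derivative of `u` along `X_α`. -/
noncomputable def XD (n : ℕ) (α : Fin n) (u : QH n → ℝ) (g : QH n) : ℝ :=
  fderiv ℝ u g (Xvec n α g)
/-- Derivative of `u` along `Y_α`. -/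
noncomputable def YD (n : ℕ) (α : Fin n) (u : QH n → ℝ) (g : QH n) : ℝ :=
  fderiv ℝ u g (Yvec n α g)
/-- Derivative of `u` along `Z_α`. -/
noncomputable def ZD (n : ℕ) (α : Fin n) (u : QH n → ℝ) (g : QH n) : ℝ :=
  fderiv ℝ u g (Zvec n α g)

/-- Square of the length of the horizontal gradient:
`|∇u|² = Σ_α ((T_α u)² + (X_α u)² + (Y_α u)² + (Z_α u)²)`. -/
noncomputable def hGradSq (n : ℕ) (u : QH n → ℝ) (g : QH n) : ℝ :=
  ∑ α : Fin n, ((TD n α u g) ^ 2 + (XD n α u g) ^ 2 + (YD n α u g) ^ 2 + (ZD n α u g) ^ 2)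

/-- The sub-Laplacian `Δu = Σ_α (T_α(T_α u) + X_α(X_α u) + Y_α(Y_α u) + Z_α(Z_α u))`. -/
noncomputable def subLap (n : ℕ) (u : QH n → ℝ) (g : QH n) : ℝ :=
  ∑ α : Fin n, (TD n α (TD n α u) g + XD n α (XD n α u) g
    + YD n α (YD n α u) g + ZD n α (ZD n α u) g)

/-- `|q|² = Σ_α (t_α² + x_α² + y_α² + z_α²)`. -/
def qSq (n : ℕ) (g : QH n) : ℝ :=
  ∑ α : Fin n, ((tC (g.1 α)) ^ 2 + (xC (g.1 α)) ^ 2 + (yC (g.1 α)) ^ 2 + (zC (g.1 α)) ^ 2)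

/-- `|ω|² = x² + y² + z²`. -/
def wSq (n : ℕ) (g : QH n) : ℝ := g.2.1 ^ 2 + g.2.2.1 ^ 2 + g.2.2.2 ^ 2

/-- `i`-component of `Im (a·b̄)` for quaternions given as coordinate quadruples. -/
def imI (a b : ℝ × ℝ × ℝ × ℝ) : ℝ :=
  -tC a * xC b + xC a * tC b - yC a * zC b + zC a * yC b

/-- `j`-component of `Im (a·b̄)`. -/
def imJ (a b : ℝ × ℝ × ℝ × ℝ) : ℝ :=
  -tC a * yC b + xC a * zC b + yC a * tC b - zC a * xC b

/-- `k`-component of `Im (a·b̄)`. -/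
def imK (a b : ℝ × ℝ × ℝ × ℝ) : ℝ :=
  -tC a * zC b - xC a * yC b + yC a * xC b + zC a * tC b

/-- The group law `(q₀,ω₀)∘(q,ω) = (q₀+q, ω+ω₀+2 Im(q₀ q̄))`. -/
def op (n : ℕ) (a g : QH n) : QH n :=
  (a.1 + g.1,
    (g.2.1 + a.2.1 + 2 * ∑ α : Fin n, imI (a.1 α) (g.1 α),
     g.2.2.1 + a.2.2.1 + 2 * ∑ α : Fin n, imJ (a.1 α) (g.1 α),
     g.2.2.2 + a.2.2.2 + 2 * ∑ α : Fin n, imK (a.1 α) (g.1 α)))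

/-- The anisotropic dilations `δ_λ(q,ω) = (λq, λ²ω)`. -/
def dil (n : ℕ) (lam : ℝ) (g : QH n) : QH n :=
  (fun α => (lam * tC (g.1 α), lam * xC (g.1 α), lam * yC (g.1 α), lam * zC (g.1 α)),
    (lam ^ 2 * g.2.1, lam ^ 2 * g.2.2.1, lam ^ 2 * g.2.2.2))

end QH

namespace QH

section Derivations

variable {n : ℕ}

/-- The four basis quaternions, as coordinate quadruples. -/
def basisQ (k : Fin 4) : ℝ × ℝ × ℝ × ℝ :=
  ![(1, 0, 0, 0), (0, 1, 0, 0), (0, 0, 1, 0), (0, 0, 0, 1)] k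

/-- Squared norm of a quaternion quadruple. -/
def nsq (a : ℝ × ℝ × ℝ × ℝ) : ℝ := tC a ^ 2 + xC a ^ 2 + yC a ^ 2 + zC a ^ 2

/-- Euclidean scalar product of quaternion quadruples. -/
def dotQ (a b : ℝ × ℝ × ℝ × ℝ) : ℝ := tC a * tC b + xC a * xC b + yC a * yC b + zC a * zC b

/-- Value at `g` of the left-invariant horizontal field with constant `q`-component `a`. -/
def hvec (a : Fin n → ℝ × ℝ × ℝ × ℝ) (g : QH n) : QH n :=
  (a, (2 * ∑ α, imI (g.1 α) (a α), 2 * ∑ α, imJ (g.1 α) (a α), 2 * ∑ α, imK (g.1 α) (a α)))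

/-- Derivative along a horizontal left-invariant field. -/
noncomputable def hd (a : Fin n → ℝ × ℝ × ℝ × ℝ) (u : QH n → ℝ) (g : QH n) : ℝ :=
  fderiv ℝ u g (hvec a g)

lemma nsq_nonneg (a : ℝ × ℝ × ℝ × ℝ) : 0 ≤ nsq a := by unfold nsq; positivity

lemma sum_single (F : Fin n → (ℝ × ℝ × ℝ × ℝ) → ℝ) (h0 : ∀ α, F α 0 = 0) (β : Fin n)
    (e : ℝ × ℝ × ℝ × ℝ) :
    ∑ α, F α ((Pi.single β e : Fin n → ℝ × ℝ × ℝ × ℝ) α) = F β e := by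
  rw [Finset.sum_eq_single β]
  · simp
  · intro b _ hb; rw [Pi.single_eq_of_ne hb]; exact h0 b
  · simp

lemma hvec_single (β : Fin n) (e : ℝ × ℝ × ℝ × ℝ) (g : QH n) :
    hvec (Pi.single β e) g
      = (Pi.single β e, (2 * imI (g.1 β) e, 2 * imJ (g.1 β) e, 2 * imK (g.1 β) e)) := by
  unfold hvec
  rw [sum_single (fun α b => imI (g.1 α) b) _ β e, sum_single (fun α b => imJ (g.1 α) b) _ β e,
    sum_single (fun α b => imK (g.1 α) b) _ β e] <;>
  intro α <;> simp [imI, imJ, imK, tC, xC, yC, zC]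

lemma hGradSq_eq (u : QH n → ℝ) (g : QH n) :
    hGradSq n u g = ∑ α, ∑ k, (hd (Pi.single α (basisQ k)) u g) ^ 2 := by
  unfold hGradSq
  refine Finset.sum_congr rfl fun α _ => ?_
  simp only [Fin.sum_univ_four, hd, hvec_single, TD, XD, YD, ZD, Tvec, Xvec, Yvec, Zvec]
  simp [basisQ, imI, imJ, imK, tC, xC, yC, zC]

lemma hGradSq_nonneg (u : QH n → ℝ) (g : QH n) : 0 ≤ hGradSq n u g := by
  unfold hGradSq; positivity

lemma hvec_eq_sum (a : Fin n → ℝ × ℝ × ℝ × ℝ) (g : QH n) :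
    hvec a g = ∑ α, (tC (a α) • Tvec n α g + xC (a α) • Xvec n α g
      + yC (a α) • Yvec n α g + zC (a α) • Zvec n α g) := by
  have h1 : ∀ α, tC (a α) • Tvec n α g + xC (a α) • Xvec n α g
      + yC (a α) • Yvec n α g + zC (a α) • Zvec n α g =
      (Pi.single α (a α), (2 * imI (g.1 α) (a α), 2 * imJ (g.1 α) (a α), 2 * imK (g.1 α) (a α))) := by
    intro α
    refine Prod.ext ?_ ?_
    · funext β
      by_cases h : β = α
      · subst h
        simp [Tvec, Xvec, Yvec, Zvec, tC, xC, yC, zC]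
      · simp [Tvec, Xvec, Yvec, Zvec, Pi.single_eq_of_ne h]
    · simp only [Tvec, Xvec, Yvec, Zvec, imI, imJ, imK, Prod.smul_mk,
        Prod.mk_add_mk, smul_eq_mul]
      refine Prod.ext ?_ (Prod.ext ?_ ?_) <;> simp only <;> ring
  simp only [h1, hvec]
  refine Prod.ext ?_ (Prod.ext ?_ (Prod.ext ?_ ?_))
  · rw [Prod.fst_sum]; simp only; exact (Finset.univ_sum_single a).symm
  · rw [Prod.snd_sum, Prod.fst_sum, Finset.mul_sum]
  · rw [Prod.snd_sum, Prod.snd_sum, Prod.fst_sum]; simp only [Finset.mul_sum]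
  · rw [Prod.snd_sum, Prod.snd_sum, Prod.snd_sum]; simp only [Finset.mul_sum]

lemma hd_eq_sum (a : Fin n → ℝ × ℝ × ℝ × ℝ) (u : QH n → ℝ) (g : QH n) :
    hd a u g = ∑ α, (tC (a α) * TD n α u g + xC (a α) * XD n α u g
      + yC (a α) * YD n α u g + zC (a α) * ZD n α u g) := by
  unfold hd
  rw [hvec_eq_sum]
  simp [TD, XD, YD, ZD]

lemma hd_sq_le (a : Fin n → ℝ × ℝ × ℝ × ℝ) (u : QH n → ℝ) (g : QH n) :
    (hd a u g) ^ 2 ≤ (∑ α, nsq (a α)) * hGradSq n u g := by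
  have hcs : ∀ f h : Fin n × Fin 4 → ℝ, (∑ i, f i * h i) ^ 2 ≤ (∑ i, f i ^ 2) * ∑ i, h i ^ 2 :=
    fun f h => Finset.sum_mul_sq_le_sq_mul_sq _ _ _
  have := hcs (fun i => ![tC (a i.1), xC (a i.1), yC (a i.1), zC (a i.1)] i.2)
    (fun i => ![TD n i.1 u g, XD n i.1 u g, YD n i.1 u g, ZD n i.1 u g] i.2)
  simp only [Fintype.sum_prod_type, Fin.sum_univ_four] at this
  simpa [hd_eq_sum, hGradSq, nsq] using this

lemma hd_add {a : Fin n → ℝ × ℝ × ℝ × ℝ} {u v : QH n → ℝ} {g : QH n}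
    (hu : DifferentiableAt ℝ u g) (hv : DifferentiableAt ℝ v g) :
    hd a (fun x => u x + v x) g = hd a u g + hd a v g := by
  unfold hd; rw [fderiv_fun_add hu hv]; rfl

lemma hd_sub {a : Fin n → ℝ × ℝ × ℝ × ℝ} {u v : QH n → ℝ} {g : QH n}
    (hu : DifferentiableAt ℝ u g) (hv : DifferentiableAt ℝ v g) :
    hd a (fun x => u x - v x) g = hd a u g - hd a v g := by
  unfold hd; rw [fderiv_fun_sub hu hv]; rfl

lemma hd_mul {a : Fin n → ℝ × ℝ × ℝ × ℝ} {u v : QH n → ℝ} {g : QH n}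
    (hu : DifferentiableAt ℝ u g) (hv : DifferentiableAt ℝ v g) :
    hd a (fun x => u x * v x) g = u g * hd a v g + v g * hd a u g := by
  unfold hd; rw [fderiv_fun_mul hu hv]; simp

lemma hd_const {a : Fin n → ℝ × ℝ × ℝ × ℝ} {g : QH n} (c : ℝ) :
    hd a (fun _ => c) g = 0 := by
  unfold hd; simp

lemma hd_comp {a : Fin n → ℝ × ℝ × ℝ × ℝ} {u : QH n → ℝ} {g : QH n} {f : ℝ → ℝ} {f' : ℝ}
    (hf : HasDerivAt f f' (u g)) (hu : DifferentiableAt ℝ u g) :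
    hd a (fun x => f (u x)) g = f' * hd a u g := by
  unfold hd
  have := (hf.comp_hasFDerivAt g hu.hasFDerivAt).fderiv
  rw [show (fun x => f (u x)) = f ∘ u from rfl, this]
  simp

lemma hd_const_mul {a : Fin n → ℝ × ℝ × ℝ × ℝ} {u : QH n → ℝ} {g : QH n} (c : ℝ)
    (hu : DifferentiableAt ℝ u g) :
    hd a (fun x => c * u x) g = c * hd a u g := by
  rw [hd_mul (differentiableAt_const c) hu, hd_const]; ring

lemma hd_div {a : Fin n → ℝ × ℝ × ℝ × ℝ} {u v : QH n → ℝ} {g : QH n}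
    (hu : DifferentiableAt ℝ u g) (hv : DifferentiableAt ℝ v g) (h0 : v g ≠ 0) :
    hd a (fun x => u x / v x) g = (hd a u g * v g - u g * hd a v g) / (v g) ^ 2 := by
  have hv' : DifferentiableAt ℝ (fun x => (v x)⁻¹) g := hv.inv h0
  simp only [div_eq_mul_inv]
  rw [hd_mul hu hv', hd_comp (f := fun y => y⁻¹) (hasDerivAt_inv h0) hv]
  field_simp
  ring

lemma hd_of_line {a : Fin n → ℝ × ℝ × ℝ × ℝ} {u : QH n → ℝ} {g : QH n} {d : ℝ}
    (hu : DifferentiableAt ℝ u g)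
    (h : HasDerivAt (fun s : ℝ => u (g + s • hvec a g)) d 0) : hd a u g = d := by
  have := hu.hasFDerivAt.hasLineDerivAt (hvec a g)
  exact HasDerivAt.unique (this : HasDerivAt _ _ _) h

end Derivations

section Model

variable {n : ℕ}

/-- `1 + |q|²`. -/
def Af (g : QH n) : ℝ := 1 + qSq n g

/-- `(1 + |q|²)² + |ω|²`. -/
def Df (g : QH n) : ℝ := Af g ^ 2 + wSq n g

lemma contDiff_coord {m : WithTop ℕ∞} (α : Fin n) :
    ContDiff ℝ m (fun g : QH n => tC (g.1 α)) ∧ ContDiff ℝ m (fun g : QH n => xC (g.1 α)) ∧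
    ContDiff ℝ m (fun g : QH n => yC (g.1 α)) ∧ ContDiff ℝ m (fun g : QH n => zC (g.1 α)) := by
  unfold tC xC yC zC
  refine ⟨?_, ?_, ?_, ?_⟩ <;> fun_prop

@[fun_prop] lemma contDiff_tC {m : WithTop ℕ∞} (α : Fin n) :
    ContDiff ℝ m (fun g : QH n => tC (g.1 α)) := (contDiff_coord α).1
@[fun_prop] lemma contDiff_xC {m : WithTop ℕ∞} (α : Fin n) :
    ContDiff ℝ m (fun g : QH n => xC (g.1 α)) := (contDiff_coord α).2.1
@[fun_prop] lemma contDiff_yC {m : WithTop ℕ∞} (α : Fin n) :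
    ContDiff ℝ m (fun g : QH n => yC (g.1 α)) := (contDiff_coord α).2.2.1
@[fun_prop] lemma contDiff_zC {m : WithTop ℕ∞} (α : Fin n) :
    ContDiff ℝ m (fun g : QH n => zC (g.1 α)) := (contDiff_coord α).2.2.2

@[fun_prop] lemma contDiff_Af {m : WithTop ℕ∞} : ContDiff ℝ m (Af : QH n → ℝ) := by
  unfold Af qSq; fun_prop

@[fun_prop] lemma contDiff_Df {m : WithTop ℕ∞} : ContDiff ℝ m (Df : QH n → ℝ) := by
  unfold Df wSq; fun_prop

lemma qSq_nonneg (g : QH n) : 0 ≤ qSq n g := by unfold qSq; positivity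

lemma wSq_nonneg (g : QH n) : 0 ≤ wSq n g := by unfold wSq; positivity

lemma one_le_Af (g : QH n) : 1 ≤ Af g := by have := qSq_nonneg g; unfold Af; linarith

lemma one_le_Df (g : QH n) : 1 ≤ Df g := by
  have := wSq_nonneg g; have := one_le_Af g; unfold Df; nlinarith

lemma Df_pos (g : QH n) : 0 < Df g := lt_of_lt_of_le one_pos (one_le_Df g)

lemma Df_ne (g : QH n) : Df g ≠ 0 := (Df_pos g).ne'

end Model

section Model2

variable {n : ℕ}

lemma hasDerivAt_line (c d : ℝ) : HasDerivAt (fun s : ℝ => c + s * d) d 0 := by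
  simpa using ((hasDerivAt_id (0 : ℝ)).mul_const d).const_add c

lemma hd_coord (a : Fin n → ℝ × ℝ × ℝ × ℝ) (α : Fin n) (g : QH n) :
    hd a (fun g => tC (g.1 α)) g = tC (a α) ∧ hd a (fun g => xC (g.1 α)) g = xC (a α) ∧
    hd a (fun g => yC (g.1 α)) g = yC (a α) ∧ hd a (fun g => zC (g.1 α)) g = zC (a α) := by
  refine ⟨?_, ?_, ?_, ?_⟩
  · refine hd_of_line ((contDiff_tC (m := 1) α).differentiable one_ne_zero g) ?_
    exact hasDerivAt_line (tC (g.1 α)) (tC (a α))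
  · refine hd_of_line ((contDiff_xC (m := 1) α).differentiable one_ne_zero g) ?_
    exact hasDerivAt_line (xC (g.1 α)) (xC (a α))
  · refine hd_of_line ((contDiff_yC (m := 1) α).differentiable one_ne_zero g) ?_
    exact hasDerivAt_line (yC (g.1 α)) (yC (a α))
  · refine hd_of_line ((contDiff_zC (m := 1) α).differentiable one_ne_zero g) ?_
    exact hasDerivAt_line (zC (g.1 α)) (zC (a α))

lemma hd_omega (a : Fin n → ℝ × ℝ × ℝ × ℝ) (g : QH n) :
    hd a (fun g => g.2.1) g = 2 * ∑ α, imI (g.1 α) (a α) ∧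
    hd a (fun g => g.2.2.1) g = 2 * ∑ α, imJ (g.1 α) (a α) ∧
    hd a (fun g => g.2.2.2) g = 2 * ∑ α, imK (g.1 α) (a α) := by
  refine ⟨?_, ?_, ?_⟩
  · refine hd_of_line (by fun_prop) ?_
    exact hasDerivAt_line (g.2.1) _
  · refine hd_of_line (by fun_prop) ?_
    exact hasDerivAt_line (g.2.2.1) _
  · refine hd_of_line (by fun_prop) ?_
    exact hasDerivAt_line (g.2.2.2) _

lemma Af_line (a : Fin n → ℝ × ℝ × ℝ × ℝ) (g : QH n) (w : ℝ × ℝ × ℝ) (s : ℝ) :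
    Af (g + s • ((a, w) : QH n))
      = Af g + s * (2 * ∑ α, dotQ (g.1 α) (a α)) + s ^ 2 * ∑ α, nsq (a α) := by
  unfold Af qSq
  rw [Finset.mul_sum, Finset.mul_sum, Finset.mul_sum, add_assoc, add_assoc, ← Finset.sum_add_distrib,
    ← Finset.sum_add_distrib]
  congr 1
  refine Finset.sum_congr rfl fun α _ => ?_
  simp only [tC, xC, yC, zC, dotQ, nsq, Prod.fst_add, Prod.smul_fst, Pi.add_apply, Pi.smul_apply,
    Prod.snd_add, Prod.smul_snd, smul_eq_mul]
  ring

lemma hd_Af (a : Fin n → ℝ × ℝ × ℝ × ℝ) (g : QH n) :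
    hd a Af g = 2 * ∑ α, dotQ (g.1 α) (a α) := by
  refine hd_of_line ((contDiff_Af (m := 1)).differentiable one_ne_zero g) ?_
  have h : (fun s : ℝ => Af (g + s • hvec a g)) = fun s =>
      Af g + s * (2 * ∑ α, dotQ (g.1 α) (a α)) + s ^ 2 * ∑ α, nsq (a α) := by
    funext s; exact Af_line a g _ s
  rw [h]
  have h2 := (hasDerivAt_line (Af g) (2 * ∑ α, dotQ (g.1 α) (a α))).fun_add
    (((hasDerivAt_id' (0 : ℝ)).fun_pow 2).mul_const (∑ α, nsq (a α)))
  simpa using h2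

lemma hd_Df (a : Fin n → ℝ × ℝ × ℝ × ℝ) (g : QH n) :
    hd a Df g = 4 * (Af g * ∑ α, dotQ (g.1 α) (a α) + g.2.1 * ∑ α, imI (g.1 α) (a α)
      + g.2.2.1 * ∑ α, imJ (g.1 α) (a α) + g.2.2.2 * ∑ α, imK (g.1 α) (a α)) := by
  have hA : DifferentiableAt ℝ (Af : QH n → ℝ) g :=
    (contDiff_Af (m := 1)).differentiable one_ne_zero g
  have h : (Df : QH n → ℝ) = fun g => ((Af g * Af g + g.2.1 * g.2.1) + g.2.2.1 * g.2.2.1)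
      + g.2.2.2 * g.2.2.2 := by
    funext g; unfold Df wSq; ring
  have h1 : DifferentiableAt ℝ (fun g : QH n => g.2.1) g := by fun_prop
  have h2 : DifferentiableAt ℝ (fun g : QH n => g.2.2.1) g := by fun_prop
  have h3 : DifferentiableAt ℝ (fun g : QH n => g.2.2.2) g := by fun_prop
  rw [h, hd_add (by fun_prop) (by fun_prop), hd_add (by fun_prop) (by fun_prop),
    hd_add (by fun_prop) (by fun_prop), hd_mul hA hA, hd_mul h1 h1, hd_mul h2 h2, hd_mul h3 h3,
    hd_Af, (hd_omega a g).1, (hd_omega a g).2.1, (hd_omega a g).2.2]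
  ring

/-- Components of the quaternion product `(A + ω) q`, with `A = 1 + |q|²`. -/
def wq (k : Fin 4) (α : Fin n) (g : QH n) : ℝ :=
  ![Af g * tC (g.1 α) - g.2.1 * xC (g.1 α) - g.2.2.1 * yC (g.1 α) - g.2.2.2 * zC (g.1 α),
    Af g * xC (g.1 α) + g.2.1 * tC (g.1 α) + g.2.2.1 * zC (g.1 α) - g.2.2.2 * yC (g.1 α),
    Af g * yC (g.1 α) - g.2.1 * zC (g.1 α) + g.2.2.1 * tC (g.1 α) + g.2.2.2 * xC (g.1 α),
    Af g * zC (g.1 α) + g.2.1 * yC (g.1 α) - g.2.2.1 * xC (g.1 α) + g.2.2.2 * tC (g.1 α)] k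

/-- Components of `A + ω`. -/
def wComp (k : Fin 4) (g : QH n) : ℝ := ![Af g, g.2.1, g.2.2.1, g.2.2.2] k

/-- The sphere coordinates pulled back by the Cayley transform. -/
noncomputable def sph : Option (Fin n) × Fin 4 → QH n → ℝ
  | (some α, k), g => 2 * wq k α g / Df g
  | (none, k), g => 2 * wComp k g / Df g - (if k = 0 then 1 else 0)

lemma contDiff_wq (k : Fin 4) (α : Fin n) {m : WithTop ℕ∞} :
    ContDiff ℝ m (wq k α : QH n → ℝ) := by
  unfold wq
  fin_cases k <;> simp <;> fun_prop

lemma contDiff_wComp (k : Fin 4) {m : WithTop ℕ∞} :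
    ContDiff ℝ m (wComp k : QH n → ℝ) := by
  unfold wComp
  fin_cases k <;> simp <;> fun_prop

lemma contDiff_sph (j : Option (Fin n) × Fin 4) {m : WithTop ℕ∞} : ContDiff ℝ m (sph j) := by
  obtain ⟨_ | α, k⟩ := j
  · exact ((contDiff_const.mul (contDiff_wComp k)).div contDiff_Df Df_ne).sub contDiff_const
  · exact (contDiff_const.mul (contDiff_wq k α)).div contDiff_Df Df_ne

lemma sum_wq_sq (α : Fin n) (g : QH n) : ∑ k, wq k α g ^ 2 = Df g * nsq (g.1 α) := by
  simp [Fin.sum_univ_four, wq, Df, nsq, wSq]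
  ring

lemma sum_sph_sq (g : QH n) : ∑ j, sph j g ^ 2 = 1 := by
  rw [Fintype.sum_prod_type, Fintype.sum_option]
  have h1 : ∀ α : Fin n, ∑ k, sph (some α, k) g ^ 2 = 4 / Df g * nsq (g.1 α) := by
    intro α
    have := sum_wq_sq α g
    simp only [sph, div_pow, mul_pow, ← Finset.sum_div, ← Finset.mul_sum, this]
    field_simp [Df_ne g]
    ring
  have h2 : ∑ k, sph (none, k) g ^ 2 = (4 - 4 * Af g) / Df g + 1 := by
    have h0 := Df_ne g
    have h3 : wSq n g = Df g - Af g ^ 2 := by unfold Df; ring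
    have h4 : g.2.1 ^ 2 = Df g - Af g ^ 2 - g.2.2.1 ^ 2 - g.2.2.2 ^ 2 := by
      rw [← h3]; unfold wSq; ring
    simp [Fin.sum_univ_four, sph, wComp]
    field_simp
    rw [h4]
    ring
  simp only [h1, ← Finset.mul_sum, h2]
  have : ∑ α, nsq (g.1 α) = Af g - 1 := by unfold Af qSq nsq; ring
  rw [this]
  ring

lemma abs_sph_le (j : Option (Fin n) × Fin 4) (g : QH n) : |sph j g| ≤ 1 := by
  rw [abs_le_one_iff_mul_self_le_one, ← sq, ← sum_sph_sq g]
  exact Finset.single_le_sum (f := fun j => sph j g ^ 2) (fun _ _ => sq_nonneg _)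
    (Finset.mem_univ j)

end Model2

section Model3

variable {n : ℕ}

lemma hd_Af_single (β : Fin n) (e : ℝ × ℝ × ℝ × ℝ) (g : QH n) :
    hd (Pi.single β e) Af g = 2 * dotQ (g.1 β) e := by
  rw [hd_Af, sum_single (fun α b => dotQ (g.1 α) b) _ β e]
  intro α; simp [dotQ, tC, xC, yC, zC]

lemma hd_omega_single (β : Fin n) (e : ℝ × ℝ × ℝ × ℝ) (g : QH n) :
    hd (Pi.single β e) (fun g => g.2.1) g = 2 * imI (g.1 β) e ∧
    hd (Pi.single β e) (fun g => g.2.2.1) g = 2 * imJ (g.1 β) e ∧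
    hd (Pi.single β e) (fun g => g.2.2.2) g = 2 * imK (g.1 β) e := by
  rw [(hd_omega _ g).1, (hd_omega _ g).2.1, (hd_omega _ g).2.2,
    sum_single (fun α b => imI (g.1 α) b) _ β e, sum_single (fun α b => imJ (g.1 α) b) _ β e,
    sum_single (fun α b => imK (g.1 α) b) _ β e]
  · exact ⟨rfl, rfl, rfl⟩
  all_goals intro α; simp [imI, imJ, imK, tC, xC, yC, zC]

lemma hd_Df_single (β : Fin n) (e : ℝ × ℝ × ℝ × ℝ) (g : QH n) :
    hd (Pi.single β e) Df g = 4 * (Af g * dotQ (g.1 β) e + g.2.1 * imI (g.1 β) e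
      + g.2.2.1 * imJ (g.1 β) e + g.2.2.2 * imK (g.1 β) e) := by
  rw [hd_Df, sum_single (fun α b => dotQ (g.1 α) b) _ β e,
    sum_single (fun α b => imI (g.1 α) b) _ β e, sum_single (fun α b => imJ (g.1 α) b) _ β e,
    sum_single (fun α b => imK (g.1 α) b) _ β e]
  all_goals intro α; simp [dotQ, imI, imJ, imK, tC, xC, yC, zC]

lemma hd_wComp (β : Fin n) (e : ℝ × ℝ × ℝ × ℝ) (k : Fin 4) (g : QH n) :
    hd (Pi.single β e) (wComp k) g
      = 2 * ![dotQ (g.1 β) e, imI (g.1 β) e, imJ (g.1 β) e, imK (g.1 β) e] k := by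
  obtain ⟨h1, h2, h3⟩ := hd_omega_single β e g
  fin_cases k
  · exact hd_Af_single β e g
  · exact h1
  · exact h2
  · exact h3

lemma differentiableAt_of_contDiff {f : QH n → ℝ} (h : ContDiff ℝ 1 f) (g : QH n) :
    DifferentiableAt ℝ f g := h.differentiable one_ne_zero g

/-- The derivative of the product `(A + ω) q_α`. -/
lemma hd_wq (β : Fin n) (e : ℝ × ℝ × ℝ × ℝ) (k : Fin 4) (α : Fin n) (g : QH n) :
    hd (Pi.single β e) (wq k α) g
      = 2 * ![dotQ (g.1 β) e * tC (g.1 α) - imI (g.1 β) e * xC (g.1 α)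
            - imJ (g.1 β) e * yC (g.1 α) - imK (g.1 β) e * zC (g.1 α),
          dotQ (g.1 β) e * xC (g.1 α) + imI (g.1 β) e * tC (g.1 α)
            + imJ (g.1 β) e * zC (g.1 α) - imK (g.1 β) e * yC (g.1 α),
          dotQ (g.1 β) e * yC (g.1 α) - imI (g.1 β) e * zC (g.1 α)
            + imJ (g.1 β) e * tC (g.1 α) + imK (g.1 β) e * xC (g.1 α),
          dotQ (g.1 β) e * zC (g.1 α) + imI (g.1 β) e * yC (g.1 α)
            - imJ (g.1 β) e * xC (g.1 α) + imK (g.1 β) e * tC (g.1 α)] k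
        + (if α = β then 
          ![Af g * tC e - g.2.1 * xC e - g.2.2.1 * yC e - g.2.2.2 * zC e,
            Af g * xC e + g.2.1 * tC e + g.2.2.1 * zC e - g.2.2.2 * yC e,
            Af g * yC e - g.2.1 * zC e + g.2.2.1 * tC e + g.2.2.2 * xC e,
            Af g * zC e + g.2.1 * yC e - g.2.2.1 * xC e + g.2.2.2 * tC e] k else 0) := by
  obtain ⟨h1, h2, h3⟩ := hd_omega_single β e g
  obtain ⟨c0, c1, c2, c3⟩ := hd_coord (Pi.single β e) α g
  have d1 : DifferentiableAt ℝ (fun g : QH n => g.2.1) g := by fun_prop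
  have d2 : DifferentiableAt ℝ (fun g : QH n => g.2.2.1) g := by fun_prop
  have d3 : DifferentiableAt ℝ (fun g : QH n => g.2.2.2) g := by fun_prop
  have dA := differentiableAt_of_contDiff (contDiff_Af (n := n)) g
  have e0 := differentiableAt_of_contDiff (contDiff_tC α) g
  have e1 := differentiableAt_of_contDiff (contDiff_xC α) g
  have e2 := differentiableAt_of_contDiff (contDiff_yC α) g
  have e3 := differentiableAt_of_contDiff (contDiff_zC α) g
  have hs : ∀ f : (ℝ × ℝ × ℝ × ℝ) → ℝ, f 0 = 0 →
      f ((Pi.single β e : Fin n → ℝ × ℝ × ℝ × ℝ) α) = if α = β then f e else 0 := by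
    intro f h0
    split_ifs with h
    · subst h; simp
    · rw [Pi.single_eq_of_ne h, h0]
  rw [hs tC rfl] at c0
  rw [hs xC rfl] at c1
  rw [hs yC rfl] at c2
  rw [hs zC rfl] at c3
  have hA := hd_Af_single β e g
  fin_cases k
  · change hd _ (fun g : QH n => Af g * tC (g.1 α) - g.2.1 * xC (g.1 α) - g.2.2.1 * yC (g.1 α) - g.2.2.2 * zC (g.1 α)) g = _
    rw [hd_sub (by fun_prop) (by fun_prop), hd_sub (by fun_prop) (by fun_prop),
      hd_sub (by fun_prop) (by fun_prop), hd_mul dA e0, hd_mul d1 e1, hd_mul d2 e2,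
      hd_mul d3 e3, h1, h2, h3, c0, c1, c2, c3, hA]
    simp only [Fin.zero_eta, Fin.mk_one, Fin.reduceFinMk, Matrix.cons_val]
    split_ifs <;> ring
  · change hd _ (fun g : QH n => Af g * xC (g.1 α) + g.2.1 * tC (g.1 α) + g.2.2.1 * zC (g.1 α) - g.2.2.2 * yC (g.1 α)) g = _
    rw [hd_sub (by fun_prop) (by fun_prop), hd_add (by fun_prop) (by fun_prop),
      hd_add (by fun_prop) (by fun_prop), hd_mul dA e1, hd_mul d1 e0, hd_mul d2 e3,
      hd_mul d3 e2, h1, h2, h3, c0, c1, c2, c3, hA]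
    simp only [Fin.zero_eta, Fin.mk_one, Fin.reduceFinMk, Matrix.cons_val]
    split_ifs <;> ring
  · change hd _ (fun g : QH n => Af g * yC (g.1 α) - g.2.1 * zC (g.1 α) + g.2.2.1 * tC (g.1 α) + g.2.2.2 * xC (g.1 α)) g = _
    rw [hd_add (by fun_prop) (by fun_prop), hd_add (by fun_prop) (by fun_prop),
      hd_sub (by fun_prop) (by fun_prop), hd_mul dA e2, hd_mul d1 e3, hd_mul d2 e0,
      hd_mul d3 e1, h1, h2, h3, c0, c1, c2, c3, hA]
    simp only [Fin.zero_eta, Fin.mk_one, Fin.reduceFinMk, Matrix.cons_val]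
    split_ifs <;> ring
  · change hd _ (fun g : QH n => Af g * zC (g.1 α) + g.2.1 * yC (g.1 α) - g.2.2.1 * xC (g.1 α) + g.2.2.2 * tC (g.1 α)) g = _
    rw [hd_add (by fun_prop) (by fun_prop), hd_sub (by fun_prop) (by fun_prop),
      hd_add (by fun_prop) (by fun_prop), hd_mul dA e3, hd_mul d1 e2, hd_mul d2 e1,
      hd_mul d3 e0, h1, h2, h3, c0, c1, c2, c3, hA]
    simp only [Fin.zero_eta, Fin.mk_one, Fin.reduceFinMk, Matrix.cons_val]
    split_ifs <;> ring

lemma hd_sph_some (β : Fin n) (e : ℝ × ℝ × ℝ × ℝ) (k : Fin 4) (α : Fin n) (g : QH n) :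
    hd (Pi.single β e) (sph (some α, k)) g
      = 2 * (hd (Pi.single β e) (wq k α) g * Df g - wq k α g * hd (Pi.single β e) Df g)
        / Df g ^ 2 := by
  have h1 := differentiableAt_of_contDiff (contDiff_wq k α) g
  have h2 := differentiableAt_of_contDiff (contDiff_Df (n := n)) g
  have : sph (some α, k) = fun g : QH n => 2 * wq k α g / Df g := rfl
  rw [this, hd_div (by fun_prop) h2 (Df_ne g), hd_const_mul _ h1]
  ring

lemma hd_sph_none (β : Fin n) (e : ℝ × ℝ × ℝ × ℝ) (k : Fin 4) (g : QH n) :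
    hd (Pi.single β e) (sph (none, k)) g
      = 2 * (hd (Pi.single β e) (wComp k) g * Df g - wComp k g * hd (Pi.single β e) Df g)
        / Df g ^ 2 := by
  have h1 := differentiableAt_of_contDiff (contDiff_wComp (n := n) k) g
  have h2 := differentiableAt_of_contDiff (contDiff_Df (n := n)) g
  have h3 : DifferentiableAt ℝ (fun g : QH n => 2 * wComp k g / Df g) g :=
    differentiableAt_of_contDiff
      ((contDiff_const.mul (contDiff_wComp k)).div contDiff_Df Df_ne) g
  have : sph (none, k) = fun g : QH n => 2 * wComp k g / Df g - (if k = 0 then 1 else 0) := rfl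
  rw [this, hd_sub h3 (by fun_prop), hd_const, hd_div (by fun_prop) h2 (Df_ne g),
    hd_const_mul _ h1]
  ring

lemma sum_hd_wComp_sq (β : Fin n) (e : ℝ × ℝ × ℝ × ℝ) (g : QH n) :
    ∑ k, (hd (Pi.single β e) (wComp k) g * Df g - wComp k g * hd (Pi.single β e) Df g) ^ 2
      = 4 * nsq (g.1 β) * nsq e * Df g ^ 2 := by
  have hD : Df g = Af g ^ 2 + (g.2.1 ^ 2 + g.2.2.1 ^ 2 + g.2.2.2 ^ 2) := rfl
  simp only [hd_wComp, hd_Df_single, Fin.sum_univ_four, wComp, hD]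
  simp only [Matrix.cons_val]
  generalize Af g = A
  generalize g.2.1 = x, g.2.2.1 = y, g.2.2.2 = z
  simp only [nsq, dotQ, imI, imJ, imK]
  generalize tC (g.1 β) = q0, xC (g.1 β) = q1, yC (g.1 β) = q2, zC (g.1 β) = q3
  generalize tC e = e0, xC e = e1, yC e = e2, zC e = e3
  ring

lemma sum_sq_combination (a b c : Fin 4 → ℝ) (D s : ℝ) :
    ∑ k, ((2 * a k + b k) * D - c k * (4 * s)) ^ 2
      = D ^ 2 * (4 * ∑ k, a k ^ 2 + 4 * ∑ k, a k * b k + ∑ k, b k ^ 2)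
        - 8 * D * s * (2 * ∑ k, a k * c k + ∑ k, b k * c k) + 16 * s ^ 2 * ∑ k, c k ^ 2 := by
  simp only [Fin.sum_univ_four]
  ring

lemma sum_hd_wq_sq (β : Fin n) (e : ℝ × ℝ × ℝ × ℝ) (α : Fin n) (g : QH n) :
    ∑ k, (hd (Pi.single β e) (wq k α) g * Df g - wq k α g * hd (Pi.single β e) Df g) ^ 2
      = 4 * nsq (g.1 β) * nsq e * nsq (g.1 α) * Df g ^ 2
        + (if α = β then nsq e * (Df g - 4 * Af g * nsq (g.1 β)) * Df g ^ 2 else 0) := by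
  have hc := sum_wq_sq α g
  simp only [hd_wq, hd_Df_single]
  rw [sum_sq_combination, hc]
  clear hc
  have hD : Df g = Af g ^ 2 + (g.2.1 ^ 2 + g.2.2.1 ^ 2 + g.2.2.2 ^ 2) := rfl
  simp only [wq, Fin.sum_univ_four, Matrix.cons_val]
  generalize hs : Af g * dotQ (g.1 β) e + g.2.1 * imI (g.1 β) e + g.2.2.1 * imJ (g.1 β) e
    + g.2.2.2 * imK (g.1 β) e = s
  generalize Df g = D at *
  generalize Af g = A at *
  generalize g.2.1 = x at *
  generalize g.2.2.1 = y at *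
  generalize g.2.2.2 = z at *
  have haa : (dotQ (g.1 β) e * tC (g.1 α) - imI (g.1 β) e * xC (g.1 α)
            - imJ (g.1 β) e * yC (g.1 α) - imK (g.1 β) e * zC (g.1 α)) ^ 2
      + (dotQ (g.1 β) e * xC (g.1 α) + imI (g.1 β) e * tC (g.1 α)
            + imJ (g.1 β) e * zC (g.1 α) - imK (g.1 β) e * yC (g.1 α)) ^ 2
      + (dotQ (g.1 β) e * yC (g.1 α) - imI (g.1 β) e * zC (g.1 α)
            + imJ (g.1 β) e * tC (g.1 α) + imK (g.1 β) e * xC (g.1 α)) ^ 2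
      + (dotQ (g.1 β) e * zC (g.1 α) + imI (g.1 β) e * yC (g.1 α)
            - imJ (g.1 β) e * xC (g.1 α) + imK (g.1 β) e * tC (g.1 α)) ^ 2
      = nsq (g.1 β) * nsq e * nsq (g.1 α) := by
    have h1 : nsq (g.1 β) * nsq e = dotQ (g.1 β) e ^ 2 + imI (g.1 β) e ^ 2 + imJ (g.1 β) e ^ 2
        + imK (g.1 β) e ^ 2 := by
      unfold nsq dotQ imI imJ imK; ring
    rw [h1]; unfold nsq; ring
  have hac : (dotQ (g.1 β) e * tC (g.1 α) - imI (g.1 β) e * xC (g.1 α)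
            - imJ (g.1 β) e * yC (g.1 α) - imK (g.1 β) e * zC (g.1 α))
          * (A * tC (g.1 α) - x * xC (g.1 α) - y * yC (g.1 α) - z * zC (g.1 α))
      + (dotQ (g.1 β) e * xC (g.1 α) + imI (g.1 β) e * tC (g.1 α)
            + imJ (g.1 β) e * zC (g.1 α) - imK (g.1 β) e * yC (g.1 α))
          * (A * xC (g.1 α) + x * tC (g.1 α) + y * zC (g.1 α) - z * yC (g.1 α))
      + (dotQ (g.1 β) e * yC (g.1 α) - imI (g.1 β) e * zC (g.1 α)
            + imJ (g.1 β) e * tC (g.1 α) + imK (g.1 β) e * xC (g.1 α))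
          * (A * yC (g.1 α) - x * zC (g.1 α) + y * tC (g.1 α) + z * xC (g.1 α))
      + (dotQ (g.1 β) e * zC (g.1 α) + imI (g.1 β) e * yC (g.1 α)
            - imJ (g.1 β) e * xC (g.1 α) + imK (g.1 β) e * tC (g.1 α))
          * (A * zC (g.1 α) + x * yC (g.1 α) - y * xC (g.1 α) + z * tC (g.1 α))
      = s * nsq (g.1 α) := by
    rw [← hs]; unfold nsq; ring
  rw [haa, hac]
  split_ifs with h
  · subst h
    have hbb : (A * tC e - x * xC e - y * yC e - z * zC e) ^ 2
        + (A * xC e + x * tC e + y * zC e - z * yC e) ^ 2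
        + (A * yC e - x * zC e + y * tC e + z * xC e) ^ 2
        + (A * zC e + x * yC e - y * xC e + z * tC e) ^ 2 = D * nsq e := by
      rw [hD]; unfold nsq; ring
    have hbc : (A * tC e - x * xC e - y * yC e - z * zC e)
          * (A * tC (g.1 α) - x * xC (g.1 α) - y * yC (g.1 α) - z * zC (g.1 α))
        + (A * xC e + x * tC e + y * zC e - z * yC e)
          * (A * xC (g.1 α) + x * tC (g.1 α) + y * zC (g.1 α) - z * yC (g.1 α))
        + (A * yC e - x * zC e + y * tC e + z * xC e)
          * (A * yC (g.1 α) - x * zC (g.1 α) + y * tC (g.1 α) + z * xC (g.1 α))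
        + (A * zC e + x * yC e - y * xC e + z * tC e)
          * (A * zC (g.1 α) + x * yC (g.1 α) - y * xC (g.1 α) + z * tC (g.1 α))
        = D * dotQ (g.1 α) e := by
      rw [hD]; unfold dotQ; ring
    have hab : (dotQ (g.1 α) e * tC (g.1 α) - imI (g.1 α) e * xC (g.1 α)
              - imJ (g.1 α) e * yC (g.1 α) - imK (g.1 α) e * zC (g.1 α))
            * (A * tC e - x * xC e - y * yC e - z * zC e)
        + (dotQ (g.1 α) e * xC (g.1 α) + imI (g.1 α) e * tC (g.1 α)
              + imJ (g.1 α) e * zC (g.1 α) - imK (g.1 α) e * yC (g.1 α))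
            * (A * xC e + x * tC e + y * zC e - z * yC e)
        + (dotQ (g.1 α) e * yC (g.1 α) - imI (g.1 α) e * zC (g.1 α)
              + imJ (g.1 α) e * tC (g.1 α) + imK (g.1 α) e * xC (g.1 α))
            * (A * yC e - x * zC e + y * tC e + z * xC e)
        + (dotQ (g.1 α) e * zC (g.1 α) + imI (g.1 α) e * yC (g.1 α)
              - imJ (g.1 α) e * xC (g.1 α) + imK (g.1 α) e * tC (g.1 α))
            * (A * zC e + x * yC e - y * xC e + z * tC e)
        = 2 * dotQ (g.1 α) e * s - nsq (g.1 α) * nsq e * A := by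
      rw [← hs]; unfold nsq dotQ imI imJ imK; ring
    rw [hab, hbb, hbc]; ring
  · simp only [mul_zero, add_zero, zero_mul, ne_eq, OfNat.ofNat_ne_zero, not_false_eq_true,
      zero_pow]
    ring

lemma sum_hd_sph_sq (β : Fin n) (e : ℝ × ℝ × ℝ × ℝ) (g : QH n) :
    ∑ j, hd (Pi.single β e) (sph j) g ^ 2 = 4 * nsq e / Df g := by
  rw [Fintype.sum_prod_type, Fintype.sum_option]
  simp only [hd_sph_some, hd_sph_none, div_pow, mul_pow, ← Finset.sum_div, ← Finset.mul_sum,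
    sum_hd_wComp_sq, sum_hd_wq_sq, Finset.sum_add_distrib, ← Finset.sum_mul]
  simp only [Finset.sum_ite_eq', Finset.mem_univ, if_true]
  have : ∑ α, nsq (g.1 α) = Af g - 1 := by unfold Af qSq nsq; ring
  rw [this]
  field_simp [Df_ne g]
  ring

lemma sum_sph_mul_hd (a : Fin n → ℝ × ℝ × ℝ × ℝ) (g : QH n) :
    ∑ j, sph j g * hd a (sph j) g = 0 := by
  have h1 : hd a (fun g : QH n => ∑ j, sph j g ^ 2) g = 0 := by
    simp only [sum_sph_sq, hd_const]
  have h2 : hd a (fun g : QH n => ∑ j, sph j g ^ 2) g = ∑ j, 2 * (sph j g * hd a (sph j) g) := by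
    have hd' : ∀ j ∈ (Finset.univ : Finset (Option (Fin n) × Fin 4)),
        DifferentiableAt ℝ (fun g : QH n => sph j g ^ 2) g := fun j _ =>
      (differentiableAt_of_contDiff (contDiff_sph j) g).pow 2
    unfold hd
    rw [fderiv_fun_sum hd']
    simp only [sum_apply]
    refine Finset.sum_congr rfl fun j _ => ?_
    have h3 := hd_mul (a := a) (differentiableAt_of_contDiff (contDiff_sph j) g)
      (differentiableAt_of_contDiff (contDiff_sph j) g)
    simp only [← sq] at h3
    unfold hd at h3
    rw [h3]; ring
  rw [h1, ← Finset.mul_sum] at h2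
  linarith

lemma nsq_basisQ (k : Fin 4) : nsq (basisQ k) = 1 := by
  fin_cases k <;> simp [nsq, basisQ, tC, xC, yC, zC]

/-- Multiplying a function by the sphere coordinates. -/
lemma sum_hGradSq_sph_mul {u : QH n → ℝ} {g : QH n} (hu : DifferentiableAt ℝ u g) :
    ∑ j, hGradSq n (fun x => sph j x * u x) g = hGradSq n u g + 16 * n * (u g ^ 2 / Df g) := by
  simp only [hGradSq_eq]
  rw [Finset.sum_comm]
  have key : ∀ (β : Fin n) (k : Fin 4),
      ∑ j, hd (Pi.single β (basisQ k)) (fun x => sph j x * u x) g ^ 2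
        = hd (Pi.single β (basisQ k)) u g ^ 2 + 4 * (u g ^ 2 / Df g) := by
    intro β k
    have h1 : ∀ j, hd (Pi.single β (basisQ k)) (fun x => sph j x * u x) g ^ 2
        = sph j g ^ 2 * hd (Pi.single β (basisQ k)) u g ^ 2
          + (sph j g * hd (Pi.single β (basisQ k)) (sph j) g)
            * (2 * u g * hd (Pi.single β (basisQ k)) u g)
          + hd (Pi.single β (basisQ k)) (sph j) g ^ 2 * u g ^ 2 := by
      intro j
      rw [hd_mul (differentiableAt_of_contDiff (contDiff_sph j) g) hu]; ring
    simp only [h1, Finset.sum_add_distrib, ← Finset.sum_mul, sum_sph_sq, sum_sph_mul_hd,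
      sum_hd_sph_sq, nsq_basisQ]
    ring
  have : ∀ β : Fin n, ∑ j, ∑ k, hd (Pi.single β (basisQ k)) (fun x => sph j x * u x) g ^ 2
      = ∑ k, hd (Pi.single β (basisQ k)) u g ^ 2 + 16 * (u g ^ 2 / Df g) := by
    intro β
    rw [Finset.sum_comm]
    simp only [key, Finset.sum_add_distrib]
    simp
    ring
  simp only [this, Finset.sum_add_distrib]
  simp
  ring

end Model3

section GroundState

variable {n : ℕ}

lemma isAddHaar_volume_prod {E F : Type*} [NormedAddCommGroup E] [MeasureSpace E] [BorelSpace E]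
    [SecondCountableTopology E] [SigmaFinite (volume : Measure E)]
    [NormedAddCommGroup F] [MeasureSpace F] [BorelSpace F]
    [SecondCountableTopology F] [SigmaFinite (volume : Measure F)]
    (_ : (volume : Measure E).IsAddHaarMeasure) (_ : (volume : Measure F).IsAddHaarMeasure) :
    (volume : Measure (E × F)).IsAddHaarMeasure :=
  Measure.prod.instIsAddHaarMeasure (volume : Measure E) (volume : Measure F)

lemma isAddHaar_volume_pi {E : Type*} [NormedAddCommGroup E] [MeasureSpace E] [BorelSpace E]
    [SecondCountableTopology E] [SigmaFinite (volume : Measure E)]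
    (_ : (volume : Measure E).IsAddHaarMeasure) :
    (volume : Measure (Fin n → E)).IsAddHaarMeasure :=
  inferInstanceAs (Measure.pi fun _ : Fin n => (volume : Measure E)).IsAddHaarMeasure

instance instIsAddHaarQH : (volume : Measure (QH n)).IsAddHaarMeasure :=
  isAddHaar_volume_prod (isAddHaar_volume_pi (isAddHaar_volume_prod inferInstance
    (isAddHaar_volume_prod inferInstance (isAddHaar_volume_prod inferInstance inferInstance))))
    (isAddHaar_volume_prod inferInstance (isAddHaar_volume_prod inferInstance inferInstance))

lemma hvec_smul_decomp (a : Fin n → ℝ × ℝ × ℝ × ℝ) (g : QH n) :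
    hvec a g = (a, 0) + ((2 * ∑ α, imI (g.1 α) (a α)) • ((0, (1, 0, 0)) : QH n)
      + ((2 * ∑ α, imJ (g.1 α) (a α)) • ((0, (0, 1, 0)) : QH n)
      + (2 * ∑ α, imK (g.1 α) (a α)) • ((0, (0, 0, 1)) : QH n))) := by
  unfold hvec
  refine Prod.ext ?_ (Prod.ext ?_ (Prod.ext ?_ ?_)) <;> simp

/-- A function which is linear in the horizontal variable only integrates to zero
against a central derivative. -/
lemma integral_horizontal_mul_fderiv {f : QH n → ℝ} (hf : ContDiff ℝ 1 f)
    (hs : HasCompactSupport f) {l : QH n → ℝ} (hl : ContDiff ℝ 1 l) (v : QH n)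
    (hlv : ∀ g (s : ℝ), l (g + s • v) = l g) :
    Integrable (fun g => l g * fderiv ℝ f g v) ∧ ∫ g, l g * fderiv ℝ f g v = 0 := by
  have hl0 : ∀ g, fderiv ℝ l g v = 0 := by
    intro g
    have h1 := (differentiableAt_of_contDiff hl g).hasFDerivAt.hasLineDerivAt v
    have h2 : HasDerivAt (fun s : ℝ => l (g + s • v)) 0 0 := by
      simp only [hlv]; exact hasDerivAt_const _ _
    exact HasDerivAt.unique (h1 : HasDerivAt _ _ _) h2
  have hsf : HasCompactSupport (fun g => fderiv ℝ f g v) := hs.fderiv_apply (𝕜 := ℝ) v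
  have hcf : Continuous (fun g => fderiv ℝ f g v) :=
    (hf.continuous_fderiv one_ne_zero).clm_apply continuous_const
  have hi : Integrable (fun g => l g * fderiv ℝ f g v) :=
    (hl.continuous.mul hcf).integrable_of_hasCompactSupport hsf.mul_left
  refine ⟨hi, ?_⟩
  rw [integral_mul_fderiv_eq_neg_fderiv_mul_of_integrable (v := v) ?_ hi ?_
    (fun x _ => hl.differentiable one_ne_zero x) (fun x _ => hf.differentiable one_ne_zero x)]
  · simp [hl0]
  · simp [hl0]
  · exact (hl.continuous.mul hf.continuous).integrable_of_hasCompactSupport hs.mul_left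

lemma continuous_hd (a : Fin n → ℝ × ℝ × ℝ × ℝ) {f : QH n → ℝ} (hf : ContDiff ℝ 1 f) :
    Continuous (hd a f) := by
  unfold hd
  refine (hf.continuous_fderiv one_ne_zero).clm_apply ?_
  unfold hvec imI imJ imK tC xC yC zC
  fun_prop

lemma continuous_hGradSq {f : QH n → ℝ} (hf : ContDiff ℝ 1 f) : Continuous (hGradSq n f) := by
  have : hGradSq n f = fun g => ∑ α, ∑ k, (hd (Pi.single α (basisQ k)) f g) ^ 2 :=
    funext (hGradSq_eq f)
  rw [this]
  exact continuous_finsetSum _ fun α _ => continuous_finsetSum _ fun k _ =>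
    (continuous_hd _ hf).pow 2

lemma hasCompactSupport_hd (a : Fin n → ℝ × ℝ × ℝ × ℝ) {f : QH n → ℝ}
    (hs : HasCompactSupport f) : HasCompactSupport (hd a f) := by
  refine (hs.fderiv (𝕜 := ℝ)).mono ?_
  intro g hg h
  exact hg (by simp [hd, h])

lemma hasCompactSupport_hGradSq {f : QH n → ℝ} (hs : HasCompactSupport f) :
    HasCompactSupport (hGradSq n f) := by
  refine (hs.fderiv (𝕜 := ℝ)).mono ?_
  intro g hg h
  exact hg (by simp [hGradSq, TD, XD, YD, ZD, h])

/-- Horizontal left-invariant fields are divergence free. -/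
lemma integral_hd (a : Fin n → ℝ × ℝ × ℝ × ℝ) {f : QH n → ℝ} (hf : ContDiff ℝ 1 f)
    (hs : HasCompactSupport f) : ∫ g, hd a f g = 0 := by
  have cI : ContDiff ℝ 1 (fun g : QH n => 2 * ∑ α, imI (g.1 α) (a α)) := by
    unfold imI; fun_prop
  have cJ : ContDiff ℝ 1 (fun g : QH n => 2 * ∑ α, imJ (g.1 α) (a α)) := by
    unfold imJ; fun_prop
  have cK : ContDiff ℝ 1 (fun g : QH n => 2 * ∑ α, imK (g.1 α) (a α)) := by
    unfold imK; fun_prop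
  obtain ⟨i0, e0⟩ := integral_horizontal_mul_fderiv hf hs (l := fun _ => 1) contDiff_const (a, 0)
    (fun _ _ => rfl)
  obtain ⟨i1, e1⟩ := integral_horizontal_mul_fderiv hf hs cI ((0, (1, 0, 0)) : QH n) (by simp)
  obtain ⟨i2, e2⟩ := integral_horizontal_mul_fderiv hf hs cJ ((0, (0, 1, 0)) : QH n) (by simp)
  obtain ⟨i3, e3⟩ := integral_horizontal_mul_fderiv hf hs cK ((0, (0, 0, 1)) : QH n) (by simp)
  have : ∀ g, hd a f g = 1 * fderiv ℝ f g (a, 0)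
      + ((2 * ∑ α, imI (g.1 α) (a α)) * fderiv ℝ f g ((0, (1, 0, 0)) : QH n)
      + ((2 * ∑ α, imJ (g.1 α) (a α)) * fderiv ℝ f g ((0, (0, 1, 0)) : QH n)
      + (2 * ∑ α, imK (g.1 α) (a α)) * fderiv ℝ f g ((0, (0, 0, 1)) : QH n))) := by
    intro g
    unfold hd
    rw [hvec_smul_decomp]
    simp only [map_add, map_smul, smul_eq_mul, one_mul]
  simp only [this]
  rw [integral_add i0 (i1.fun_add (i2.fun_add i3)), integral_add i1 (i2.fun_add i3), integral_add i2 i3,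
    e0, e1, e2, e3]
  simp

lemma hd_hd_Df (β : Fin n) (e : ℝ × ℝ × ℝ × ℝ) (g : QH n) :
    hd (Pi.single β e) (hd (Pi.single β e) Df) g
      = 8 * (nsq (g.1 β) * nsq e) + 4 * (Af g * nsq e) := by
  have h0 : hd (Pi.single β e) Df = fun g => 4 * (((Af g * dotQ (g.1 β) e + g.2.1 * imI (g.1 β) e)
      + g.2.2.1 * imJ (g.1 β) e) + g.2.2.2 * imK (g.1 β) e) := funext (hd_Df_single β e)
  obtain ⟨h1, h2, h3⟩ := hd_omega_single β e g
  have hA := hd_Af_single β e g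
  obtain ⟨c0, c1, c2, c3⟩ := hd_coord (Pi.single β e) β g
  rw [Pi.single_eq_same] at c0 c1 c2 c3
  have d1 : DifferentiableAt ℝ (fun g : QH n => g.2.1) g := by fun_prop
  have d2 : DifferentiableAt ℝ (fun g : QH n => g.2.2.1) g := by fun_prop
  have d3 : DifferentiableAt ℝ (fun g : QH n => g.2.2.2) g := by fun_prop
  have dA := differentiableAt_of_contDiff (contDiff_Af (n := n)) g
  have e0 := differentiableAt_of_contDiff (contDiff_tC β) g
  have e1 := differentiableAt_of_contDiff (contDiff_xC β) g
  have e2 := differentiableAt_of_contDiff (contDiff_yC β) g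
  have e3 := differentiableAt_of_contDiff (contDiff_zC β) g
  have lin : ∀ p0 p1 p2 p3 : ℝ, DifferentiableAt ℝ
      (fun g : QH n => p0 * tC (g.1 β) + p1 * xC (g.1 β) + p2 * yC (g.1 β) + p3 * zC (g.1 β)) g ∧
      hd (Pi.single β e)
      (fun g : QH n => p0 * tC (g.1 β) + p1 * xC (g.1 β) + p2 * yC (g.1 β) + p3 * zC (g.1 β)) g
      = p0 * tC e + p1 * xC e + p2 * yC e + p3 * zC e := by
    intro p0 p1 p2 p3
    refine ⟨by fun_prop, ?_⟩
    rw [hd_add (by fun_prop) (by fun_prop), hd_add (by fun_prop) (by fun_prop),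
      hd_add (by fun_prop) (by fun_prop), hd_const_mul _ e0, hd_const_mul _ e1, hd_const_mul _ e2,
      hd_const_mul _ e3, c0, c1, c2, c3]
  have k0 := lin (tC e) (xC e) (yC e) (zC e)
  have k1 := lin (xC e) (-tC e) (zC e) (-yC e)
  have k2 := lin (yC e) (-zC e) (-tC e) (xC e)
  have k3 := lin (zC e) (yC e) (-xC e) (-tC e)
  rw [show (fun g : QH n => tC e * tC (g.1 β) + xC e * xC (g.1 β) + yC e * yC (g.1 β)
    + zC e * zC (g.1 β)) = fun g => dotQ (g.1 β) e by funext g; unfold dotQ; ring] at k0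
  rw [show (fun g : QH n => xC e * tC (g.1 β) + -tC e * xC (g.1 β) + zC e * yC (g.1 β)
    + -yC e * zC (g.1 β)) = fun g => -imI (g.1 β) e by funext g; unfold imI; ring] at k1
  rw [show (fun g : QH n => yC e * tC (g.1 β) + -zC e * xC (g.1 β) + -tC e * yC (g.1 β)
    + xC e * zC (g.1 β)) = fun g => -imJ (g.1 β) e by funext g; unfold imJ; ring] at k2
  rw [show (fun g : QH n => zC e * tC (g.1 β) + yC e * xC (g.1 β) + -xC e * yC (g.1 β)
    + -tC e * zC (g.1 β)) = fun g => -imK (g.1 β) e by funext g; unfold imK; ring] at k3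
  have h0' : hd (Pi.single β e) Df = fun g => 4 * (((Af g * dotQ (g.1 β) e
      - g.2.1 * (-imI (g.1 β) e))
      - g.2.2.1 * (-imJ (g.1 β) e)) - g.2.2.2 * (-imK (g.1 β) e)) := by
    rw [h0]; funext g; ring
  have D0 := k0.1
  have D1 := k1.1
  have D2 := k2.1
  have D3 := k3.1
  rw [h0', hd_const_mul _ (by fun_prop), hd_sub (by fun_prop) (by fun_prop),
    hd_sub (by fun_prop) (by fun_prop), hd_sub (by fun_prop) (by fun_prop),
    hd_mul dA D0, hd_mul d1 D1, hd_mul d2 D2, hd_mul d3 D3,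
    k0.2, k1.2, k2.2, k3.2, h1, h2, h3, hA]
  unfold nsq dotQ imI imJ imK
  ring

lemma sum_hd_Df_sq (β : Fin n) (g : QH n) :
    ∑ k, hd (Pi.single β (basisQ k)) Df g ^ 2 = 16 * (Df g * nsq (g.1 β)) := by
  simp only [hd_Df_single, Fin.sum_univ_four]
  have hD : Df g = Af g ^ 2 + (g.2.1 ^ 2 + g.2.2.1 ^ 2 + g.2.2.2 ^ 2) := rfl
  simp [basisQ, dotQ, imI, imJ, imK, nsq, tC, xC, yC, zC, hD]
  ring

/-- Deviation of `u` from being a multiple of `Df ^ (-(n+1))`. -/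
noncomputable def defect (n : ℕ) (u : QH n → ℝ) (g : QH n) : ℝ :=
  ∑ α, ∑ k, (hd (Pi.single α (basisQ k)) u g
    + (n + 1) * (u g * (hd (Pi.single α (basisQ k)) Df g / Df g))) ^ 2

lemma contDiff_hd_Df (β : Fin n) (e : ℝ × ℝ × ℝ × ℝ) {m : WithTop ℕ∞} :
    ContDiff ℝ m (hd (Pi.single β e) (Df : QH n → ℝ)) := by
  rw [show hd (Pi.single β e) Df = fun g : QH n => 4 * (((Af g * dotQ (g.1 β) e
      + g.2.1 * imI (g.1 β) e) + g.2.2.1 * imJ (g.1 β) e) + g.2.2.2 * imK (g.1 β) e) from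
    funext (hd_Df_single β e)]
  unfold dotQ imI imJ imK
  fun_prop

lemma defect_eq {u : QH n → ℝ} (hu : ContDiff ℝ 1 u) (g : QH n) :
    defect n u g = hGradSq n u g - 16 * n * (n + 1) * (u g ^ 2 / Df g)
      + ∑ α, ∑ k, hd (Pi.single α (basisQ k))
        (fun g => (n + 1) * (u g ^ 2 * (hd (Pi.single α (basisQ k)) Df g / Df g))) g := by
  have key : ∀ (α : Fin n) (k : Fin 4), (hd (Pi.single α (basisQ k)) u g
      + (n + 1) * (u g * (hd (Pi.single α (basisQ k)) Df g / Df g))) ^ 2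
      = hd (Pi.single α (basisQ k)) u g ^ 2 + hd (Pi.single α (basisQ k))
        (fun g => (n + 1) * (u g ^ 2 * (hd (Pi.single α (basisQ k)) Df g / Df g))) g
        + ((n + 1) * (n + 2) * (hd (Pi.single α (basisQ k)) Df g ^ 2) * (u g ^ 2 / Df g ^ 2)
          - (n + 1) * (8 * nsq (g.1 α) + 4 * Af g) * (u g ^ 2 / Df g)) := by
    intro α k
    have du := differentiableAt_of_contDiff hu g
    have dD := differentiableAt_of_contDiff (contDiff_Df (n := n)) g
    have dh := differentiableAt_of_contDiff (contDiff_hd_Df α (basisQ k)) g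
    have dq : DifferentiableAt ℝ (fun g => hd (Pi.single α (basisQ k)) Df g / Df g) g :=
      differentiableAt_of_contDiff ((contDiff_hd_Df α (basisQ k)).div contDiff_Df Df_ne) g
    have h1 := hd_hd_Df α (basisQ k) g
    rw [nsq_basisQ] at h1
    simp only [sq (u _)]
    rw [hd_const_mul _ (by fun_prop), hd_mul (by fun_prop) dq, hd_mul du du, hd_div dh dD (Df_ne g),
      h1]
    field_simp [Df_ne g]
    ring
  unfold defect
  simp only [key, Finset.sum_add_distrib, Finset.sum_sub_distrib, hGradSq_eq, ← Finset.sum_mul,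
    ← Finset.mul_sum, sum_hd_Df_sq]
  have : ∑ α, nsq (g.1 α) = Af g - 1 := by unfold Af qSq nsq; ring
  simp [← Finset.mul_sum, ← Finset.sum_mul, Finset.sum_add_distrib, this]
  field_simp [Df_ne g]
  ring

/-- Ground state representation of the conformally weighted energy. -/
lemma integral_defect {u : QH n → ℝ} (hu : ContDiff ℝ 1 u) (hs : HasCompactSupport u) :
    ∫ g, defect n u g = (∫ g, hGradSq n u g) - 16 * n * (n + 1) * ∫ g, u g ^ 2 / Df g := by
  have hc : ∀ (α : Fin n) (k : Fin 4), ContDiff ℝ 1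
      (fun g => (n + 1) * (u g ^ 2 * (hd (Pi.single α (basisQ k)) Df g / Df g))) := fun α k =>
    contDiff_const.mul ((hu.pow 2).mul ((contDiff_hd_Df α (basisQ k)).div contDiff_Df Df_ne))
  have hcs : ∀ (α : Fin n) (k : Fin 4), HasCompactSupport
      (fun g => (n + 1) * (u g ^ 2 * (hd (Pi.single α (basisQ k)) Df g / Df g))) := fun α k => by
    refine hs.mono ?_
    intro g hg h
    exact hg (by simp [h])
  have i1 : Integrable (hGradSq n u) :=
    (continuous_hGradSq hu).integrable_of_hasCompactSupport (hasCompactSupport_hGradSq hs)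
  have i2 : Integrable (fun g => u g ^ 2 / Df g) := by
    refine ((hu.continuous.pow 2).div (contDiff_Df (m := 0)).continuous Df_ne
      ).integrable_of_hasCompactSupport (hs.mono ?_)
    intro g hg h
    exact hg (by simp [h])
  have i3 : ∀ (α : Fin n) (k : Fin 4), Integrable (hd (Pi.single α (basisQ k))
      (fun g => (n + 1) * (u g ^ 2 * (hd (Pi.single α (basisQ k)) Df g / Df g)))) := fun α k =>
    (continuous_hd _ (hc α k)).integrable_of_hasCompactSupport (hasCompactSupport_hd _ (hcs α k))
  have i4 : Integrable (fun g => hGradSq n u g - 16 * n * (n + 1) * (u g ^ 2 / Df g)) :=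
    i1.sub (i2.const_mul _)
  simp only [defect_eq hu]
  rw [integral_add i4 (integrable_finsetSum _ fun α _ =>
      integrable_finsetSum _ fun k _ => i3 α k), integral_sub i1 (i2.const_mul _),
    integral_const_mul, integral_finsetSum _ fun α _ => integrable_finsetSum _ fun k _ => i3 α k]
  have : ∀ α : Fin n, ∫ g, ∑ k, hd (Pi.single α (basisQ k))
      (fun g => (n + 1) * (u g ^ 2 * (hd (Pi.single α (basisQ k)) Df g / Df g))) g = 0 := by
    intro α
    rw [integral_finsetSum _ fun k _ => i3 α k]
    exact Finset.sum_eq_zero fun k _ => integral_hd _ (hc α k) (hcs α k)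
  simp [this]

/-- The horizontal energy density of `Df ^ (n+1) * u`. -/
lemma hGradSq_Df_pow_mul {u : QH n → ℝ} (hu : ContDiff ℝ 1 u) (g : QH n) :
    hGradSq n (fun g => Df g ^ (n + 1) * u g) g = (Df g ^ (n + 1)) ^ 2 * defect n u g := by
  simp only [hGradSq_eq, defect, Finset.mul_sum]
  refine Finset.sum_congr rfl fun α _ => Finset.sum_congr rfl fun k _ => ?_
  have du := differentiableAt_of_contDiff hu g
  have dD := differentiableAt_of_contDiff (contDiff_Df (n := n)) g
  rw [hd_mul (by fun_prop) du, hd_comp (f := fun y => y ^ (n + 1)) (hasDerivAt_pow (n + 1) (Df g)) dD]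
  have := Df_ne g
  simp only [Nat.add_sub_cancel]
  push_cast
  rw [pow_succ]
  field_simp
  ring

lemma defect_nonneg (u : QH n → ℝ) (g : QH n) : 0 ≤ defect n u g := by
  unfold defect; positivity

end GroundState

section Translations

variable {n : ℕ}

lemma measurePreserving_shear (a : Fin n → ℝ × ℝ × ℝ × ℝ)
    (l : (Fin n → ℝ × ℝ × ℝ × ℝ) → ℝ × ℝ × ℝ) (hl : Continuous l) :
    MeasurePreserving (fun g : QH n => ((g.1 + a, g.2 + l g.1) : QH n)) := by
  have : (volume : Measure (Fin n → ℝ × ℝ × ℝ × ℝ)).IsAddHaarMeasure :=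
    isAddHaar_volume_pi (isAddHaar_volume_prod inferInstance
      (isAddHaar_volume_prod inferInstance (isAddHaar_volume_prod inferInstance inferInstance)))
  have : (volume : Measure (ℝ × ℝ × ℝ)).IsAddHaarMeasure :=
    isAddHaar_volume_prod inferInstance (isAddHaar_volume_prod inferInstance inferInstance)
  refine MeasurePreserving.skew_product (μa := volume) (μb := volume) (μc := volume)
    (μd := volume) (f := fun q : Fin n → ℝ × ℝ × ℝ × ℝ => q + a) (g := fun q w => w + l q)
    (measurePreserving_add_right volume a) ?_ ?_
  · exact (continuous_snd.add (hl.comp continuous_fst)).measurable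
  · exact Filter.Eventually.of_forall fun q => (measurePreserving_add_right volume (l q)).map_eq

lemma measurePreserving_op_left (a : QH n) : MeasurePreserving (op n a) := by
  have := measurePreserving_shear a.1
    (fun q => (a.2.1 + 2 * ∑ α, imI (a.1 α) (q α), a.2.2.1 + 2 * ∑ α, imJ (a.1 α) (q α),
      a.2.2.2 + 2 * ∑ α, imK (a.1 α) (q α)))
    (by unfold imI imJ imK tC xC yC zC; fun_prop)
  convert this using 1
  funext g
  refine Prod.ext (add_comm _ _) (Prod.ext ?_ (Prod.ext ?_ ?_)) <;> simp [op] <;> ring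

lemma measurePreserving_op_right (h : QH n) : MeasurePreserving (fun g => op n g h) := by
  have := measurePreserving_shear h.1
    (fun q => (h.2.1 + 2 * ∑ α, imI (q α) (h.1 α), h.2.2.1 + 2 * ∑ α, imJ (q α) (h.1 α),
      h.2.2.2 + 2 * ∑ α, imK (q α) (h.1 α)))
    (by unfold imI imJ imK tC xC yC zC; fun_prop)
  convert this using 1
  funext g
  refine Prod.ext ?_ (Prod.ext ?_ (Prod.ext ?_ ?_)) <;> simp [op] <;> ring

@[fun_prop] lemma contDiff_op {m : WithTop ℕ∞} :
    ContDiff ℝ m (fun x : QH n × QH n => op n x.1 x.2) := by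
  unfold op imI imJ imK tC xC yC zC
  fun_prop

lemma continuous_op : Continuous (fun x : QH n × QH n => op n x.1 x.2) :=
  (contDiff_op (m := 0)).continuous

lemma op_assoc (a b c : QH n) : op n (op n a b) c = op n a (op n b c) := by
  have hI : ∀ x y z : ℝ × ℝ × ℝ × ℝ, imI (x + y) z = imI x z + imI y z ∧
      imI x (y + z) = imI x y + imI x z := by
    intro x y z; simp [imI, tC, xC, yC, zC]; constructor <;> ring
  have hJ : ∀ x y z : ℝ × ℝ × ℝ × ℝ, imJ (x + y) z = imJ x z + imJ y z ∧
      imJ x (y + z) = imJ x y + imJ x z := by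
    intro x y z; simp [imJ, tC, xC, yC, zC]; constructor <;> ring
  have hK : ∀ x y z : ℝ × ℝ × ℝ × ℝ, imK (x + y) z = imK x z + imK y z ∧
      imK x (y + z) = imK x y + imK x z := by
    intro x y z; simp [imK, tC, xC, yC, zC]; constructor <;> ring
  refine Prod.ext (add_assoc _ _ _) (Prod.ext ?_ (Prod.ext ?_ ?_)) <;>
  simp only [op, Pi.add_apply, (hI _ _ _).1, (hI _ _ _).2, (hJ _ _ _).1, (hJ _ _ _).2,
    (hK _ _ _).1, (hK _ _ _).2, Finset.sum_add_distrib] <;> ring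

/-- Inverse for the group law. -/
def inv (g : QH n) : QH n := -g

lemma im_self (x : ℝ × ℝ × ℝ × ℝ) : imI x x = 0 ∧ imJ x x = 0 ∧ imK x x = 0 := by
  simp only [imI, imJ, imK]
  refine ⟨?_, ?_, ?_⟩ <;> ring

lemma im_neg (x y : ℝ × ℝ × ℝ × ℝ) :
    imI (-x) y = -imI x y ∧ imJ (-x) y = -imJ x y ∧ imK (-x) y = -imK x y ∧
    imI x (-y) = -imI x y ∧ imJ x (-y) = -imJ x y ∧ imK x (-y) = -imK x y := by
  simp [imI, imJ, imK, tC, xC, yC, zC]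
  refine ⟨?_, ?_, ?_, ?_, ?_, ?_⟩ <;> ring

lemma op_inv (g : QH n) : op n g (inv g) = 0 := by
  refine Prod.ext ?_ (Prod.ext ?_ (Prod.ext ?_ ?_)) <;> simp [op, inv, im_self, im_neg]

lemma inv_op (g : QH n) : op n (inv g) g = 0 := by
  refine Prod.ext ?_ (Prod.ext ?_ (Prod.ext ?_ ?_)) <;> simp [op, inv, im_self, im_neg]

lemma zero_op (g : QH n) : op n 0 g = g := by
  refine Prod.ext ?_ (Prod.ext ?_ (Prod.ext ?_ ?_)) <;> simp [op, imI, imJ, imK, tC, xC, yC, zC]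

lemma op_zero (g : QH n) : op n g 0 = g := by
  refine Prod.ext ?_ (Prod.ext ?_ (Prod.ext ?_ ?_)) <;> simp [op, imI, imJ, imK, tC, xC, yC, zC]

lemma op_inv_op (a g : QH n) : op n a (op n (inv a) g) = g := by
  rw [← op_assoc, op_inv, zero_op]

lemma inv_op_op (a g : QH n) : op n (inv a) (op n a g) = g := by
  rw [← op_assoc, inv_op, zero_op]

/-- Left translation as a homeomorphism. -/
def opHomeo (a : QH n) : QH n ≃ₜ QH n where
  toFun := op n a
  invFun := op n (inv a)
  left_inv := inv_op_op a
  right_inv := op_inv_op a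
  continuous_toFun := continuous_op.comp (continuous_const.prodMk continuous_id)
  continuous_invFun := continuous_op.comp (continuous_const.prodMk continuous_id)

lemma op_horizontal (a : Fin n → ℝ × ℝ × ℝ × ℝ) (g : QH n) : op n g (a, 0) = g + hvec a g := by
  refine Prod.ext ?_ (Prod.ext ?_ (Prod.ext ?_ ?_)) <;> simp [op, hvec]

lemma hvec_smul (a : Fin n → ℝ × ℝ × ℝ × ℝ) (s : ℝ) (g : QH n) :
    hvec (s • a) g = s • hvec a g := by
  refine Prod.ext rfl (Prod.ext ?_ (Prod.ext ?_ ?_)) <;>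
  simp only [hvec, imI, imJ, imK, tC, xC, yC, zC, Pi.smul_apply, Prod.smul_fst, Prod.smul_snd,
    smul_eq_mul, Finset.mul_sum] <;>
  refine Finset.sum_congr rfl fun α _ => ?_ <;> ring

lemma hvec_flow (a : Fin n → ℝ × ℝ × ℝ × ℝ) (s : ℝ) (g : QH n) :
    hvec a (g + s • hvec a g) = hvec a g := by
  refine Prod.ext rfl (Prod.ext ?_ (Prod.ext ?_ ?_)) <;>
  simp only [hvec, imI, imJ, imK, tC, xC, yC, zC, Pi.smul_apply, Prod.smul_fst, Prod.smul_snd,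
    smul_eq_mul, Finset.mul_sum, Prod.fst_add, Prod.snd_add, Pi.add_apply] <;>
  refine Finset.sum_congr rfl fun α _ => ?_ <;> ring

lemma op_flow (a : QH n) (b : Fin n → ℝ × ℝ × ℝ × ℝ) (s : ℝ) (g : QH n) :
    op n a (g + s • hvec b g) = op n a g + s • hvec b (op n a g) := by
  rw [← hvec_smul, ← op_horizontal, ← op_assoc, op_horizontal, hvec_smul]

lemma hd_op (a : QH n) (b : Fin n → ℝ × ℝ × ℝ × ℝ) {u : QH n → ℝ} (hu : ContDiff ℝ 1 u)
    (g : QH n) : hd b (fun x => u (op n a x)) g = hd b u (op n a g) := by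
  have h1 : ContDiff ℝ 1 (fun x => u (op n a x)) :=
    hu.comp (contDiff_op.comp (contDiff_const.prodMk contDiff_id))
  refine hd_of_line (differentiableAt_of_contDiff h1 g) ?_
  simp only [op_flow]
  exact (differentiableAt_of_contDiff hu (op n a g)).hasFDerivAt.hasLineDerivAt _

lemma hGradSq_op (a : QH n) {u : QH n → ℝ} (hu : ContDiff ℝ 1 u)
    (g : QH n) : hGradSq n (fun x => u (op n a x)) g = hGradSq n u (op n a g) := by
  simp only [hGradSq_eq, hd_op a _ hu]

lemma dil_eq (lam : ℝ) (g : QH n) : dil n lam g = (lam • g.1, lam ^ 2 • g.2) := rfl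

@[fun_prop] lemma contDiff_dil {m : WithTop ℕ∞} :
    ContDiff ℝ m (fun x : ℝ × QH n => dil n x.1 x.2) := by
  simp only [dil_eq]; fun_prop

lemma dil_flow (lam : ℝ) (b : Fin n → ℝ × ℝ × ℝ × ℝ) (s : ℝ) (g : QH n) :
    dil n lam (g + s • hvec b g) = dil n lam g + (s * lam) • hvec b (dil n lam g) := by
  refine Prod.ext ?_ (Prod.ext ?_ (Prod.ext ?_ ?_)) <;>
  simp only [dil_eq, hvec, imI, imJ, imK, tC, xC, yC, zC, Pi.smul_apply, Prod.smul_fst,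
    Prod.smul_snd, smul_eq_mul, Prod.fst_add, Prod.snd_add, smul_add, smul_smul, Finset.mul_sum,
    mul_add]
  · rw [mul_comm]
  all_goals
    congr 1
    refine Finset.sum_congr rfl fun α _ => ?_
    ring

lemma hd_dil (lam : ℝ) (b : Fin n → ℝ × ℝ × ℝ × ℝ) {u : QH n → ℝ} (hu : ContDiff ℝ 1 u)
    (g : QH n) : hd b (fun x => u (dil n lam x)) g = lam * hd b u (dil n lam g) := by
  have h1 : ContDiff ℝ 1 (fun x => u (dil n lam x)) :=
    hu.comp (contDiff_dil.comp (contDiff_const.prodMk contDiff_id))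
  refine hd_of_line (differentiableAt_of_contDiff h1 g) ?_
  simp only [dil_flow, mul_smul]
  have := (differentiableAt_of_contDiff hu (dil n lam g)).hasFDerivAt.hasLineDerivAt
    (lam • hvec b (dil n lam g))
  rw [map_smul] at this
  exact this

lemma hGradSq_dil (lam : ℝ) {u : QH n → ℝ} (hu : ContDiff ℝ 1 u)
    (g : QH n) : hGradSq n (fun x => u (dil n lam x)) g = lam ^ 2 * hGradSq n u (dil n lam g) := by
  simp only [hGradSq_eq, hd_dil lam _ hu, mul_pow, Finset.mul_sum]

lemma dil_dil (a b : ℝ) (g : QH n) : dil n a (dil n b g) = dil n (a * b) g := by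
  simp [dil_eq, smul_smul, mul_pow]

lemma dil_one (g : QH n) : dil n 1 g = g := by simp [dil_eq]

lemma dil_op (lam : ℝ) (a g : QH n) : dil n lam (op n a g) = op n (dil n lam a) (dil n lam g) := by
  refine Prod.ext ?_ (Prod.ext ?_ (Prod.ext ?_ ?_)) <;>
  simp only [dil_eq, op, imI, imJ, imK, tC, xC, yC, zC, Pi.smul_apply, Prod.smul_fst,
    Prod.smul_snd, smul_eq_mul, smul_add, Finset.mul_sum, mul_add]
  all_goals
    congr 1
    refine Finset.sum_congr rfl fun α _ => ?_
    ring

lemma map_dil {lam : ℝ} (hl : 0 < lam) : Measure.map (dil n lam) (volume : Measure (QH n))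
    = ENNReal.ofReal ((lam ^ (4 * n + 6))⁻¹) • volume := by
  have : (volume : Measure (Fin n → ℝ × ℝ × ℝ × ℝ)).IsAddHaarMeasure :=
    isAddHaar_volume_pi (isAddHaar_volume_prod inferInstance
      (isAddHaar_volume_prod inferInstance (isAddHaar_volume_prod inferInstance inferInstance)))
  have : (volume : Measure (ℝ × ℝ × ℝ)).IsAddHaarMeasure :=
    isAddHaar_volume_prod inferInstance (isAddHaar_volume_prod inferInstance inferInstance)
  have h1 := Measure.map_addHaar_smul (volume : Measure (Fin n → ℝ × ℝ × ℝ × ℝ)) hl.ne'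
  have h2 := Measure.map_addHaar_smul (volume : Measure (ℝ × ℝ × ℝ)) (pow_pos hl 2).ne'
  have h3 : dil n lam = Prod.map (fun q : Fin n → ℝ × ℝ × ℝ × ℝ => lam • q)
    (fun w : ℝ × ℝ × ℝ => lam ^ 2 • w) := rfl
  rw [h3, Measure.volume_eq_prod, ← Measure.map_prod_map volume volume
    (measurable_const_smul lam) (measurable_const_smul _), h1, h2, Measure.prod_smul_left,
    Measure.prod_smul_right, smul_smul, ← ENNReal.ofReal_mul (abs_nonneg _), ← abs_mul,
    abs_of_pos (by positivity)]
  congr 3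
  simp [Module.finrank_pi_fintype]
  rw [← pow_mul, ← mul_inv, ← pow_add]
  congr 2
  ring

lemma measurableEmbedding_dil {lam : ℝ} (hl : 0 < lam) : MeasurableEmbedding (dil n lam) := by
  have hc : ∀ r, Continuous (dil n r) := fun r =>
    (contDiff_dil (m := 0)).continuous.comp (continuous_const.prodMk continuous_id)
  let e : QH n ≃ₜ QH n :=
    { toFun := dil n lam
      invFun := dil n lam⁻¹
      left_inv := fun g => by rw [dil_dil, inv_mul_cancel₀ hl.ne', dil_one]
      right_inv := fun g => by rw [dil_dil, mul_inv_cancel₀ hl.ne', dil_one]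
      continuous_toFun := hc _
      continuous_invFun := hc _ }
  exact e.measurableEmbedding

lemma integral_dil {lam : ℝ} (hl : 0 < lam) (f : QH n → ℝ) :
    ∫ g, f (dil n lam g) = (lam ^ (4 * n + 6))⁻¹ * ∫ g, f g := by
  rw [← (measurableEmbedding_dil hl).integral_map, map_dil hl, integral_smul_measure,
    ENNReal.toReal_ofReal (by positivity), smul_eq_mul]

lemma lintegral_dil {lam : ℝ} (hl : 0 < lam) (f : QH n → ENNReal) :
    ∫⁻ g, f (dil n lam g) = ENNReal.ofReal ((lam ^ (4 * n + 6))⁻¹) * ∫⁻ g, f g := by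
  rw [← (measurableEmbedding_dil hl).lintegral_map, map_dil hl, lintegral_smul_measure, smul_eq_mul]

lemma integral_op (a : QH n) (f : QH n → ℝ) : ∫ g, f (op n a g) = ∫ g, f g :=
  (measurePreserving_op_left a).integral_comp (opHomeo a).measurableEmbedding f

end Translations

section TranslationBounds

variable {n : ℕ}

instance instSigmaFiniteQH : SigmaFinite (volume : Measure (QH n)) :=
  Measure.IsAddHaarMeasure.sigmaFinite _

lemma sq_intervalIntegral_le {f : ℝ → ℝ} (hf : Continuous f) :
    (∫ s in (0 : ℝ)..1, f s) ^ 2 ≤ ∫ s in (0 : ℝ)..1, f s ^ 2 := by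
  set m := ∫ s in (0 : ℝ)..1, f s with hm
  have h0 : 0 ≤ ∫ s in (0 : ℝ)..1, (f s - m) ^ 2 :=
    intervalIntegral.integral_nonneg zero_le_one fun _ _ => sq_nonneg _
  have h1 : ∀ s, (f s - m) ^ 2 = f s ^ 2 - 2 * m * f s + m ^ 2 := fun s => by ring
  simp only [h1] at h0
  have i1 : IntervalIntegrable (fun s => f s ^ 2 - 2 * m * f s) volume 0 1 :=
    ((hf.pow 2).sub (continuous_const.mul hf)).intervalIntegrable _ _
  have i2 : IntervalIntegrable (fun s => f s ^ 2) volume 0 1 :=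
    (hf.pow 2).intervalIntegrable _ _
  have i3 : IntervalIntegrable (fun s => 2 * m * f s) volume 0 1 :=
    (continuous_const.mul hf).intervalIntegrable _ _
  rw [intervalIntegral.integral_add i1 (continuous_const.intervalIntegrable _ _),
    intervalIntegral.integral_sub i2 i3, intervalIntegral.integral_const_mul,
    ← hm] at h0
  simp at h0
  nlinarith

lemma continuous_hvec (a : Fin n → ℝ × ℝ × ℝ × ℝ) : Continuous (hvec (n := n) a) := by
  unfold hvec imI imJ imK tC xC yC zC
  fun_prop

lemma continuous_flow (a : Fin n → ℝ × ℝ × ℝ × ℝ) :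
    Continuous (fun x : QH n × ℝ => x.1 + x.2 • hvec a x.1) :=
  continuous_fst.add (continuous_snd.smul ((continuous_hvec a).comp continuous_fst))

lemma sq_sub_le_lintegral {v : QH n → ℝ} (hv : ContDiff ℝ 1 v) (a : Fin n → ℝ × ℝ × ℝ × ℝ)
    {R : ℝ} (ha : ∑ α, nsq (a α) ≤ R) (g : QH n) :
    ENNReal.ofReal ((v (g + hvec a g) - v g) ^ 2) ≤ ENNReal.ofReal R *
      ∫⁻ s in Set.Icc (0 : ℝ) 1, ENNReal.ofReal (hGradSq n v (g + s • hvec a g)) := by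
  have hR : 0 ≤ R := le_trans (Finset.sum_nonneg fun α _ => nsq_nonneg _) ha
  have hfl : Continuous (fun s : ℝ => g + s • hvec a g) :=
    (continuous_flow a).comp (continuous_const.prodMk continuous_id)
  have hder : ∀ s : ℝ, HasDerivAt (fun s : ℝ => v (g + s • hvec a g))
      (hd a v (g + s • hvec a g)) s := by
    intro s
    have h1 := (differentiableAt_of_contDiff hv (g + s • hvec a g)).hasFDerivAt
    have h2 : HasDerivAt (fun s : ℝ => g + s • hvec a g) (hvec a g) s := by
      simpa using ((hasDerivAt_id s).smul_const (hvec a g)).const_add g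
    have h3 := h1.comp_hasDerivAt s h2
    unfold hd
    rw [hvec_flow]
    exact h3
  have hc : Continuous (fun s : ℝ => hd a v (g + s • hvec a g)) := (continuous_hd a hv).comp hfl
  have hG : Continuous (fun s : ℝ => hGradSq n v (g + s • hvec a g)) :=
    (continuous_hGradSq hv).comp hfl
  have h4 := intervalIntegral.integral_eq_sub_of_hasDerivAt (a := 0) (b := 1)
    (fun s _ => hder s) (hc.intervalIntegrable _ _)
  simp only [one_smul, zero_smul, add_zero] at h4
  have h5 : (v (g + hvec a g) - v g) ^ 2 ≤ R * ∫ s in (0 : ℝ)..1, hGradSq n v (g + s • hvec a g) := by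
    rw [← h4, ← intervalIntegral.integral_const_mul]
    refine (sq_intervalIntegral_le hc).trans ?_
    refine intervalIntegral.integral_mono zero_le_one ((hc.pow 2).intervalIntegrable _ _)
      ((continuous_const.mul hG).intervalIntegrable _ _) fun s => ?_
    exact (hd_sq_le a v _).trans (mul_le_mul_of_nonneg_right ha (hGradSq_nonneg _ _))
  refine (ENNReal.ofReal_le_ofReal h5).trans ?_
  rw [ENNReal.ofReal_mul hR, intervalIntegral.integral_of_le zero_le_one,
    ← integral_Icc_eq_integral_Ioc, ofReal_integral_eq_lintegral_ofReal]
  · exact hG.continuousOn.integrableOn_Icc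
  · exact Filter.Eventually.of_forall fun _ => hGradSq_nonneg _ _

/-- Right translation by `h` moves functions on `S` by at most `M` times the energy on `T`. -/
def TransBound (M : ENNReal) (S T : Set (QH n)) (h : QH n) : Prop :=
  ∀ v : QH n → ℝ, ContDiff ℝ 1 v →
    ∫⁻ g in S, ENNReal.ofReal ((v (op n g h) - v g) ^ 2)
      ≤ M * ∫⁻ g in T, ENNReal.ofReal (hGradSq n v g)

lemma transBound_horizontal {S T : Set (QH n)} (hS : MeasurableSet S) (hT : MeasurableSet T)
    (a : Fin n → ℝ × ℝ × ℝ × ℝ) {R : ℝ} (ha : ∑ α, nsq (a α) ≤ R)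
    (hST : ∀ g ∈ S, ∀ s ∈ Set.Icc (0 : ℝ) 1, g + s • hvec a g ∈ T) :
    TransBound (ENNReal.ofReal R) S T (a, 0) := by
  intro v hv
  have hm : Measurable (fun g : QH n => ENNReal.ofReal (hGradSq n v g)) :=
    (continuous_hGradSq hv).measurable.ennreal_ofReal
  have hm2 : Measurable (fun x : QH n × ℝ =>
      ENNReal.ofReal (hGradSq n v (x.1 + x.2 • hvec a x.1))) :=
    hm.comp (continuous_flow a).measurable
  calc ∫⁻ g in S, ENNReal.ofReal ((v (op n g (a, 0)) - v g) ^ 2)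
      ≤ ∫⁻ g in S, ENNReal.ofReal R *
        ∫⁻ s in Set.Icc (0 : ℝ) 1, ENNReal.ofReal (hGradSq n v (g + s • hvec a g)) := by
        refine lintegral_mono fun g => ?_
        rw [op_horizontal]
        exact sq_sub_le_lintegral hv a ha g
    _ = ENNReal.ofReal R * ∫⁻ g in S,
        ∫⁻ s in Set.Icc (0 : ℝ) 1, ENNReal.ofReal (hGradSq n v (g + s • hvec a g)) := by
        rw [lintegral_const_mul' _ _ ENNReal.ofReal_ne_top]
    _ = ENNReal.ofReal R * ∫⁻ s in Set.Icc (0 : ℝ) 1, ∫⁻ g in S,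
          ENNReal.ofReal (hGradSq n v (g + s • hvec a g)) := by
        rw [lintegral_lintegral_swap hm2.aemeasurable]
    _ ≤ ENNReal.ofReal R * ∫⁻ s in Set.Icc (0 : ℝ) 1, ∫⁻ g in T, ENNReal.ofReal (hGradSq n v g) := by
        gcongr ENNReal.ofReal R * ?_
        refine setLIntegral_mono measurable_const fun s hs => ?_
        have hmp := measurePreserving_op_right (n := n) (s • a, 0)
        simp only [op_horizontal, hvec_smul] at hmp
        rw [← lintegral_indicator hS, ← lintegral_indicator hT,
          ← hmp.lintegral_comp (hm.indicator hT)]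
        refine lintegral_mono fun g => ?_
        by_cases hg : g ∈ S
        · rw [Set.indicator_of_mem hg, Set.indicator_of_mem (hST g hg s hs)]
        · rw [Set.indicator_of_notMem hg]; exact zero_le
    _ = ENNReal.ofReal R * ∫⁻ g in T, ENNReal.ofReal (hGradSq n v g) := by
        simp

lemma ofReal_add_sq_le (a b : ℝ) : ENNReal.ofReal ((a + b) ^ 2)
    ≤ 2 * (ENNReal.ofReal (a ^ 2) + ENNReal.ofReal (b ^ 2)) := by
  rw [← ENNReal.ofReal_add (sq_nonneg _) (sq_nonneg _), show (2 : ENNReal) = ENNReal.ofReal 2 by simp,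
    ← ENNReal.ofReal_mul zero_le_two]
  exact ENNReal.ofReal_le_ofReal (by nlinarith [sq_nonneg (a - b)])

lemma TransBound.comp {S S' T : Set (QH n)} {M M' : ENNReal} {h h' : QH n}
    (hS : MeasurableSet S) (hS' : MeasurableSet S')
    (H : TransBound M S T h) (H' : TransBound M' S' T h') (hSS : ∀ g ∈ S, op n g h ∈ S') :
    TransBound (2 * (M + M')) S T (op n h h') := by
  intro v hv
  have hco : ∀ k : QH n, Continuous (fun g => op n g k) := fun k =>
    continuous_op.comp (continuous_id.prodMk continuous_const)
  have m1 : Measurable (fun g => ENNReal.ofReal ((v (op n g h) - v g) ^ 2)) :=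
    (((hv.continuous.comp (hco h)).sub hv.continuous).pow 2).measurable.ennreal_ofReal
  have m2 : Measurable (fun g => ENNReal.ofReal ((v (op n g h') - v g) ^ 2)) :=
    (((hv.continuous.comp (hco h')).sub hv.continuous).pow 2).measurable.ennreal_ofReal
  calc ∫⁻ g in S, ENNReal.ofReal ((v (op n g (op n h h')) - v g) ^ 2)
      ≤ ∫⁻ g in S, 2 * (ENNReal.ofReal ((v (op n g h) - v g) ^ 2)
          + ENNReal.ofReal ((v (op n (op n g h) h') - v (op n g h)) ^ 2)) := by
        refine lintegral_mono fun g => ?_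
        refine le_trans (le_of_eq ?_) (ofReal_add_sq_le _ _)
        rw [op_assoc]; congr 2; ring
    _ = 2 * ((∫⁻ g in S, ENNReal.ofReal ((v (op n g h) - v g) ^ 2))
          + ∫⁻ g in S, ENNReal.ofReal ((v (op n (op n g h) h') - v (op n g h)) ^ 2)) := by
        rw [lintegral_const_mul' _ _ (by simp), lintegral_add_left m1]
    _ ≤ 2 * ((∫⁻ g in S, ENNReal.ofReal ((v (op n g h) - v g) ^ 2))
          + ∫⁻ g in S', ENNReal.ofReal ((v (op n g h') - v g) ^ 2)) := by
        gcongr 2 * (_ + ?_)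
        rw [← lintegral_indicator hS, ← lintegral_indicator hS',
          ← (measurePreserving_op_right h).lintegral_comp (m2.indicator hS')]
        refine lintegral_mono fun g => ?_
        by_cases hg : g ∈ S
        · rw [Set.indicator_of_mem hg, Set.indicator_of_mem (hSS g hg)]
        · rw [Set.indicator_of_notMem hg]; exact zero_le
    _ ≤ 2 * (M * (∫⁻ g in T, ENNReal.ofReal (hGradSq n v g))
          + M' * ∫⁻ g in T, ENNReal.ofReal (hGradSq n v g)) := by
        gcongr
        · exact H v hv
        · exact H' v hv
    _ = _ := by ring

/-- Every group element is a product of five horizontal ones. -/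
lemma eq_op_horizontal (β : Fin n) (h : QH n) (c d : Fin n → ℝ × ℝ × ℝ × ℝ)
    (hc : c = Pi.single β (0, h.2.1 / 4, h.2.2.1 / 4, h.2.2.2 / 4))
    (hd : d = Pi.single β (1, 0, 0, 0)) :
    op n (h.1, 0) (op n (c, 0) (op n (d, 0) (op n (-c, 0) (-d, 0)))) = h := by
  have hs : ∀ F : (ℝ × ℝ × ℝ × ℝ) → (ℝ × ℝ × ℝ × ℝ) → ℝ, (∀ y, F 0 y = 0) →
      ∀ a b : ℝ × ℝ × ℝ × ℝ, ∑ α, F ((Pi.single β a : Fin n → ℝ × ℝ × ℝ × ℝ) α)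
        ((Pi.single β b : Fin n → ℝ × ℝ × ℝ × ℝ) α) = F a b := by
    intro F hF a b
    rw [Finset.sum_eq_single β]
    · simp
    · intro x _ hx; rw [Pi.single_eq_of_ne hx, hF]
    · simp
  have z : ∀ y, imI 0 y = 0 ∧ imJ 0 y = 0 ∧ imK 0 y = 0 := by
    intro y; simp [imI, imJ, imK, tC, xC, yC, zC]
  have key : op n (c, 0) (op n (d, 0) (op n (-c, 0) (-d, 0))) = (0, h.2) := by
    subst hc hd
    simp only [← Pi.single_neg, op, ← Pi.single_add]
    rw [hs imI (fun y => (z y).1), hs imJ (fun y => (z y).2.1), hs imK (fun y => (z y).2.2),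
      hs imI (fun y => (z y).1), hs imJ (fun y => (z y).2.1), hs imK (fun y => (z y).2.2),
      hs imI (fun y => (z y).1), hs imJ (fun y => (z y).2.1), hs imK (fun y => (z y).2.2)]
    refine Prod.ext ?_ (Prod.ext ?_ (Prod.ext ?_ ?_))
    · simp
    all_goals
      simp [imI, imJ, imK, tC, xC, yC, zC]; ring
  rw [key]
  refine Prod.ext ?_ (Prod.ext ?_ (Prod.ext ?_ ?_)) <;>
    simp [op, imI, imJ, imK, tC, xC, yC, zC]

lemma sum_nsq_single (β : Fin n) (e : ℝ × ℝ × ℝ × ℝ) :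
    ∑ α, nsq ((Pi.single β e : Fin n → ℝ × ℝ × ℝ × ℝ) α) = nsq e :=
  sum_single (fun _ b => nsq b) (fun _ => by simp [nsq, tC, xC, yC, zC]) β e

/-- Translation bound along a chain of sets stable under short horizontal moves. -/
lemma transBound_chain (hn : 1 ≤ n) (S : ℕ → Set (QH n)) (hS : ∀ i, MeasurableSet (S i)) {R : ℝ}
    (hR : 1 ≤ R) (hchain : ∀ i, ∀ g ∈ S i, ∀ a : Fin n → ℝ × ℝ × ℝ × ℝ, ∑ α, nsq (a α) ≤ R →
      ∀ s ∈ Set.Icc (0 : ℝ) 1, g + s • hvec a g ∈ S (i + 1)) (h : QH n)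
    (h1 : ∑ α, nsq (h.1 α) ≤ R) (h2 : wSq n h ≤ 16 * R) :
    TransBound (62 * ENNReal.ofReal R) (S 0) (S 5) h := by
  let β : Fin n := ⟨0, hn⟩
  have mono : ∀ i, S i ⊆ S (i + 1) := fun i g hg => by
    simpa using hchain i g hg 0 (by simp [nsq, tC, xC, yC, zC]; linarith) 0 (by simp)
  have mono' : Monotone S := monotone_nat_of_le_succ mono
  have hB : ∀ (i : ℕ) (_ : i < 5) (a : Fin n → ℝ × ℝ × ℝ × ℝ), ∑ α, nsq (a α) ≤ R →
      TransBound (ENNReal.ofReal R) (S i) (S 5) (a, 0) := fun i hi a ha =>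
    transBound_horizontal (hS i) (hS 5) a ha fun g hg s hs =>
      mono' (by omega : i + 1 ≤ 5) (hchain i g hg a ha s hs)
  have hM : ∀ (i : ℕ) (a : Fin n → ℝ × ℝ × ℝ × ℝ), ∑ α, nsq (a α) ≤ R →
      ∀ g ∈ S i, op n g (a, 0) ∈ S (i + 1) := fun i a ha g hg => by
    rw [op_horizontal]; simpa using hchain i g hg a ha 1 (by simp)
  set c : Fin n → ℝ × ℝ × ℝ × ℝ := Pi.single β (0, h.2.1 / 4, h.2.2.1 / 4, h.2.2.2 / 4) with hc
  set d : Fin n → ℝ × ℝ × ℝ × ℝ := Pi.single β (1, 0, 0, 0) with hd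
  have nc : ∑ α, nsq (c α) ≤ R := by
    rw [hc, sum_nsq_single]; unfold wSq at h2; simp [nsq, tC, xC, yC, zC]; nlinarith
  have nd : ∑ α, nsq (d α) ≤ R := by
    rw [hd, sum_nsq_single]; simpa [nsq, tC, xC, yC, zC] using hR
  have hneg : ∀ a : Fin n → ℝ × ℝ × ℝ × ℝ, ∑ α, nsq ((-a) α) = ∑ α, nsq (a α) := fun a => by
    simp [nsq, tC, xC, yC, zC]
  have nc' : ∑ α, nsq ((-c) α) ≤ R := by rw [hneg]; exact nc
  have nd' : ∑ α, nsq ((-d) α) ≤ R := by rw [hneg]; exact nd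
  have key := (hB 0 (by omega) h.1 h1).comp (hS 0) (hS 1)
    ((hB 1 (by omega) c nc).comp (hS 1) (hS 2)
      ((hB 2 (by omega) d nd).comp (hS 2) (hS 3)
        ((hB 3 (by omega) (-c) nc').comp (hS 3) (hS 4) (hB 4 (by omega) (-d) nd')
          (hM 3 _ nc')) (hM 2 _ nd)) (hM 1 _ nc)) (hM 0 _ h1)
  rw [eq_op_horizontal β h c d hc hd] at key
  intro v hv
  refine (key v hv).trans (mul_le_mul' ?_ le_rfl)
  have : ∀ x : ENNReal, 2 * (x + 2 * (x + 2 * (x + 2 * (x + x)))) = 46 * x := fun x => by ring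
  rw [this]
  gcongr
  norm_num

end TranslationBounds

section Sobolev

variable {n : ℕ}

/-- The unit box for the homogeneous structure. -/
def box (n : ℕ) : Set (QH n) := {h | ∑ α, nsq (h.1 α) ≤ 1 ∧ wSq n h ≤ 16}

lemma sum_nsq_eq (h : QH n) : ∑ α, nsq (h.1 α) = qSq n h := rfl

lemma continuous_qSq : Continuous (qSq n) := by unfold qSq tC xC yC zC; fun_prop

lemma continuous_wSq : Continuous (wSq n) := by unfold wSq; fun_prop

lemma continuous_dil (lam : ℝ) : Continuous (dil n lam) :=
  (contDiff_dil (m := 0)).continuous.comp (continuous_const.prodMk continuous_id)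

lemma isClosed_box : IsClosed (box n) :=
  (isClosed_le continuous_qSq continuous_const).inter (isClosed_le continuous_wSq continuous_const)

lemma abs_le_of_sq_le {x r : ℝ} (hr : 0 ≤ r) (h : x ^ 2 ≤ r ^ 2) : |x| ≤ r := abs_le_of_sq_le_sq h hr

lemma norm_le_of_qSq_wSq {r : ℝ} (hr : 0 ≤ r) {h : QH n} (h1 : qSq n h ≤ r ^ 2)
    (h2 : wSq n h ≤ r ^ 2) : ‖h‖ ≤ r := by
  have hq : ∀ α, nsq (h.1 α) ≤ r ^ 2 := fun α =>
    le_trans (Finset.single_le_sum (f := fun α => nsq (h.1 α)) (fun _ _ => nsq_nonneg _)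
      (Finset.mem_univ α)) h1
  unfold wSq at h2
  rw [Prod.norm_def, max_le_iff]
  constructor
  · rw [pi_norm_le_iff_of_nonneg hr]
    intro α
    have := hq α
    unfold nsq tC xC yC zC at this
    simp only [Prod.norm_def, max_le_iff, Real.norm_eq_abs]
    refine ⟨?_, ?_, ?_, ?_⟩ <;> refine abs_le_of_sq_le hr ?_ <;> nlinarith [sq_nonneg (h.1 α).1,
      sq_nonneg (h.1 α).2.1, sq_nonneg (h.1 α).2.2.1, sq_nonneg (h.1 α).2.2.2]
  · simp only [Prod.norm_def, max_le_iff, Real.norm_eq_abs]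
    refine ⟨?_, ?_, ?_⟩ <;> refine abs_le_of_sq_le hr ?_ <;> nlinarith [sq_nonneg h.2.1,
      sq_nonneg h.2.2.1, sq_nonneg h.2.2.2]

lemma volume_box_lt_top : volume (box n) < ⊤ := by
  refine (measure_mono ?_).trans_lt (measure_closedBall_lt_top (x := (0 : QH n)) (r := 4))
  intro h hh
  rw [mem_closedBall_zero_iff]
  have h1 : qSq n h ≤ 1 := hh.1
  exact norm_le_of_qSq_wSq (by norm_num) (by linarith) (by linarith [hh.2])

lemma volume_box_pos : 0 < volume (box n) := by
  refine lt_of_lt_of_le ?_ (measure_mono (s := {h : QH n | qSq n h < 1 ∧ wSq n h < 16}) ?_)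
  · refine IsOpen.measure_pos _ ((isOpen_lt continuous_qSq continuous_const).inter
      (isOpen_lt continuous_wSq continuous_const)) ⟨0, ?_⟩
    simp [qSq, wSq, tC, xC, yC, zC]
  · intro h hh
    exact ⟨le_of_lt hh.1, le_of_lt hh.2⟩

lemma transBound_box (hn : 1 ≤ n) {h : QH n} (hh : h ∈ box n) :
    TransBound 62 Set.univ Set.univ h := by
  have := transBound_chain hn (fun _ => Set.univ) (fun _ => MeasurableSet.univ) (R := 1) le_rfl
    (fun _ _ _ _ _ _ _ => Set.mem_univ _) h hh.1 (by linarith [hh.2])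
  simpa using this

lemma lintegral_sq_le_of_dil (hn : 1 ≤ n) {r : ℝ} (hr : 0 < r) {h : QH n} (hh : dil n r⁻¹ h ∈ box n)
    {v : QH n → ℝ} (hv : ContDiff ℝ 1 v) :
    ∫⁻ g, ENNReal.ofReal ((v (op n g h) - v g) ^ 2)
      ≤ 62 * ENNReal.ofReal (r ^ 2) * ∫⁻ g, ENNReal.ofReal (hGradSq n v g) := by
  have h1 : ContDiff ℝ 1 (fun x => v (dil n r x)) :=
    hv.comp (contDiff_dil.comp (contDiff_const.prodMk contDiff_id))
  have key := transBound_box hn hh _ h1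
  simp only [hGradSq_dil r hv, dil_op, dil_dil, mul_inv_cancel₀ hr.ne', dil_one,
    Measure.restrict_univ, ENNReal.ofReal_mul (sq_nonneg r)] at key
  rw [lintegral_dil hr (fun g => ENNReal.ofReal ((v (op n g h) - v g) ^ 2)),
    lintegral_dil hr (fun g => ENNReal.ofReal (r ^ 2) * ENNReal.ofReal (hGradSq n v g)),
    lintegral_const_mul' _ _ ENNReal.ofReal_ne_top, mul_left_comm] at key
  have hpos : 0 < (r ^ (4 * n + 6))⁻¹ := by positivity
  rw [ENNReal.mul_le_mul_iff_right (ENNReal.ofReal_pos.2 hpos).ne' ENNReal.ofReal_ne_top] at key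
  rwa [mul_assoc]

lemma exists_truncation : ∃ (σ : ℝ → ℝ) (L : ℝ), 0 < L ∧ ContDiff ℝ 1 σ ∧
    (∀ s, |s| ≤ 1 → σ s = 0) ∧ (∀ s, 2 ≤ |s| → σ s = 1) ∧ (∀ s, |deriv σ s| ≤ L) ∧
    (∀ s, deriv σ s ≠ 0 → 1 ≤ |s| ∧ |s| ≤ 2) := by
  set σ : ℝ → ℝ := fun s => Real.smoothTransition ((s ^ 2 - 1) / 3) with hσ
  have hc : ContDiff ℝ 1 σ := Real.smoothTransition.contDiff.comp (by fun_prop)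
  have h0 : ∀ s : ℝ, |s| ≤ 1 → σ s = 0 := fun s hs => by
    refine Real.smoothTransition.zero_of_nonpos ?_
    have := sq_abs s
    nlinarith [abs_nonneg s]
  have h1 : ∀ s : ℝ, 2 ≤ |s| → σ s = 1 := fun s hs => by
    refine Real.smoothTransition.one_of_one_le ?_
    have := sq_abs s
    nlinarith [abs_nonneg s]
  have hd0 : ∀ s, deriv σ s ≠ 0 → 1 ≤ |s| ∧ |s| ≤ 2 := by
    intro s hs
    by_contra hcon
    apply hs
    rw [not_and_or, not_le, not_le] at hcon
    rcases hcon with h | h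
    · have : σ =ᶠ[nhds s] fun _ => 0 := by
        filter_upwards [(isOpen_lt continuous_abs continuous_const).mem_nhds h] with x hx
        exact h0 x (le_of_lt hx)
      rw [this.deriv_eq, deriv_const]
    · have : σ =ᶠ[nhds s] fun _ => 1 := by
        filter_upwards [(isOpen_lt continuous_const continuous_abs).mem_nhds h] with x hx
        exact h1 x (le_of_lt hx)
      rw [this.deriv_eq, deriv_const]
  have hcd : Continuous (deriv σ) := hc.continuous_deriv le_rfl
  obtain ⟨L, hL⟩ := (isCompact_Icc (a := (-2 : ℝ)) (b := 2)).exists_bound_of_continuousOn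
    hcd.continuousOn
  refine ⟨σ, max L 1, by positivity, hc, h0, h1, fun s => ?_, hd0⟩
  by_cases hs : deriv σ s = 0
  · rw [hs, abs_zero]; positivity
  · exact (hL s (abs_le.1 (hd0 s hs).2)).trans (le_max_left _ _)

lemma volume_dil_preimage {r : ℝ} (hr : 0 < r) (S : Set (QH n)) (hS : MeasurableSet S) :
    volume {h | dil n r⁻¹ h ∈ S} = ENNReal.ofReal (r ^ (4 * n + 6)) * volume S := by
  have h := lintegral_dil (inv_pos.2 hr) (S.indicator (1 : QH n → ENNReal))
  rw [lintegral_indicator_one hS, inv_pow, inv_inv] at h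
  rw [← h]
  exact (lintegral_indicator_one (hS.preimage (continuous_dil r⁻¹).measurable)).symm

instance instOpensMeasurableSpaceProdQH : OpensMeasurableSpace (QH n × QH n) :=
  (Prod.borelSpace : BorelSpace (QH n × QH n)).opensMeasurable

/-- Chebyshev-type estimate on level sets. -/
lemma exists_level_estimate (hn : 1 ≤ n) : ∃ K : ℝ, 0 < K ∧ ∀ u : QH n → ℝ, ContDiff ℝ 1 u →
    HasCompactSupport u → ∀ t : ℝ, 0 < t →
    ENNReal.ofReal (t ^ 2) * volume {g | 2 * t ≤ |u g|} ≤ ENNReal.ofReal K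
      * volume {g | t < |u g|} ^ ((2 : ℝ) / (4 * n + 6))
      * ∫⁻ g in {g | t ≤ |u g| ∧ |u g| ≤ 2 * t}, ENNReal.ofReal (hGradSq n u g) := by
  obtain ⟨σ, L, hL, hσ, hσ0, hσ1, hσL, hσd⟩ := exists_truncation
  obtain ⟨κ, hκ, hκv⟩ : ∃ κ : ℝ, 0 < κ ∧ volume (box n) = ENNReal.ofReal κ :=
    ⟨(volume (box n)).toReal, ENNReal.toReal_pos volume_box_pos.ne' volume_box_lt_top.ne,
      (ENNReal.ofReal_toReal volume_box_lt_top.ne).symm⟩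
  refine ⟨124 * L ^ 2 * (2 / κ) ^ ((2 : ℝ) / (4 * n + 6)), by positivity, ?_⟩
  intro u hu hs t ht
  set T := {g | 2 * t ≤ |u g|} with hT
  set e := ∫⁻ g in {g | t ≤ |u g| ∧ |u g| ≤ 2 * t}, ENNReal.ofReal (hGradSq n u g) with he
  have hA : volume {g | t < |u g|} < ⊤ := by
    refine (measure_mono ?_).trans_lt hs.isCompact.measure_lt_top
    intro g hg
    refine subset_tsupport u ?_
    intro h
    simp only [Set.mem_ofPred_eq, h, abs_zero] at hg
    exact absurd hg (not_lt.2 ht.le)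
  by_cases hA0 : volume {g | t < |u g|} = 0
  · have : volume T = 0 := by
      refine measure_mono_null ?_ hA0
      intro g hg
      simp only [hT, Set.mem_ofPred_eq] at hg ⊢
      linarith
    rw [this, mul_zero]; exact zero_le
  obtain ⟨A, hApos, hAeq⟩ : ∃ A : ℝ, 0 < A ∧ volume {g | t < |u g|} = ENNReal.ofReal A :=
    ⟨_, ENNReal.toReal_pos hA0 hA.ne, (ENNReal.ofReal_toReal hA.ne).symm⟩
  set r : ℝ := (2 * A / κ) ^ ((1 : ℝ) / (4 * n + 6)) with hr
  have hrpos : 0 < r := by positivity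
  have hrQ : r ^ (4 * n + 6) = 2 * A / κ := by
    rw [hr, ← Real.rpow_natCast, ← Real.rpow_mul (by positivity)]
    push_cast
    rw [one_div, inv_mul_cancel₀ (by positivity), Real.rpow_one]
  have hr2 : r ^ 2 = (2 * A / κ) ^ ((2 : ℝ) / (4 * n + 6)) := by
    rw [hr, ← Real.rpow_natCast, ← Real.rpow_mul (by positivity)]
    congr 1; push_cast; ring
  set B : Set (QH n) := {h | dil n r⁻¹ h ∈ box n} with hB
  have hBm : MeasurableSet B := isClosed_box.measurableSet.preimage (continuous_dil r⁻¹).measurable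
  have hBv : volume B = ENNReal.ofReal (2 * A) := by
    rw [hB, volume_dil_preimage hrpos _ isClosed_box.measurableSet, hκv, hrQ,
      ← ENNReal.ofReal_mul (by positivity)]
    congr 1; field_simp
  set f : QH n → ℝ := fun g => t * σ (u g / t) with hf
  have hfc : ContDiff ℝ 1 f := contDiff_const.mul (hσ.comp (hu.div_const t))
  have hfG : ∫⁻ g, ENNReal.ofReal (hGradSq n f g) ≤ ENNReal.ofReal (L ^ 2) * e := by
    rw [he, ← lintegral_const_mul' _ _ ENNReal.ofReal_ne_top, ← lintegral_indicator]
    · refine lintegral_mono fun g => ?_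
      have hder : HasDerivAt (fun y => t * σ (y / t)) (deriv σ (u g / t)) (u g) := by
        have h1 : HasDerivAt σ (deriv σ (u g / t)) (u g / t) :=
          (hσ.differentiable one_ne_zero _).hasDerivAt
        have h2 := (h1.comp (u g) ((hasDerivAt_id (u g)).div_const t)).const_mul t
        rw [one_div, mul_comm (deriv σ _), mul_inv_cancel_left₀ ht.ne'] at h2
        exact h2
      have hG : hGradSq n f g = (deriv σ (u g / t)) ^ 2 * hGradSq n u g := by
        simp only [hGradSq_eq, Finset.mul_sum, ← mul_pow]
        refine Finset.sum_congr rfl fun α _ => Finset.sum_congr rfl fun k _ => ?_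
        rw [hf, hd_comp hder (differentiableAt_of_contDiff hu g)]
      by_cases hd0 : deriv σ (u g / t) = 0
      · simp only [hG, hd0]
        simp
      · have h3 := hσd _ hd0
        rw [abs_div, abs_of_pos ht, le_div_iff₀ ht, div_le_iff₀ ht, one_mul] at h3
        have hmem : g ∈ {g | t ≤ |u g| ∧ |u g| ≤ 2 * t} := h3
        rw [Set.indicator_of_mem hmem, ← ENNReal.ofReal_mul (sq_nonneg _), hG]
        refine ENNReal.ofReal_le_ofReal (mul_le_mul_of_nonneg_right ?_ (hGradSq_nonneg _ _))
        rw [← sq_abs]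
        exact pow_le_pow_left₀ (abs_nonneg _) (hσL _) 2
    · exact ((isClosed_le continuous_const hu.continuous.abs).inter
        (isClosed_le hu.continuous.abs continuous_const)).measurableSet
  have hTm : MeasurableSet T := (isClosed_le continuous_const hu.continuous.abs).measurableSet
  have hm2 : Measurable (fun x : QH n × QH n => ENNReal.ofReal ((f (op n x.1 x.2) - f x.1) ^ 2)) :=
    ((((hfc.continuous.comp continuous_op).sub
      (hfc.continuous.comp continuous_fst)).pow 2).measurable).ennreal_ofReal
  have up : ∫⁻ h in B, ∫⁻ g, ENNReal.ofReal ((f (op n g h) - f g) ^ 2)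
      ≤ 62 * ENNReal.ofReal (r ^ 2) * (ENNReal.ofReal (L ^ 2) * e) * ENNReal.ofReal (2 * A) := by
    rw [← hBv, ← setLIntegral_const]
    refine setLIntegral_mono measurable_const fun h hh => ?_
    exact (lintegral_sq_le_of_dil hn hrpos hh hfc).trans (mul_le_mul' le_rfl hfG)
  have low : ENNReal.ofReal (t ^ 2) * ENNReal.ofReal A * volume T
      ≤ ∫⁻ h in B, ∫⁻ g, ENNReal.ofReal ((f (op n g h) - f g) ^ 2) := by
    rw [lintegral_lintegral_swap (f := fun h g => ENNReal.ofReal ((f (op n g h) - f g) ^ 2))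
      (hm2.comp measurable_swap).aemeasurable, ← setLIntegral_const]
    refine (setLIntegral_mono' hTm fun g hg => ?_).trans (setLIntegral_le_lintegral T _)
    have hset : MeasurableSet {h | |u (op n g h)| ≤ t} :=
      (isClosed_le ((hu.continuous.comp (opHomeo g).continuous).abs) continuous_const).measurableSet
    have hfg : f g = t := by
      simp only [hf]
      rw [hσ1 _ (by rw [abs_div, abs_of_pos ht, le_div_iff₀ ht]; exact hg), mul_one]
    have hvol : ENNReal.ofReal A ≤ volume (B ∩ {h | |u (op n g h)| ≤ t}) := by
      have h1 : volume B ≤ volume (B ∩ {h | |u (op n g h)| ≤ t})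
          + volume (op n g ⁻¹' {x | t < |u x|}) := by
        refine (measure_mono ?_).trans (measure_union_le _ _)
        intro h hh
        by_cases hc : |u (op n g h)| ≤ t
        · exact Or.inl ⟨hh, hc⟩
        · exact Or.inr (not_le.1 hc)
      rw [(measurePreserving_op_left g).measure_preimage
        (isOpen_lt continuous_const hu.continuous.abs).measurableSet.nullMeasurableSet, hAeq, hBv,
        two_mul, ENNReal.ofReal_add hApos.le hApos.le] at h1
      exact (ENNReal.add_le_add_iff_right ENNReal.ofReal_ne_top).1 h1
    calc ENNReal.ofReal (t ^ 2) * ENNReal.ofReal A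
        ≤ ENNReal.ofReal (t ^ 2) * volume (B ∩ {h | |u (op n g h)| ≤ t}) := by gcongr
      _ = ∫⁻ _ in B ∩ {h | |u (op n g h)| ≤ t}, ENNReal.ofReal (t ^ 2) := by rw [setLIntegral_const]
      _ ≤ ∫⁻ h in B ∩ {h | |u (op n g h)| ≤ t}, ENNReal.ofReal ((f (op n g h) - f g) ^ 2) := by
          refine setLIntegral_mono' (hBm.inter hset) fun h hh => ?_
          have : f (op n g h) = 0 := by
            simp only [hf]
            rw [hσ0 _ (by rw [abs_div, abs_of_pos ht, div_le_one ht]; exact hh.2), mul_zero]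
          rw [this, hfg, zero_sub, neg_sq]
      _ ≤ ∫⁻ h in B, ENNReal.ofReal ((f (op n g h) - f g) ^ 2) :=
          lintegral_mono_set Set.inter_subset_left
  have fin := low.trans up
  rw [hAeq, ENNReal.ofReal_rpow_of_pos hApos, ENNReal.ofReal_mul zero_le_two] at *
  have hne : ENNReal.ofReal A ≠ 0 := (ENNReal.ofReal_pos.2 hApos).ne'
  have fin2 : ENNReal.ofReal A * (ENNReal.ofReal (t ^ 2) * volume T)
      ≤ ENNReal.ofReal A * (124 * ENNReal.ofReal (r ^ 2) * ENNReal.ofReal (L ^ 2) * e) := by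
    calc _ = ENNReal.ofReal (t ^ 2) * ENNReal.ofReal A * volume T := by ring
      _ ≤ _ := fin
      _ = _ := by rw [show ENNReal.ofReal 2 = 2 by simp]; ring
  rw [ENNReal.mul_le_mul_iff_right hne ENNReal.ofReal_ne_top] at fin2
  refine fin2.trans (le_of_eq ?_)
  rw [← ENNReal.ofReal_mul (by positivity), show (124 : ENNReal) = ENNReal.ofReal 124 by simp,
    ← ENNReal.ofReal_mul (by positivity), ← ENNReal.ofReal_mul (by positivity)]
  congr 2
  rw [hr2, mul_div_right_comm, Real.mul_rpow (by positivity) hApos.le]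
  ring

end Sobolev

section SobolevInequality

variable {n : ℕ}

/-- The critical Sobolev exponent. -/
noncomputable def pS (n : ℕ) : ℝ := 2 + 1 / ((n : ℝ) + 1)

/-- The `p`-th power of the `L^p` norm for the critical exponent. -/
noncomputable def Nf (n : ℕ) (u : QH n → ℝ) : ℝ := ∫ g, |u g| ^ pS n

/-- The horizontal Dirichlet energy. -/
noncomputable def Ef (n : ℕ) (u : QH n → ℝ) : ℝ := ∫ g, hGradSq n u g

lemma two_lt_pS : 2 < pS n := by unfold pS; have : (0 : ℝ) < 1 / ((n : ℝ) + 1) := by positivity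
                                 linarith

lemma pS_pos : 0 < pS n := two_pos.trans two_lt_pS

lemma pS_theta : pS n * (2 / (4 * n + 6)) = pS n - 2 := by
  unfold pS
  field_simp
  ring

lemma one_sub_theta : 1 - (2 : ℝ) / (4 * n + 6) = 2 / pS n := by
  unfold pS
  field_simp
  ring

lemma continuous_abs_rpow {u : QH n → ℝ} (hu : Continuous u) {p : ℝ} (hp : 0 ≤ p) :
    Continuous (fun g => |u g| ^ p) :=
  hu.abs.rpow_const fun _ => Or.inr hp

lemma hasCompactSupport_abs_rpow {u : QH n → ℝ} (hs : HasCompactSupport u) {p : ℝ} (hp : p ≠ 0) :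
    HasCompactSupport (fun g => |u g| ^ p) :=
  hs.comp_left (g := fun y => |y| ^ p) (by simp [Real.zero_rpow hp])

lemma integrable_abs_rpow {u : QH n → ℝ} (hu : Continuous u) (hs : HasCompactSupport u) {p : ℝ}
    (hp : 0 < p) : Integrable (fun g => |u g| ^ p) :=
  (continuous_abs_rpow hu hp.le).integrable_of_hasCompactSupport
    (hasCompactSupport_abs_rpow hs hp.ne')

lemma integrable_hGradSq {u : QH n → ℝ} (hu : ContDiff ℝ 1 u) (hs : HasCompactSupport u) :
    Integrable (hGradSq n u) :=
  (continuous_hGradSq hu).integrable_of_hasCompactSupport (hasCompactSupport_hGradSq hs)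

lemma Nf_nonneg (u : QH n → ℝ) : 0 ≤ Nf n u :=
  integral_nonneg fun _ => Real.rpow_nonneg (abs_nonneg _) _

lemma Ef_nonneg (u : QH n → ℝ) : 0 ≤ Ef n u := integral_nonneg fun _ => hGradSq_nonneg _ _

lemma ofReal_Nf {u : QH n → ℝ} (hu : Continuous u) (hs : HasCompactSupport u) :
    ENNReal.ofReal (Nf n u) = ∫⁻ g, ENNReal.ofReal (|u g| ^ pS n) :=
  ofReal_integral_eq_lintegral_ofReal (integrable_abs_rpow hu hs pS_pos)
    (Filter.Eventually.of_forall fun _ => Real.rpow_nonneg (abs_nonneg _) _)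

lemma ofReal_Ef {u : QH n → ℝ} (hu : ContDiff ℝ 1 u) (hs : HasCompactSupport u) :
    ENNReal.ofReal (Ef n u) = ∫⁻ g, ENNReal.ofReal (hGradSq n u g) :=
  ofReal_integral_eq_lintegral_ofReal (integrable_hGradSq hu hs)
    (Filter.Eventually.of_forall fun _ => hGradSq_nonneg _ _)

lemma setLIntegral_inv_le_one {y : ℝ} (hy : 0 ≤ y) :
    ∫⁻ t in Set.Ioi (0 : ℝ), {t : ℝ | t ≤ y ∧ y ≤ 2 * t}.indicator
      (fun t => ENNReal.ofReal t⁻¹) t ≤ 1 := by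
  rcases hy.eq_or_lt with rfl | hy
  · refine le_of_eq_of_le (setLIntegral_eq_zero measurableSet_Ioi fun t ht => ?_) zero_le_one
    refine Set.indicator_of_notMem ?_ _
    rintro ⟨h, -⟩
    exact absurd ht (not_lt.2 h)
  · have hm : MeasurableSet (Set.Icc (y / 2) y) := measurableSet_Icc
    calc _ ≤ ∫⁻ t in Set.Ioi (0 : ℝ), (Set.Icc (y / 2) y).indicator
          (fun _ => ENNReal.ofReal (2 / y)) t := by
          refine lintegral_mono fun t => ?_
          by_cases ht : t ≤ y ∧ y ≤ 2 * t
          · rw [Set.indicator_of_mem (show t ∈ {t : ℝ | t ≤ y ∧ y ≤ 2 * t} from ht),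
              Set.indicator_of_mem (show t ∈ Set.Icc (y / 2) y from ⟨by linarith [ht.2], ht.1⟩)]
            refine ENNReal.ofReal_le_ofReal ?_
            rw [inv_eq_one_div, div_le_div_iff₀ (by linarith [ht.2]) hy]
            linarith [ht.2]
          · rw [Set.indicator_of_notMem (show t ∉ {t : ℝ | t ≤ y ∧ y ≤ 2 * t} from ht)]
            exact zero_le
      _ ≤ ∫⁻ t, (Set.Icc (y / 2) y).indicator (fun _ => ENNReal.ofReal (2 / y)) t :=
          setLIntegral_le_lintegral _ _
      _ = 1 := by
          rw [lintegral_indicator hm, setLIntegral_const, Real.volume_Icc,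
            ← ENNReal.ofReal_mul (by positivity)]
          rw [show 2 / y * (y - y / 2) = 1 by field_simp; ring, ENNReal.ofReal_one]

/-- The Sobolev inequality with some positive constant. -/
lemma exists_sobolev (hn : 1 ≤ n) : ∃ c : ℝ, 0 < c ∧ ∀ u : QH n → ℝ, ContDiff ℝ 1 u →
    HasCompactSupport u → c * Nf n u ^ (2 / pS n) ≤ Ef n u := by
  obtain ⟨K, hK, hlev⟩ := exists_level_estimate hn
  set p := pS n with hp
  have hp0 : 0 < p := pS_pos
  set θ : ℝ := 2 / (4 * n + 6) with hθ
  have hθ0 : 0 < θ := by positivity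
  refine ⟨(2 ^ p * p * K)⁻¹, by positivity, fun u hu hs => ?_⟩
  rw [inv_mul_le_iff₀ (by positivity)]
  rcases (Nf_nonneg u).eq_or_lt with h0 | hN
  · rw [← h0, Real.zero_rpow (by positivity)]
    exact mul_nonneg (by positivity) (Ef_nonneg u)
  have hNl := ofReal_Nf hu.continuous hs
  set N := Nf n u with hNdef
  -- the layer cake formula for `|u| / 2`
  have lc : ENNReal.ofReal ((2 ^ p)⁻¹) * ENNReal.ofReal N = ENNReal.ofReal p *
      ∫⁻ t in Set.Ioi (0 : ℝ), volume {g | t ≤ |u g| / 2} * ENNReal.ofReal (t ^ (p - 1)) := by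
    rw [← lintegral_rpow_eq_lintegral_meas_le_mul volume
      (Filter.Eventually.of_forall fun g => by positivity)
      ((hu.continuous.abs.div_const 2).measurable.aemeasurable) hp0, hNl,
      ← lintegral_const_mul' _ _ ENNReal.ofReal_ne_top]
    refine lintegral_congr fun g => ?_
    rw [← ENNReal.ofReal_mul (by positivity), Real.div_rpow (abs_nonneg _) zero_le_two,
      div_eq_inv_mul]
  have cheb : ∀ t : ℝ, 0 < t → volume {g | t < |u g|} ≤ ENNReal.ofReal (t ^ (-p) * N) := by
    intro t ht
    have h1 : ENNReal.ofReal (t ^ p) * volume {g | t < |u g|} ≤ ENNReal.ofReal N := by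
      rw [hNl]
      refine (mul_le_mul' le_rfl (measure_mono ?_)).trans (mul_meas_ge_le_lintegral
        ((continuous_abs_rpow hu.continuous hp0.le).measurable.ennreal_ofReal) _)
      intro g hg
      exact ENNReal.ofReal_le_ofReal (Real.rpow_le_rpow ht.le (le_of_lt hg) hp0.le)
    calc volume {g | t < |u g|} = ENNReal.ofReal (t ^ (-p)) *
          (ENNReal.ofReal (t ^ p) * volume {g | t < |u g|}) := by
          rw [← mul_assoc, ← ENNReal.ofReal_mul (by positivity), ← Real.rpow_add ht,
            neg_add_cancel, Real.rpow_zero, ENNReal.ofReal_one, one_mul]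
      _ ≤ ENNReal.ofReal (t ^ (-p)) * ENNReal.ofReal N := by gcongr
      _ = _ := (ENNReal.ofReal_mul (by positivity)).symm
  have lvl : ∀ t : ℝ, 0 < t → volume {g | t ≤ |u g| / 2} * ENNReal.ofReal (t ^ (p - 1))
      ≤ ENNReal.ofReal (K * N ^ θ) * (ENNReal.ofReal t⁻¹ *
        ∫⁻ g in {g | t ≤ |u g| ∧ |u g| ≤ 2 * t}, ENNReal.ofReal (hGradSq n u g)) := by
    intro t ht
    have e1 : {g | t ≤ |u g| / 2} = {g | 2 * t ≤ |u g|} := by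
      ext g
      simp only [Set.mem_ofPred_eq]
      constructor <;> intro h <;> linarith
    have e2 : t ^ (p - 1) = t ^ (p - 3) * t ^ 2 := by
      rw [← Real.rpow_natCast, ← Real.rpow_add ht]; congr 1; push_cast; ring
    have e3 : volume {g | t < |u g|} ^ θ ≤ ENNReal.ofReal (t ^ (2 - p) * N ^ θ) := by
      refine (ENNReal.rpow_le_rpow (cheb t ht) hθ0.le).trans (le_of_eq ?_)
      rw [ENNReal.ofReal_rpow_of_nonneg (by positivity) hθ0.le, Real.mul_rpow (by positivity) hN.le,
        ← Real.rpow_mul ht.le]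
      congr 3
      have := pS_theta (n := n)
      rw [← hp, ← hθ] at this
      linarith
    rw [e1, e2, ENNReal.ofReal_mul (by positivity)]
    calc _ = ENNReal.ofReal (t ^ (p - 3)) *
          (ENNReal.ofReal (t ^ 2) * volume {g | 2 * t ≤ |u g|}) := by ring
      _ ≤ ENNReal.ofReal (t ^ (p - 3)) * (ENNReal.ofReal K * ENNReal.ofReal (t ^ (2 - p) * N ^ θ) *
          ∫⁻ g in {g | t ≤ |u g| ∧ |u g| ≤ 2 * t}, ENNReal.ofReal (hGradSq n u g)) := by
          refine mul_le_mul' le_rfl ((hlev u hu hs t ht).trans ?_)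
          gcongr
      _ = _ := by
          rw [← mul_assoc, ← mul_assoc, ← mul_assoc]
          congr 1
          rw [← ENNReal.ofReal_mul (by positivity), ← ENNReal.ofReal_mul (by positivity),
            ← ENNReal.ofReal_mul (by positivity)]
          congr 1
          have : t⁻¹ = t ^ (p - 3) * t ^ (2 - p) := by
            rw [← Real.rpow_add ht, ← Real.rpow_neg_one]; congr 1; ring
          rw [this]; ring
  have ton : ∫⁻ t in Set.Ioi (0 : ℝ), (ENNReal.ofReal t⁻¹ *
      ∫⁻ g in {g | t ≤ |u g| ∧ |u g| ≤ 2 * t}, ENNReal.ofReal (hGradSq n u g))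
      ≤ ENNReal.ofReal (Ef n u) := by
    have hSm : MeasurableSet {x : ℝ × QH n | x.1 ≤ |u x.2| ∧ |u x.2| ≤ 2 * x.1} := by
      have hm : Measurable (fun x : ℝ × QH n => |u x.2|) :=
        (hu.continuous.abs.measurable).comp measurable_snd
      exact (measurableSet_le measurable_fst hm).inter
        (measurableSet_le hm (measurable_fst.const_mul 2))
    have hGm : Measurable (fun g => ENNReal.ofReal (hGradSq n u g)) :=
      (continuous_hGradSq hu).measurable.ennreal_ofReal
    have hFm : Measurable ({x : ℝ × QH n | x.1 ≤ |u x.2| ∧ |u x.2| ≤ 2 * x.1}.indicator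
        (fun x => ENNReal.ofReal x.1⁻¹ * ENNReal.ofReal (hGradSq n u x.2))) :=
      ((measurable_fst.inv.ennreal_ofReal).mul (hGm.comp measurable_snd)).indicator hSm
    calc _ = ∫⁻ t in Set.Ioi (0 : ℝ), ∫⁻ g,
          {x : ℝ × QH n | x.1 ≤ |u x.2| ∧ |u x.2| ≤ 2 * x.1}.indicator
            (fun x => ENNReal.ofReal x.1⁻¹ * ENNReal.ofReal (hGradSq n u x.2)) (t, g) := by
          refine lintegral_congr fun t => ?_
          have hS : MeasurableSet {g | t ≤ |u g| ∧ |u g| ≤ 2 * t} :=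
            ((isClosed_le continuous_const hu.continuous.abs).inter
              (isClosed_le hu.continuous.abs continuous_const)).measurableSet
          rw [← lintegral_const_mul' _ _ ENNReal.ofReal_ne_top, ← lintegral_indicator hS]
          rfl
      _ = ∫⁻ g, ∫⁻ t in Set.Ioi (0 : ℝ),
          {x : ℝ × QH n | x.1 ≤ |u x.2| ∧ |u x.2| ≤ 2 * x.1}.indicator
            (fun x => ENNReal.ofReal x.1⁻¹ * ENNReal.ofReal (hGradSq n u x.2)) (t, g) :=
          lintegral_lintegral_swap hFm.aemeasurable
      _ ≤ ∫⁻ g, ENNReal.ofReal (hGradSq n u g) := by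
          refine lintegral_mono fun g => ?_
          calc _ = ∫⁻ t in Set.Ioi (0 : ℝ), ENNReal.ofReal (hGradSq n u g) *
                {t : ℝ | t ≤ |u g| ∧ |u g| ≤ 2 * t}.indicator
                  (fun t => ENNReal.ofReal t⁻¹) t := by
                refine lintegral_congr fun t => ?_
                by_cases ht : t ≤ |u g| ∧ |u g| ≤ 2 * t
                · rw [Set.indicator_of_mem (show (t, g) ∈ {x : ℝ × QH n |
                    x.1 ≤ |u x.2| ∧ |u x.2| ≤ 2 * x.1} from ht),
                    Set.indicator_of_mem (show t ∈ {t : ℝ | t ≤ |u g| ∧ |u g| ≤ 2 * t} from ht), mul_comm]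
                · rw [Set.indicator_of_notMem (show (t, g) ∉ {x : ℝ × QH n |
                    x.1 ≤ |u x.2| ∧ |u x.2| ≤ 2 * x.1} from ht),
                    Set.indicator_of_notMem (show t ∉ {t : ℝ | t ≤ |u g| ∧ |u g| ≤ 2 * t} from ht), mul_zero]
            _ ≤ ENNReal.ofReal (hGradSq n u g) * 1 := by
                rw [lintegral_const_mul' _ _ ENNReal.ofReal_ne_top]
                exact mul_le_mul' le_rfl (setLIntegral_inv_le_one (abs_nonneg _))
            _ = _ := mul_one _
      _ = _ := (ofReal_Ef hu hs).symm
  have tot : ENNReal.ofReal ((2 ^ p)⁻¹ * N) ≤ ENNReal.ofReal (p * (K * N ^ θ * Ef n u)) := by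
    rw [ENNReal.ofReal_mul (by positivity), lc, ENNReal.ofReal_mul hp0.le,
      ENNReal.ofReal_mul (p := K * N ^ θ) (by positivity)]
    refine mul_le_mul' le_rfl ?_
    refine (setLIntegral_mono' measurableSet_Ioi fun t ht => lvl t ht).trans ?_
    rw [lintegral_const_mul' _ _ ENNReal.ofReal_ne_top]
    exact mul_le_mul' le_rfl ton
  rw [ENNReal.ofReal_le_ofReal_iff (mul_nonneg hp0.le (mul_nonneg (by positivity) (Ef_nonneg u))),
    inv_mul_le_iff₀ (by positivity)] at tot
  have h1 : N = N ^ θ * N ^ (2 / p) := by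
    rw [← Real.rpow_add hN, hp, ← one_sub_theta (n := n), ← hθ]
    simp
  have hNθ : 0 < N ^ θ := by positivity
  refine le_of_mul_le_mul_left ?_ hNθ
  calc N ^ θ * N ^ (2 / p) = N := h1.symm
    _ ≤ _ := tot
    _ = _ := by ring

end SobolevInequality

section Minimizers

variable {n : ℕ}

lemma Nf_const_mul (c : ℝ) (u : QH n → ℝ) :
    Nf n (fun g => c * u g) = |c| ^ pS n * Nf n u := by
  unfold Nf
  rw [← integral_const_mul]
  congr 1
  ext g
  rw [abs_mul, Real.mul_rpow (abs_nonneg _) (abs_nonneg _)]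

lemma hGradSq_const_mul (c : ℝ) {u : QH n → ℝ} (hu : ContDiff ℝ 1 u) (g : QH n) :
    hGradSq n (fun g => c * u g) g = c ^ 2 * hGradSq n u g := by
  simp only [hGradSq_eq, hd_const_mul c (differentiableAt_of_contDiff hu g), mul_pow,
    Finset.mul_sum]

lemma Ef_const_mul (c : ℝ) {u : QH n → ℝ} (hu : ContDiff ℝ 1 u) :
    Ef n (fun g => c * u g) = c ^ 2 * Ef n u := by
  unfold Ef
  simp only [hGradSq_const_mul c hu]
  rw [integral_const_mul]

lemma exists_normalize {u : QH n → ℝ} (hu : ContDiff ℝ 1 u) (hs : HasCompactSupport u)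
    (hN : 0 < Nf n u) : ∃ v : QH n → ℝ, ContDiff ℝ 1 v ∧ HasCompactSupport v ∧ Nf n v = 1 ∧
      Ef n u = Nf n u ^ (2 / pS n) * Ef n v := by
  set c := Nf n u ^ (-(1 / pS n)) with hc
  have hc0 : 0 < c := by positivity
  have hp := pS_pos (n := n)
  refine ⟨fun g => c * u g, contDiff_const.mul hu, hs.mul_left, ?_, ?_⟩
  · rw [Nf_const_mul, abs_of_pos hc0, hc, ← Real.rpow_mul hN.le, neg_mul,
      one_div_mul_cancel hp.ne', Real.rpow_neg_one, inv_mul_cancel₀ hN.ne']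
  · rw [Ef_const_mul c hu, ← mul_assoc, hc, ← Real.rpow_natCast, ← Real.rpow_mul hN.le,
      ← Real.rpow_add hN]
    rw [show 2 / pS n + -(1 / pS n) * ((2 : ℕ) : ℝ) = 0 by push_cast; ring, Real.rpow_zero, one_mul]

/-- Existence of the best constant and of almost-minimizers. -/
lemma exists_best (hn : 1 ≤ n) {u₀ : QH n → ℝ} (hu₀ : ContDiff ℝ 1 u₀)
    (hs₀ : HasCompactSupport u₀) (hN₀ : 0 < Nf n u₀) :
    ∃ C : ℝ, 0 < C ∧ (∀ u : QH n → ℝ, ContDiff ℝ 1 u → HasCompactSupport u →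
      C * Nf n u ^ (2 / pS n) ≤ Ef n u) ∧
      ∀ δ > 0, ∃ u : QH n → ℝ, ContDiff ℝ 1 u ∧ HasCompactSupport u ∧ Nf n u = 1 ∧
        Ef n u < C + δ := by
  obtain ⟨c, hc, hsob⟩ := exists_sobolev hn
  set S : Set ℝ := {e | ∃ u : QH n → ℝ, ContDiff ℝ 1 u ∧ HasCompactSupport u ∧ Nf n u = 1 ∧
    Ef n u = e} with hS
  obtain ⟨v₀, hv₀, hvs₀, hvN₀, -⟩ := exists_normalize hu₀ hs₀ hN₀
  have hne : S.Nonempty := ⟨_, v₀, hv₀, hvs₀, hvN₀, rfl⟩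
  have hlow : ∀ e ∈ S, c ≤ e := by
    rintro _ ⟨u, hu, hs, hN, rfl⟩
    simpa [hN] using hsob u hu hs
  have hbdd : BddBelow S := ⟨c, hlow⟩
  refine ⟨sInf S, hc.trans_le (le_csInf hne hlow), fun u hu hs => ?_, fun δ hδ => ?_⟩
  · rcases (Nf_nonneg u).eq_or_lt with h0 | hN
    · rw [← h0, Real.zero_rpow (div_pos two_pos pS_pos).ne', mul_zero]
      exact Ef_nonneg u
    · obtain ⟨v, hv, hvs, hvN, hE⟩ := exists_normalize hu hs hN
      rw [hE, mul_comm]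
      gcongr
      exact csInf_le hbdd ⟨v, hv, hvs, hvN, rfl⟩
  · obtain ⟨_, ⟨u, hu, hs, hN, rfl⟩, hlt⟩ := exists_lt_of_csInf_lt hne (lt_add_of_pos_right _ hδ)
    exact ⟨u, hu, hs, hN, hlt⟩

/-- The action of translations and dilations preserving norm and energy. -/
noncomputable def shift (a : QH n) (lam : ℝ) (u : QH n → ℝ) (g : QH n) : ℝ :=
  lam ^ (2 * n + 2) * u (op n a (dil n lam g))

lemma contDiff_shift (a : QH n) (lam : ℝ) {u : QH n → ℝ} (hu : ContDiff ℝ 1 u) :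
    ContDiff ℝ 1 (shift a lam u) := by
  refine contDiff_const.mul (hu.comp ?_)
  exact (contDiff_op (n := n)).comp (contDiff_const.prodMk
    ((contDiff_dil (n := n)).comp (contDiff_const.prodMk contDiff_id)))

/-- Dilations as homeomorphisms. -/
noncomputable def dilHomeo {lam : ℝ} (hl : 0 < lam) : QH n ≃ₜ QH n where
  toFun := dil n lam
  invFun := dil n lam⁻¹
  left_inv g := by rw [dil_dil, inv_mul_cancel₀ hl.ne', dil_one]
  right_inv g := by rw [dil_dil, mul_inv_cancel₀ hl.ne', dil_one]
  continuous_toFun := continuous_dil lam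
  continuous_invFun := continuous_dil lam⁻¹

lemma hasCompactSupport_shift (a : QH n) {lam : ℝ} (hl : 0 < lam) {u : QH n → ℝ}
    (hs : HasCompactSupport u) : HasCompactSupport (shift a lam u) :=
  HasCompactSupport.mul_left
    ((hs.comp_homeomorph (opHomeo a)).comp_homeomorph (dilHomeo hl))

lemma abs_shift_rpow (a : QH n) {lam : ℝ} (hl : 0 < lam) (u : QH n → ℝ) (g : QH n) :
    |shift a lam u g| ^ pS n = lam ^ (4 * n + 6) * |u (op n a (dil n lam g))| ^ pS n := by
  unfold shift
  rw [abs_mul, abs_of_pos (by positivity), Real.mul_rpow (by positivity) (abs_nonneg _)]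
  congr 1
  rw [← Real.rpow_natCast, ← Real.rpow_natCast, ← Real.rpow_mul hl.le]
  congr 1
  unfold pS
  push_cast
  field_simp
  ring

lemma integral_shift (a : QH n) {lam : ℝ} (hl : 0 < lam) (f : QH n → ℝ) :
    ∫ g, lam ^ (4 * n + 6) * f (op n a (dil n lam g)) = ∫ g, f g := by
  rw [integral_const_mul, integral_dil hl (fun g => f (op n a g)), integral_op,
    mul_inv_cancel_left₀ (by positivity)]

lemma Nf_shift (a : QH n) {lam : ℝ} (hl : 0 < lam) (u : QH n → ℝ) :
    Nf n (shift a lam u) = Nf n u := by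
  unfold Nf
  simp only [abs_shift_rpow a hl]
  exact integral_shift a hl (fun g => |u g| ^ pS n)

lemma Ef_shift (a : QH n) {lam : ℝ} (hl : 0 < lam) {u : QH n → ℝ} (hu : ContDiff ℝ 1 u) :
    Ef n (shift a lam u) = Ef n u := by
  unfold Ef
  have hu' : ContDiff ℝ 1 (fun g => u (op n a g)) :=
    hu.comp ((contDiff_op (n := n)).comp (contDiff_const.prodMk contDiff_id))
  have hu'' : ContDiff ℝ 1 (fun g => u (op n a (dil n lam g))) :=
    hu'.comp ((contDiff_dil (n := n)).comp (contDiff_const.prodMk contDiff_id))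
  rw [← integral_shift a hl (hGradSq n u)]
  congr 1
  ext g
  unfold shift
  rw [hGradSq_const_mul _ hu'', hGradSq_dil lam hu' g, hGradSq_op a hu]
  ring

end Minimizers

section Centering

variable {n : ℕ}

/-- `D(δ_{1/λ} g) λ²`, the conformal factor of the dilated sphere. -/
noncomputable def Gf (lam : ℝ) (g : QH n) : ℝ := ((lam ^ 2 + qSq n g) ^ 2 + wSq n g) / lam ^ 2

lemma sq_le_Gf {lam : ℝ} (hl : 0 < lam) (g : QH n) : lam ^ 2 ≤ Gf lam g := by
  have h1 := qSq_nonneg g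
  have h2 := wSq_nonneg g
  unfold Gf
  rw [le_div_iff₀ (by positivity)]
  nlinarith [mul_nonneg (sq_nonneg lam) h1, sq_nonneg (qSq n g)]

lemma gauge_le_Gf {lam : ℝ} (hl : 0 < lam) (g : QH n) :
    (qSq n g ^ 2 + wSq n g) / lam ^ 2 ≤ Gf lam g := by
  have h1 := qSq_nonneg g
  unfold Gf
  gcongr
  nlinarith [sq_nonneg lam]

lemma Gf_pos {lam : ℝ} (hl : 0 < lam) (g : QH n) : 0 < Gf lam g :=
  lt_of_lt_of_le (by positivity) (sq_le_Gf hl g)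

lemma qSq_dil (lam : ℝ) (g : QH n) : qSq n (dil n lam g) = lam ^ 2 * qSq n g := by
  unfold qSq
  rw [Finset.mul_sum]
  refine Finset.sum_congr rfl fun α _ => ?_
  simp only [dil, tC, xC, yC, zC]
  ring

lemma wSq_dil (lam : ℝ) (g : QH n) : wSq n (dil n lam g) = lam ^ 4 * wSq n g := by
  simp only [wSq, dil]
  ring

lemma Gf_dil {lam mu : ℝ} (hl : 0 < lam) (hm : 0 < mu) (g : QH n) :
    Gf (lam * mu) (dil n lam g) = lam ^ 2 * Gf mu g := by
  unfold Gf
  rw [qSq_dil, wSq_dil]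
  field_simp

lemma Gf_one (g : QH n) : Gf 1 g = Df g := by simp [Gf, Df, Af]

/-- The function whose critical points are the centering transformations. -/
noncomputable def Psi (w : QH n → ℝ) (x : QH n × ℝ) : ℝ :=
  ∫ h, w h * Real.log (Gf (Real.exp x.2) (op n (inv x.1) h))

lemma continuous_log_Gf : Continuous (fun y : (QH n × ℝ) × QH n =>
    Real.log (Gf (Real.exp y.1.2) (op n (inv y.1.1) y.2))) := by
  have h1 : Continuous (fun y : (QH n × ℝ) × QH n => op n (inv y.1.1) y.2) :=
    continuous_op.comp (((continuous_fst.comp continuous_fst).neg).prodMk continuous_snd)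
  have h2 : Continuous (fun y : (QH n × ℝ) × QH n => Real.exp y.1.2) := by fun_prop
  refine Continuous.log ?_ fun y => (Gf_pos (Real.exp_pos _) _).ne'
  unfold Gf
  exact ((((h2.pow 2).add (continuous_qSq.comp h1)).pow 2).add (continuous_wSq.comp h1)).div
    (h2.pow 2) fun y => by positivity

lemma continuous_Psi {w : QH n → ℝ} (hw : Continuous w) (hs : HasCompactSupport w) :
    Continuous (Psi w) := by
  have hcont : Continuous (fun x : QH n × ℝ => ∫ h in tsupport w,
      w h * Real.log (Gf (Real.exp x.2) (op n (inv x.1) h))) := by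
    refine continuous_parametric_integral_of_continuous ?_ hs.isCompact
    exact (hw.comp continuous_snd).mul continuous_log_Gf
  convert hcont using 2 with x
  unfold Psi
  refine (setIntegral_eq_integral_of_forall_compl_eq_zero fun h hh => ?_).symm
  rw [image_eq_zero_of_notMem_tsupport hh, zero_mul]

lemma integrable_mul_log_Gf {w : QH n → ℝ} (hw : Continuous w) (hs : HasCompactSupport w)
    (x : QH n × ℝ) :
    Integrable (fun h => w h * Real.log (Gf (Real.exp x.2) (op n (inv x.1) h))) :=
  (hw.mul (continuous_log_Gf.comp (continuous_const.prodMk continuous_id))).integrable_of_hasCompactSupport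
    hs.mul_right

lemma isCompact_gauge (R : ℝ) : IsCompact {h : QH n | qSq n h ^ 2 + wSq n h ≤ R} := by
  refine Metric.isCompact_of_isClosed_isBounded
    (isClosed_le ((continuous_qSq.pow 2).add continuous_wSq) continuous_const) ?_
  refine (Metric.isBounded_closedBall (x := (0 : QH n)) (r := |R| + 1)).subset fun h hh => ?_
  simp only [Set.mem_ofPred_eq] at hh
  have h1 := qSq_nonneg h
  have h2 := wSq_nonneg h
  have h3 := le_abs_self R
  have h4 := abs_nonneg R
  rw [mem_closedBall_zero_iff]
  refine norm_le_of_qSq_wSq (by positivity) ?_ (by nlinarith)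
  nlinarith [sq_nonneg (qSq n h - 1)]

lemma exists_small_gauge {w : QH n → ℝ} (hw : Continuous w) (hs : HasCompactSupport w) :
    ∃ r : ℝ, 0 < r ∧ r ≤ 1 ∧ ∀ a : QH n,
      ∫ h in {h | qSq n (op n a h) ^ 2 + wSq n (op n a h) ≤ r ^ 4}, w h ≤ 1 / 4 := by
  obtain ⟨W, hW⟩ := hw.bounded_above_of_compact_support hs
  set V := (volume {h : QH n | qSq n h ^ 2 + wSq n h ≤ 1}).toReal with hV
  have hVtop := (isCompact_gauge (n := n) 1).measure_lt_top (μ := volume)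
  have hW0 : 0 ≤ W := (norm_nonneg _).trans (hW 0)
  have hV0 : 0 ≤ V := ENNReal.toReal_nonneg
  set r : ℝ := 1 / (4 * (W * V) + 1) with hr
  have hr0 : 0 < r := by positivity
  have hr1 : r ≤ 1 := by
    rw [hr, div_le_one (by positivity)]
    nlinarith [mul_nonneg hW0 hV0]
  refine ⟨r, hr0, hr1, fun a => ?_⟩
  have hset : {h : QH n | qSq n h ^ 2 + wSq n h ≤ r ^ 4}
      = {h | dil n r⁻¹ h ∈ {h : QH n | qSq n h ^ 2 + wSq n h ≤ 1}} := by
    ext h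
    simp only [Set.mem_ofPred_eq, qSq_dil, wSq_dil]
    rw [show (r⁻¹ ^ 2 * qSq n h) ^ 2 + r⁻¹ ^ 4 * wSq n h = (qSq n h ^ 2 + wSq n h) / r ^ 4 by
      field_simp, div_le_one (by positivity)]
  have hmeas : MeasurableSet {h : QH n | qSq n h ^ 2 + wSq n h ≤ r ^ 4} :=
    (isCompact_gauge _).isClosed.measurableSet
  have hvol : volume {h | qSq n (op n a h) ^ 2 + wSq n (op n a h) ≤ r ^ 4}
      = ENNReal.ofReal (r ^ (4 * n + 6)) * volume {h : QH n | qSq n h ^ 2 + wSq n h ≤ 1} := by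
    rw [← volume_dil_preimage hr0 _ (isCompact_gauge 1).isClosed.measurableSet, ← hset]
    exact (measurePreserving_op_left a).measure_preimage hmeas.nullMeasurableSet
  have hlt : volume {h | qSq n (op n a h) ^ 2 + wSq n (op n a h) ≤ r ^ 4} < ⊤ := by
    rw [hvol]; exact ENNReal.mul_lt_top ENNReal.ofReal_lt_top hVtop
  have := norm_setIntegral_le_of_norm_le_const hlt (f := w) (C := W) fun h _ => hW h
  rw [Measure.real, hvol, ENNReal.toReal_mul, ENNReal.toReal_ofReal (by positivity), ← hV] at this
  refine (le_abs_self _).trans (this.trans ?_)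
  have h1 : r ^ (4 * n + 6) ≤ r := pow_le_of_le_one hr0.le hr1 (by omega)
  calc W * (r ^ (4 * n + 6) * V) ≤ W * (r * V) := by gcongr
    _ = (W * V) * r := by ring
    _ ≤ 1 / 4 := by
      rw [hr, mul_one_div, div_le_div_iff₀ (by positivity) (by positivity)]
      linarith

lemma exists_min_Psi {w : QH n → ℝ} (hw : Continuous w) (hs : HasCompactSupport w)
    (hw0 : ∀ h, 0 ≤ w h) (hw1 : ∫ h, w h = 1) :
    ∃ x : QH n × ℝ, ∀ y, Psi w x ≤ Psi w y := by
  have hwi : Integrable w := hw.integrable_of_hasCompactSupport hs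
  obtain ⟨r, hr0, hr1, hsmall⟩ := exists_small_gauge hw hs
  have lower : ∀ (x : QH n × ℝ) (c : ℝ), (∀ h ∈ tsupport w,
      c ≤ Real.log (Gf (Real.exp x.2) (op n (inv x.1) h))) → c ≤ Psi w x := by
    intro x c hc
    calc c = ∫ h, w h * c := by rw [integral_mul_const, hw1, one_mul]
      _ ≤ Psi w x := by
        refine integral_mono (hwi.mul_const c) (integrable_mul_log_Gf hw hs x) fun h => ?_
        by_cases hh : h ∈ tsupport w
        · exact mul_le_mul_of_nonneg_left (hc h hh) (hw0 h)
        · simp [image_eq_zero_of_notMem_tsupport hh]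
  have b1 : ∀ x : QH n × ℝ, 2 * x.2 ≤ Psi w x := by
    intro x
    refine lower x _ fun h _ => ?_
    rw [Real.le_log_iff_exp_le (Gf_pos (Real.exp_pos _) _), two_mul, Real.exp_add, ← sq]
    exact sq_le_Gf (Real.exp_pos _) _
  have b2 : ∀ x : QH n × ℝ, x.2 ≤ 0 → 4 * Real.log r - x.2 ≤ Psi w x := by
    intro x hx
    set B := {h | qSq n (op n (inv x.1) h) ^ 2 + wSq n (op n (inv x.1) h) ≤ r ^ 4} with hB
    have hBm : MeasurableSet B :=
      ((isCompact_gauge (r ^ 4)).isClosed.preimage (opHomeo (inv x.1)).continuous).measurableSet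
    have hlr : Real.log r ≤ 0 := Real.log_nonpos hr0.le hr1
    have hpt : ∀ h, w h * (4 * Real.log r - 2 * x.2) + B.indicator w h * (4 * x.2)
        ≤ w h * Real.log (Gf (Real.exp x.2) (op n (inv x.1) h)) := by
      intro h
      by_cases hh : h ∈ B
      · rw [Set.indicator_of_mem hh, ← mul_add]
        refine mul_le_mul_of_nonneg_left ?_ (hw0 h)
        have : 2 * x.2 ≤ Real.log (Gf (Real.exp x.2) (op n (inv x.1) h)) := by
          rw [Real.le_log_iff_exp_le (Gf_pos (Real.exp_pos _) _), two_mul, Real.exp_add, ← sq]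
          exact sq_le_Gf (Real.exp_pos _) _
        linarith
      · rw [Set.indicator_of_notMem hh, zero_mul, add_zero]
        refine mul_le_mul_of_nonneg_left ?_ (hw0 h)
        rw [Real.le_log_iff_exp_le (Gf_pos (Real.exp_pos _) _)]
        refine le_trans ?_ (gauge_le_Gf (Real.exp_pos _) _)
        rw [Real.exp_sub, two_mul, Real.exp_add, ← sq]
        have h4 : Real.exp (4 * Real.log r) = r ^ 4 := by
          rw [mul_comm, Real.exp_mul, Real.exp_log hr0]
          norm_cast
        rw [h4]
        gcongr
        exact (not_le.1 hh).le
    have hint : Integrable (fun h => w h * (4 * Real.log r - 2 * x.2)) := hwi.mul_const _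
    have hint2 : Integrable (fun h => B.indicator w h * (4 * x.2)) :=
      (hwi.indicator hBm).mul_const _
    calc 4 * Real.log r - x.2
        ≤ 1 * (4 * Real.log r - 2 * x.2) + (∫ h in B, w h) * (4 * x.2) := by
          nlinarith [hsmall (inv x.1)]
      _ = ∫ h, (w h * (4 * Real.log r - 2 * x.2) + B.indicator w h * (4 * x.2)) := by
          rw [integral_add hint hint2, integral_mul_const, integral_mul_const, hw1,
            integral_indicator hBm]
      _ ≤ Psi w x := integral_mono (hint.add hint2) (integrable_mul_log_Gf hw hs x) hpt
  set M := Psi w (0, 0) with hM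
  set R := Real.exp (M + M) with hR
  have hK1 : IsCompact ((fun y : QH n × QH n => op n y.1 (inv y.2)) ''
      (tsupport w ×ˢ {h : QH n | qSq n h ^ 2 + wSq n h ≤ R})) :=
    (hs.isCompact.prod (isCompact_gauge R)).image
      (continuous_op.comp (continuous_fst.prodMk continuous_snd.neg))
  refine (continuous_Psi hw hs).exists_forall_le' (0, 0) ?_
  refine Filter.mem_cocompact.2 ⟨_, hK1.prod (isCompact_Icc
    (a := min 0 (4 * Real.log r - M)) (b := M / 2)), ?_⟩
  rintro ⟨a, s⟩ hx
  by_contra hlt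
  have hlt' : Psi w (a, s) < M := not_le.1 hlt
  have h1 := b1 (a, s)
  simp only at h1
  refine hx ⟨?_, ?_, by linarith⟩
  · by_contra ha
    refine not_le.2 hlt' (lower (a, s) M fun h hh => ?_)
    have hg : R < qSq n (op n (inv a) h) ^ 2 + wSq n (op n (inv a) h) := by
      by_contra hle
      refine ha ⟨(h, op n (inv a) h), ⟨hh, not_lt.1 hle⟩, ?_⟩
      have e1 : op n a (op n (inv a) h) = h := op_inv_op a h
      calc op n h (inv (op n (inv a) h))
          = op n (op n a (op n (inv a) h)) (inv (op n (inv a) h)) := by rw [e1]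
        _ = a := by rw [op_assoc, op_inv, op_zero]
    rw [Real.le_log_iff_exp_le (Gf_pos (Real.exp_pos _) _)]
    refine le_trans ?_ (gauge_le_Gf (Real.exp_pos _) _)
    rw [le_div_iff₀ (by positivity), ← Real.exp_nat_mul, ← Real.exp_add]
    refine le_trans (Real.exp_le_exp.2 ?_) hg.le
    push_cast
    linarith
  · by_cases hs0 : s ≤ 0
    · have := b2 (a, s) hs0
      simp only at this
      exact (min_le_right _ _).trans (by linarith)
    · exact (min_le_left _ _).trans (not_le.1 hs0).le

end Centering

section Centered

variable {n : ℕ}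

lemma inv_op_rev (x y : QH n) : inv (op n x y) = op n (inv y) (inv x) := by
  have h : op n (op n (inv y) (inv x)) (op n x y) = 0 := by
    rw [op_assoc, inv_op_op, inv_op]
  calc inv (op n x y) = op n (op n (op n (inv y) (inv x)) (op n x y)) (inv (op n x y)) := by
        rw [h, zero_op]
    _ = op n (inv y) (inv x) := by rw [op_assoc, op_inv, op_zero]

lemma dil_inv (lam : ℝ) (g : QH n) : dil n lam (inv g) = inv (dil n lam g) := by
  simp only [dil_eq, inv, Prod.neg_mk, Prod.fst_neg, Prod.snd_neg, smul_neg]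

lemma Psi_shift (a b : QH n) (s t : ℝ) {u : QH n → ℝ} (hN : Nf n u = 1) (hu : Continuous u)
    (hs : HasCompactSupport u) :
    Psi (fun g => |u g| ^ pS n) (op n a (dil n (Real.exp s) b), s + t)
      = (∫ g, |shift a (Real.exp s) u g| ^ pS n * Real.log (Gf (Real.exp t) (op n (inv b) g)))
        + 2 * s := by
  have hl := Real.exp_pos s
  unfold Psi
  rw [← integral_shift a hl]
  have hN' := Nf_shift a hl u
  rw [hN, Nf] at hN'
  have hcu : Continuous (shift a (Real.exp s) u) :=
    continuous_const.mul (hu.comp ((opHomeo a).continuous.comp (continuous_dil _)))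
  have hcs := hasCompactSupport_shift a hl hs
  have i1 := integrable_mul_log_Gf (continuous_abs_rpow hcu pS_pos.le)
    (hasCompactSupport_abs_rpow hcs (pS_pos (n := n)).ne') (b, t)
  have i2 : Integrable (fun g => |shift a (Real.exp s) u g| ^ pS n * (2 * s)) :=
    (integrable_abs_rpow hcu hcs pS_pos).mul_const _
  have h2 : 2 * s = ∫ g, |shift a (Real.exp s) u g| ^ pS n * (2 * s) := by
    rw [integral_mul_const, hN', one_mul]
  conv_rhs => rw [h2]
  rw [← integral_add i1 i2]
  congr 1
  ext g
  rw [abs_shift_rpow a hl, ← mul_assoc, ← mul_add]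
  congr 1
  rw [inv_op_rev, op_assoc, inv_op_op, ← dil_inv, ← dil_op, Real.exp_add,
    Gf_dil hl (Real.exp_pos t), Real.log_mul (by positivity) (Gf_pos (Real.exp_pos _) _).ne',
    Real.log_pow, Real.log_exp]
  push_cast
  ring

/-- Any function can be moved to one minimising the conformal factor functional. -/
lemma exists_shift_stationary {u : QH n → ℝ} (hu : Continuous u) (hs : HasCompactSupport u)
    (hN : Nf n u = 1) : ∃ (a : QH n) (s : ℝ), ∀ (b : QH n) (t : ℝ),
      0 ≤ ∫ g, |shift a (Real.exp s) u g| ^ pS n / Df g *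
        (Gf (Real.exp t) (op n (inv b) g) - Df g) := by
  obtain ⟨⟨a, s⟩, hmin⟩ := exists_min_Psi (continuous_abs_rpow hu (pS_pos (n := n)).le)
    (hasCompactSupport_abs_rpow hs (pS_pos (n := n)).ne')
    (fun h => Real.rpow_nonneg (abs_nonneg _) _) hN
  refine ⟨a, s, fun b t => ?_⟩
  have hl := Real.exp_pos s
  have hcu : Continuous (shift a (Real.exp s) u) :=
    continuous_const.mul (hu.comp ((opHomeo a).continuous.comp (continuous_dil _)))
  have hcs := hasCompactSupport_shift a hl hs
  set W : QH n → ℝ := fun g => |shift a (Real.exp s) u g| ^ pS n with hW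
  have hWc : Continuous W := continuous_abs_rpow hcu pS_pos.le
  have hWs : HasCompactSupport W := hasCompactSupport_abs_rpow hcs (pS_pos (n := n)).ne'
  have hW0 : ∀ g, 0 ≤ W g := fun g => Real.rpow_nonneg (abs_nonneg _) _
  have e0 : dil n (Real.exp s) 0 = 0 := by simp [dil_eq]
  have h0 := Psi_shift a 0 s 0 hN hu hs
  rw [e0, op_zero, add_zero] at h0
  have hm := hmin (op n a (dil n (Real.exp s) b), s + t)
  rw [h0, Psi_shift a b s t hN hu hs, add_le_add_iff_right] at hm
  have i1 := integrable_mul_log_Gf hWc hWs (0, 0)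
  have i2 := integrable_mul_log_Gf hWc hWs (b, t)
  have i3 : Integrable (fun g => W g / Df g * (Gf (Real.exp t) (op n (inv b) g) - Df g)) := by
    refine Continuous.integrable_of_hasCompactSupport ?_ ?_
    · have h1 := (opHomeo (inv b)).continuous
      have hD : Continuous (Df : QH n → ℝ) := (contDiff_Df (m := 0)).continuous
      refine (hWc.div hD Df_ne).mul (Continuous.sub ?_ hD)
      unfold Gf
      exact (((continuous_const.add (continuous_qSq.comp h1)).pow 2).add
        (continuous_wSq.comp h1)).div continuous_const fun y => by positivity
    · simp only [div_mul_eq_mul_div]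
      simp only [mul_div_assoc]
      exact hWs.mul_right
  have hsub : Integrable (fun g => W g * Real.log (Gf (Real.exp t) (op n (inv b) g))
      - W g * Real.log (Gf (Real.exp 0) (op n (inv 0) g))) := i2.sub i1
  calc 0 ≤ (∫ g, W g * Real.log (Gf (Real.exp t) (op n (inv b) g)))
        - ∫ g, W g * Real.log (Gf (Real.exp 0) (op n (inv 0) g)) := sub_nonneg.2 hm
    _ = ∫ g, (W g * Real.log (Gf (Real.exp t) (op n (inv b) g))
      - W g * Real.log (Gf (Real.exp 0) (op n (inv 0) g))) := (integral_sub i2 i1).symm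
    _ ≤ _ := by
      refine integral_mono hsub i3 fun g => ?_
      have hD := Df_pos g
      have hG := Gf_pos (Real.exp_pos t) (op n (inv b) g)
      have e1 : Gf (Real.exp 0) (op n (inv 0) g) = Df g := by
        rw [Real.exp_zero, Gf_one]
        congr 1
        simp [inv, zero_op]
      rw [e1, ← mul_sub, ← Real.log_div hG.ne' hD.ne', div_mul_eq_mul_div, mul_div_assoc]
      refine mul_le_mul_of_nonneg_left ?_ (hW0 g)
      rw [sub_div, div_self hD.ne']
      exact Real.log_le_sub_one_of_pos (by positivity)

lemma eq_zero_of_quartic_nonneg {c₁ c₂ c₃ c₄ : ℝ}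
    (h : ∀ s : ℝ, |s| ≤ 1 / 2 → 0 ≤ s * c₁ + s ^ 2 * c₂ + s ^ 3 * c₃ + s ^ 4 * c₄) : c₁ = 0 := by
  by_contra hc
  set K := |c₂| + |c₃| + |c₄| with hK
  have h1 : 0 < |c₁| := abs_pos.2 hc
  have hK0 : 0 ≤ K := by positivity
  set ε := 1 / (2 * (|c₁| + K)) with hε
  have hε0 : 0 < ε := by positivity
  have e1 : |c₁| * ε ≤ 1 / 2 := by
    rw [hε, mul_one_div, div_le_div_iff₀ (by positivity) (by positivity)]; linarith
  have e2 : K * ε ≤ 1 / 2 := by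
    rw [hε, mul_one_div, div_le_div_iff₀ (by positivity) (by positivity)]; linarith
  set s := -c₁ * ε with hs
  have hs' : |s| = |c₁| * ε := by rw [hs, abs_mul, abs_neg, abs_of_pos hε0]
  have hs1 : |s| ≤ 1 / 2 := hs' ▸ e1
  have h2 := h s hs1
  have hb : ∀ c : ℝ, ∀ k : ℕ, s ^ (2 + k) * c ≤ s ^ 2 * |c| := by
    intro c k
    calc s ^ (2 + k) * c ≤ |s ^ (2 + k) * c| := le_abs_self _
      _ = s ^ 2 * (|s| ^ k * |c|) := by rw [abs_mul, abs_pow, pow_add, sq_abs]; ring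
      _ ≤ s ^ 2 * (1 * |c|) := by
        gcongr
        exact pow_le_one₀ (abs_nonneg _) (by linarith)
      _ = _ := by rw [one_mul]
  have h3 := hb c₂ 0
  have h4 := hb c₃ 1
  have h5 := hb c₄ 2
  have h6 : 0 ≤ s * c₁ + s ^ 2 * K := by
    rw [hK]; simp only [add_zero] at h3; norm_num at h4 h5; linarith
  have h7 : s * c₁ + s ^ 2 * K = c₁ ^ 2 * ε * (K * ε - 1) := by rw [hs]; ring
  rw [h7] at h6
  have h8 : 0 < c₁ ^ 2 * ε := by positivity
  nlinarith

lemma integral_eq_zero_of_quartic {κ l₁ l₂ l₃ l₄ : QH n → ℝ} (hκ : Continuous κ)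
    (hκs : HasCompactSupport κ) (h₁ : Continuous l₁) (h₂ : Continuous l₂) (h₃ : Continuous l₃)
    (h₄ : Continuous l₄) (h : ∀ s : ℝ, |s| ≤ 1 / 2 →
      0 ≤ ∫ g, κ g * (s * l₁ g + s ^ 2 * l₂ g + s ^ 3 * l₃ g + s ^ 4 * l₄ g)) :
    ∫ g, κ g * l₁ g = 0 := by
  refine eq_zero_of_quartic_nonneg (c₂ := ∫ g, κ g * l₂ g) (c₃ := ∫ g, κ g * l₃ g)
    (c₄ := ∫ g, κ g * l₄ g) fun s hs => (h s hs).trans (le_of_eq ?_)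
  have hi : ∀ {l : QH n → ℝ}, Continuous l → ∀ c : ℝ, Integrable (fun g => c * (κ g * l g)) :=
    fun hl c => ((hκ.mul hl).integrable_of_hasCompactSupport hκs.mul_right).const_mul c
  have e : ∀ g, κ g * (s * l₁ g + s ^ 2 * l₂ g + s ^ 3 * l₃ g + s ^ 4 * l₄ g)
      = s * (κ g * l₁ g) + s ^ 2 * (κ g * l₂ g) + s ^ 3 * (κ g * l₃ g) + s ^ 4 * (κ g * l₄ g) :=
    fun g => by ring
  simp only [e]
  have j12 : Integrable (fun g => s * (κ g * l₁ g) + s ^ 2 * (κ g * l₂ g)) :=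
    (hi h₁ _).add (hi h₂ _)
  have j123 : Integrable (fun g => s * (κ g * l₁ g) + s ^ 2 * (κ g * l₂ g)
    + s ^ 3 * (κ g * l₃ g)) := j12.add (hi h₃ _)
  rw [integral_add j123 (hi h₄ _), integral_add j12 (hi h₃ _), integral_add (hi h₁ _) (hi h₂ _)]
  simp only [integral_const_mul]

lemma op_inv_vertical (w : ℝ × ℝ × ℝ) (g : QH n) : op n (inv (0, w)) g = (g.1, g.2 - w) := by
  ext <;> simp [op, inv, imI, imJ, imK, tC, xC, yC, zC] <;> ring

lemma qSq_op_single (β : Fin n) (e : ℝ × ℝ × ℝ × ℝ) (s : ℝ) (g : QH n) :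
    qSq n (op n (inv (Pi.single β (s • e), 0)) g)
      = qSq n g - 2 * s * dotQ (g.1 β) e + s ^ 2 * nsq e := by
  have h1 : ∀ α, nsq ((op n (inv (Pi.single β (s • e), 0)) g).1 α) = nsq (g.1 α)
      + (if α = β then - 2 * s * dotQ (g.1 β) e + s ^ 2 * nsq e else 0) := by
    intro α
    by_cases h : α = β
    · subst h
      simp only [op, inv, Prod.neg_mk, Pi.add_apply, Pi.neg_apply, Pi.single_eq_same, if_true]
      simp [nsq, dotQ, tC, xC, yC, zC]
      ring
    · simp [op, inv, h]
  rw [← sum_nsq_eq, ← sum_nsq_eq]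
  simp only [h1, Finset.sum_add_distrib, Finset.sum_ite_eq', Finset.mem_univ, if_true]
  ring

lemma snd_op_single (β : Fin n) (e : ℝ × ℝ × ℝ × ℝ) (s : ℝ) (g : QH n) :
    (op n (inv (Pi.single β (s • e), 0)) g).2
      = (g.2.1 - 2 * s * imI e (g.1 β), g.2.2.1 - 2 * s * imJ e (g.1 β),
        g.2.2.2 - 2 * s * imK e (g.1 β)) := by
  have key : ∀ (f : (ℝ × ℝ × ℝ × ℝ) → (ℝ × ℝ × ℝ × ℝ) → ℝ), (∀ b, f 0 b = 0) →
      ∑ α, f ((inv (Pi.single β (s • e), (0 : ℝ × ℝ × ℝ)) : QH n).1 α) (g.1 α)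
        = f (-(s • e)) (g.1 β) := by
    intro f hf
    rw [Finset.sum_eq_single β]
    · simp [inv]
    · intro α _ h
      simp [inv, h, hf]
    · simp
  have k1 := key imI (by intro b; simp [imI, tC, xC, yC, zC])
  have k2 := key imJ (by intro b; simp [imJ, tC, xC, yC, zC])
  have k3 := key imK (by intro b; simp [imK, tC, xC, yC, zC])
  unfold op
  simp only [k1, k2, k3]
  simp only [inv, imI, imJ, imK, tC, xC, yC, zC, Prod.snd_neg, Prod.fst_neg, Prod.smul_fst,
    Prod.smul_snd, Prod.neg_mk, smul_eq_mul, Prod.fst_zero, Prod.snd_zero]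
  ext <;> simp <;> ring

lemma wq_eq_dot (k : Fin 4) (β : Fin n) (g : QH n) :
    wq k β g = Af g * dotQ (g.1 β) (basisQ k) + (g.2.1 * imI (basisQ k) (g.1 β)
      + g.2.2.1 * imJ (basisQ k) (g.1 β) + g.2.2.2 * imK (basisQ k) (g.1 β)) := by
  fin_cases k <;> simp [wq, dotQ, basisQ, imI, imJ, imK, tC, xC, yC, zC] <;> ring

/-- Centering by a conformal transformation. -/
lemma exists_centered {u : QH n → ℝ} (hu : ContDiff ℝ 1 u) (hs : HasCompactSupport u)
    (hN : Nf n u = 1) : ∃ v : QH n → ℝ, ContDiff ℝ 1 v ∧ HasCompactSupport v ∧ Nf n v = 1 ∧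
      Ef n v = Ef n u ∧ ∀ j, ∫ g, |v g| ^ pS n * sph j g = 0 := by
  obtain ⟨a, s, hst⟩ := exists_shift_stationary hu.continuous hs hN
  have hl := Real.exp_pos s
  set v := shift a (Real.exp s) u with hv
  have hvc : ContDiff ℝ 1 v := contDiff_shift a _ hu
  have hvs : HasCompactSupport v := hasCompactSupport_shift a hl hs
  refine ⟨v, hvc, hvs, (Nf_shift a hl u).trans hN, Ef_shift a hl hu, ?_⟩
  have hD : Continuous (Df : QH n → ℝ) := (contDiff_Df (m := 0)).continuous
  have hA : Continuous (Af : QH n → ℝ) := (contDiff_Af (m := 0)).continuous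
  set κ : QH n → ℝ := fun g => |v g| ^ pS n / Df g with hκ
  have hκc : Continuous κ := (continuous_abs_rpow hvc.continuous pS_pos.le).div hD Df_ne
  have hκs : HasCompactSupport κ := by
    simp only [hκ, div_eq_mul_inv]
    exact (hasCompactSupport_abs_rpow hvs (pS_pos (n := n)).ne').mul_right
  have fin : ∀ (l : QH n → ℝ) (j : Option (Fin n) × Fin 4) (c : ℝ),
      (∀ g, sph j g = c * l g / Df g) → ∫ g, κ g * l g = 0 →
      ∫ g, |v g| ^ pS n * sph j g = 0 := by
    intro l j c hj h0
    have : ∀ g, |v g| ^ pS n * sph j g = c * (κ g * l g) := fun g => by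
      rw [hj, hκ]; simp only; ring
    simp only [this]
    rw [integral_const_mul, h0, mul_zero]
  have c0 : Continuous (fun _ : QH n => (0 : ℝ)) := continuous_const
  have c1 : Continuous (fun _ : QH n => (1 : ℝ)) := continuous_const
  have vert : ∀ (f : QH n → ℝ) (b : ℝ × ℝ × ℝ), Continuous f →
      (∀ (s : ℝ) (g : QH n), wSq n (g.1, g.2 - s • b) = wSq n g + (s * (-2 * f g) + s ^ 2 * 1)) →
      ∫ g, κ g * f g = 0 := by
    intro f b hf h
    have := integral_eq_zero_of_quartic (l₁ := fun g => -2 * f g) hκc hκs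
      (continuous_const.mul hf) c1 c0 c0 (fun s _ => ?_)
    · simp only [mul_left_comm (κ _) (-2) _] at this
      rw [integral_const_mul] at this
      linarith
    · have h1 := hst (0, s • b) 0
      simp only [Real.exp_zero, Gf_one, op_inv_vertical] at h1
      refine h1.trans (le_of_eq (integral_congr_ae (Filter.Eventually.of_forall fun g => ?_)))
      have e : Df (g.1, g.2 - s • b) = Df g + (s * (-2 * f g) + s ^ 2 * 1) := by
        unfold Df
        rw [h, show Af (g.1, g.2 - s • b) = Af g from rfl]
        ring
      simp only [hκ, e]
      ring
  rintro ⟨_ | β, k⟩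
  · fin_cases k
    · refine fin (fun g => 1 - (qSq n g ^ 2 + wSq n g)) _ 1 (fun g => ?_) ?_
      · have := Df_ne g
        simp only [sph, wComp]
        simp only [Fin.zero_eta, Matrix.cons_val_zero, if_true]
        field_simp
        unfold Df Af
        ring
      · refine integral_eq_zero_of_quartic hκc hκs (by
          exact continuous_const.sub ((continuous_qSq.pow 2).add continuous_wSq)) c1 c0 c0
          (fun s hs => ?_)
        have hs1 : 0 < 1 + s := by linarith [(abs_le.1 hs).1]
        have h1 := hst 0 (Real.log (1 + s) / 2)
        have h2 := mul_nonneg hs1.le h1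
        rw [← integral_const_mul] at h2
        refine h2.trans (le_of_eq (integral_congr_ae (Filter.Eventually.of_forall fun g => ?_)))
        have e1 : op n (inv 0) g = g := by simp [inv, zero_op]
        have e2 : Real.exp (Real.log (1 + s) / 2) ^ 2 = 1 + s := by
          rw [← Real.exp_nat_mul]
          push_cast
          rw [mul_div_cancel₀ _ two_ne_zero, Real.exp_log hs1]
        have := Df_ne g
        simp only [hκ, e1, Gf, e2]
        field_simp
        unfold Df Af
        ring
    · refine fin (fun g => g.2.1) _ 2 (fun g => by simp [sph, wComp]) ?_
      refine vert _ (1, 0, 0) (by fun_prop) fun s g => ?_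
      simp [wSq]; ring
    · refine fin (fun g => g.2.2.1) _ 2 (fun g => by simp [sph, wComp]) ?_
      refine vert _ (0, 1, 0) (by fun_prop) fun s g => ?_
      simp [wSq]; ring
    · refine fin (fun g => g.2.2.2) _ 2 (fun g => by simp [sph, wComp]) ?_
      refine vert _ (0, 0, 1) (by fun_prop) fun s g => ?_
      simp [wSq]; ring
  · refine fin (fun g => -4 * wq k β g) _ (-(1 / 2)) (fun g => by simp only [sph]; ring) ?_
    have hdot : Continuous (fun g : QH n => dotQ (g.1 β) (basisQ k)) := by
      unfold dotQ tC xC yC zC; fun_prop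
    have hI : Continuous (fun g : QH n => imI (basisQ k) (g.1 β) ^ 2
        + imJ (basisQ k) (g.1 β) ^ 2 + imK (basisQ k) (g.1 β) ^ 2) := by
      unfold imI imJ imK tC xC yC zC; fun_prop
    refine integral_eq_zero_of_quartic hκc hκs
      (l₂ := fun g => 2 * Af g * nsq (basisQ k) + 4 * dotQ (g.1 β) (basisQ k) ^ 2
        + 4 * (imI (basisQ k) (g.1 β) ^ 2 + imJ (basisQ k) (g.1 β) ^ 2
          + imK (basisQ k) (g.1 β) ^ 2))
      (l₃ := fun g => -4 * nsq (basisQ k) * dotQ (g.1 β) (basisQ k))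
      (l₄ := fun _ => nsq (basisQ k) ^ 2)
      (continuous_const.mul (contDiff_wq (m := 0) k β).continuous)
      (((((continuous_const.mul hA)).mul continuous_const).add
        (continuous_const.mul (hdot.pow 2))).add (continuous_const.mul hI))
      (continuous_const.mul hdot) continuous_const (fun s _ => ?_)
    have h1 := hst (Pi.single β (s • basisQ k), 0) 0
    simp only [Real.exp_zero, Gf_one] at h1
    refine h1.trans (le_of_eq (integral_congr_ae (Filter.Eventually.of_forall fun g => ?_)))
    simp only [hκ, wq_eq_dot]
    congr 1
    unfold Df Af wSq
    rw [qSq_op_single, snd_op_single]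
    ring

end Centered

section SecondVariation

variable {n : ℕ}

lemma exists_quadratic_le_rpow {p η : ℝ} (hp : 2 ≤ p) (hη : 0 < η) :
    ∃ s₀ > 0, ∀ s : ℝ, |s| ≤ s₀ → 1 + p * s + (p * (p - 1) / 2 - η) * s ^ 2 ≤ (1 + s) ^ p := by
  set β := p * (p - 1) / 2 - η with hβ
  set f : ℝ → ℝ := fun s => (1 + s) ^ p - (p * s + β * s ^ 2) with hf
  have hid : ∀ s : ℝ, HasDerivAt (fun s : ℝ => 1 + s) 1 s := fun s =>
    (hasDerivAt_id s).const_add 1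
  have h1 : ∀ s, HasDerivAt f (p * (1 + s) ^ (p - 1) - (p + β * (2 * s))) s := by
    intro s
    have a1 := (hid s).rpow_const (p := p) (Or.inr (by linarith))
    have a2 : HasDerivAt (fun s : ℝ => p * s + β * s ^ 2) (p * 1 + β * (2 * s)) s :=
      ((hasDerivAt_id s).const_mul p).add (by simpa using (hasDerivAt_pow 2 s).const_mul β)
    exact (a1.sub a2).congr_deriv (by ring)
  have h2 : HasDerivAt (fun s : ℝ => p * (1 + s) ^ (p - 1) - (p + β * (2 * s)))
      (p * (p - 1) - 2 * β) 0 := by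
    have a1 := ((hid 0).rpow_const (p := p - 1) (Or.inr (by linarith))).const_mul p
    have a2 : HasDerivAt (fun s : ℝ => p + β * (2 * s)) (β * (2 * 1)) 0 :=
      (((hasDerivAt_id (0 : ℝ)).const_mul 2).const_mul β).const_add p
    exact (a1.sub a2).congr_deriv (by simp; ring)
  have hd1 : deriv f = fun s : ℝ => p * (1 + s) ^ (p - 1) - (p + β * (2 * s)) :=
    funext fun s => (h1 s).deriv
  have hmin : IsLocalMin f 0 := by
    refine isLocalMin_of_deriv_deriv_pos ?_ ?_ (h1 0).continuousAt
    · rw [hd1, h2.deriv, hβ]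
      ring_nf
      linarith
    · rw [hd1]; simp
  obtain ⟨r, hr, hball⟩ := Metric.eventually_nhds_iff.1 hmin
  refine ⟨r / 2, by positivity, fun s hs => ?_⟩
  have := hball (y := s) (by rw [Real.dist_eq, sub_zero]; linarith)
  simp only [hf] at this
  norm_num at this
  linarith

lemma one_add_mul_sub_le_rpow {y α : ℝ} (hy : 0 ≤ y) (hα : 0 ≤ α) :
    1 + α * (y - y ^ 2) ≤ (1 + y) ^ α := by
  have hy1 : 0 < 1 + y := by linarith
  have h1 : y - y ^ 2 ≤ Real.log (1 + y) := by
    refine le_trans ?_ (Real.one_sub_inv_le_log_of_pos hy1)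
    rw [show 1 - (1 + y)⁻¹ = y / (1 + y) by field_simp; ring, le_div_iff₀ hy1]
    nlinarith [pow_nonneg hy 3]
  rw [Real.rpow_def_of_pos hy1, mul_comm (Real.log _)]
  linarith [Real.add_one_le_exp (α * Real.log (1 + y)), mul_le_mul_of_nonneg_left h1 hα]

lemma hGradSq_add_sub {u v : QH n → ℝ} (hu : ContDiff ℝ 1 u) (hv : ContDiff ℝ 1 v) (t : ℝ)
    (g : QH n) : hGradSq n (fun g => u g + t * v g) g + hGradSq n (fun g => u g + -t * v g) g
      = 2 * hGradSq n u g + 2 * t ^ 2 * hGradSq n v g := by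
  have du := differentiableAt_of_contDiff hu g
  have dv := differentiableAt_of_contDiff hv g
  simp only [hGradSq_eq, Finset.mul_sum, ← Finset.sum_add_distrib]
  refine Finset.sum_congr rfl fun α _ => Finset.sum_congr rfl fun k _ => ?_
  rw [hd_add du (dv.const_mul t), hd_add du (dv.const_mul (-t)), hd_const_mul _ dv,
    hd_const_mul _ dv]
  ring

lemma Ef_add_sub {u v : QH n → ℝ} (hu : ContDiff ℝ 1 u) (hv : ContDiff ℝ 1 v)
    (hsu : HasCompactSupport u) (hsv : HasCompactSupport v) (t : ℝ) :
    Ef n (fun g => u g + t * v g) + Ef n (fun g => u g + -t * v g)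
      = 2 * Ef n u + 2 * t ^ 2 * Ef n v := by
  unfold Ef
  have hi : ∀ t : ℝ, Integrable (hGradSq n (fun g => u g + t * v g)) := fun t =>
    integrable_hGradSq (hu.add (contDiff_const.mul hv)) (hsu.add hsv.mul_left)
  rw [← integral_add (hi t) (hi (-t)), ← integral_const_mul, ← integral_const_mul,
    ← integral_add ((integrable_hGradSq hu hsu).const_mul _)
      ((integrable_hGradSq hv hsv).const_mul _)]
  congr 1
  ext g
  exact hGradSq_add_sub hu hv t g

lemma sum_Ef_sph_mul {u : QH n → ℝ} (hu : ContDiff ℝ 1 u) (hs : HasCompactSupport u) :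
    ∑ j, Ef n (fun x => sph j x * u x) = Ef n u + 16 * n * ∫ g, u g ^ 2 / Df g := by
  unfold Ef
  have hi : Integrable (fun g => u g ^ 2 / Df g) := by
    refine Continuous.integrable_of_hasCompactSupport ((hu.continuous.pow 2).div
      (contDiff_Df (m := 0)).continuous Df_ne) ?_
    simp only [sq, mul_div_assoc]
    exact hs.mul_right
  rw [← integral_finsetSum _ fun j _ =>
    integrable_hGradSq ((contDiff_sph j).mul hu) hs.mul_left]
  simp only [fun g => sum_hGradSq_sph_mul (differentiableAt_of_contDiff hu g)]
  rw [integral_add (integrable_hGradSq hu hs) (hi.const_mul _), integral_const_mul]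

lemma Nf_mul_sph_ge {p η s₀ : ℝ} (hp : p = pS n)
    (hlow : ∀ s : ℝ, |s| ≤ s₀ → 1 + p * s + (p * (p - 1) / 2 - η) * s ^ 2 ≤ (1 + s) ^ p)
    {u : QH n → ℝ} (hu : Continuous u) (hs : HasCompactSupport u) (hN : Nf n u = 1)
    (j : Option (Fin n) × Fin 4) (hc : ∫ g, |u g| ^ pS n * sph j g = 0) {t : ℝ} (ht : |t| ≤ s₀)
    (ht1 : |t| ≤ 1) :
    1 + (p * (p - 1) / 2 - η) * t ^ 2 * (∫ g, |u g| ^ pS n * sph j g ^ 2)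
      ≤ Nf n (fun g => u g + t * (sph j g * u g)) := by
  have hsph : Continuous (sph j : QH n → ℝ) := (contDiff_sph (m := 0) j).continuous
  have i0 := integrable_abs_rpow hu hs (pS_pos (n := n))
  have cw := continuous_abs_rpow hu (pS_pos (n := n)).le
  have sw := hasCompactSupport_abs_rpow hs (pS_pos (n := n)).ne'
  have i1 : Integrable (fun g => |u g| ^ pS n * sph j g) :=
    (cw.mul hsph).integrable_of_hasCompactSupport sw.mul_right
  have i2 : Integrable (fun g => |u g| ^ pS n * sph j g ^ 2) :=
    (cw.mul (hsph.pow 2)).integrable_of_hasCompactSupport sw.mul_right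
  have i01 : Integrable (fun g => |u g| ^ pS n + (p * t) * (|u g| ^ pS n * sph j g)) :=
    i0.add (i1.const_mul _)
  have hle : ∀ g, |t * sph j g| ≤ |t| := fun g => by
    rw [abs_mul]; exact mul_le_of_le_one_right (abs_nonneg _) (abs_sph_le j g)
  calc _ = Nf n u + (p * t) * (∫ g, |u g| ^ pS n * sph j g)
        + (p * (p - 1) / 2 - η) * t ^ 2 * (∫ g, |u g| ^ pS n * sph j g ^ 2) := by
        rw [hN, hc]; ring
    _ = ∫ g, (|u g| ^ pS n + (p * t) * (|u g| ^ pS n * sph j g)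
        + (p * (p - 1) / 2 - η) * t ^ 2 * (|u g| ^ pS n * sph j g ^ 2)) := by
        rw [integral_add i01 (i2.const_mul _), integral_add i0 (i1.const_mul _),
          integral_const_mul, integral_const_mul, Nf]
    _ ≤ _ := by
        unfold Nf
        refine integral_mono (i01.add (i2.const_mul _)) (integrable_abs_rpow
          (hu.add (continuous_const.mul (hsph.mul hu))) (hs.add hs.mul_left.mul_left) pS_pos)
          fun g => ?_
        have h1 := hlow (t * sph j g) ((hle g).trans ht)
        have h2 : 0 ≤ 1 + t * sph j g := by
          linarith [(abs_le.1 ((hle g).trans ht1)).1]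
        have e : u g + t * (sph j g * u g) = u g * (1 + t * sph j g) := by ring
        simp only [e]
        rw [abs_mul, abs_of_nonneg h2, Real.mul_rpow (abs_nonneg _) h2, ← hp]
        have h3 := mul_le_mul_of_nonneg_left h1 (Real.rpow_nonneg (abs_nonneg (u g)) p)
        linarith

lemma sub_le_of_second_variation {C ε N p η t δ m E V : ℝ} (hC : 0 < C) (hε : 0 < ε) (hN : 0 ≤ N)
    (hp2 : 2 < p) (hpn : p - 2 = 1 / (N + 1)) (hη0 : 0 < η) (ht0 : 0 < t) (hδ0 : 0 < δ)
    (hm0 : 0 < m) (hηε : C * (N + 1) * η ≤ ε / 4) (htε : m * C * (N + 1) * (9 * t ^ 2) ≤ ε / 4)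
    (hδε : δ * ((N + 2) * (1 + m / t ^ 2)) = ε / 4) (hE : E ≤ C + δ)
    (hsum : C * (m + 2 / p * ((p * (p - 1) / 2 - η) * t ^ 2) - m * (9 * t ^ 4))
      ≤ m * E + t ^ 2 * (E + 16 * N * V)) : E - 16 * N * (N + 1) * V ≤ ε := by
  have e3 : 2 / p * ((p * (p - 1) / 2 - η) * t ^ 2) = t ^ 2 * (p - 1 - 2 / p * η) := by
    field_simp
  have h3 : 2 / p ≤ 1 := by rw [div_le_one (by linarith)]; linarith
  have hmain : C * (p - 1) ≤ C + δ + 16 * N * V + m * δ / t ^ 2 + C * η + m * C * (9 * t ^ 2) := by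
    have h5 : t ^ 2 * (C * (p - 1 - 2 / p * η)) ≤
        t ^ 2 * (C + δ + 16 * N * V + m * δ / t ^ 2 + m * C * (9 * t ^ 2)) := by
      have h4 : t ^ 2 * (m * δ / t ^ 2) = m * δ := by field_simp
      rw [e3] at hsum
      have h6 : m * E ≤ m * (C + δ) := by gcongr
      have h7 : t ^ 2 * E ≤ t ^ 2 * (C + δ) := by gcongr
      rw [mul_add, mul_add, h4]
      ring_nf at hsum h6 h7 ⊢
      linarith
    have h6 := le_of_mul_le_mul_left h5 (by positivity)
    have h7 : C * (2 / p * η) ≤ C * η := by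
      gcongr; exact mul_le_of_le_one_left hη0.le h3
    linarith
  have h8 : C ≤ (N + 1) * (δ + 16 * N * V + m * δ / t ^ 2 + C * η + m * C * (9 * t ^ 2)) := by
    have h9 : C * (p - 2) ≤ δ + 16 * N * V + m * δ / t ^ 2 + C * η + m * C * (9 * t ^ 2) := by
      linarith
    rw [hpn, mul_one_div, div_le_iff₀ (by positivity)] at h9
    linarith
  have h9 : δ + (N + 1) * (δ + m * δ / t ^ 2) ≤ δ * ((N + 2) * (1 + m / t ^ 2)) := by
    have h10 : 0 ≤ δ * (m / t ^ 2) := by positivity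
    rw [mul_comm m δ, mul_div_assoc]
    linarith
  rw [hδε] at h9
  linarith

set_option maxHeartbeats 1000000 in
/-- The second variation along the sphere coordinates controls the defect of a centered
almost-minimizer. -/
lemma exists_defect_le {C : ℝ} (hC : 0 < C) (hineq : ∀ u : QH n → ℝ, ContDiff ℝ 1 u →
    HasCompactSupport u → C * Nf n u ^ (2 / pS n) ≤ Ef n u) {ε : ℝ} (hε : 0 < ε) :
    ∃ δ > 0, ∀ u : QH n → ℝ, ContDiff ℝ 1 u → HasCompactSupport u → Nf n u = 1 →
      (∀ j, ∫ g, |u g| ^ pS n * sph j g = 0) → Ef n u ≤ C + δ → ∫ g, defect n u g ≤ ε := by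
  set p := pS n with hp
  have hp2 : 2 < p := two_lt_pS
  have hp3 : p ≤ 3 := by
    rw [hp, pS]
    have : 1 / ((n : ℝ) + 1) ≤ 1 := by
      rw [div_le_one (by positivity)]; linarith [(Nat.cast_nonneg n : (0 : ℝ) ≤ n)]
    linarith
  set η : ℝ := min 1 (ε / (4 * C * (n + 1))) with hη
  have hη0 : 0 < η := by positivity
  have hη1 : η ≤ 1 := min_le_left _ _
  have hηε : C * (n + 1) * η ≤ ε / 4 := by
    calc C * (n + 1) * η ≤ C * (n + 1) * (ε / (4 * C * (n + 1))) := by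
          gcongr; exact min_le_right _ _
      _ = ε / 4 := by field_simp
  obtain ⟨s₀, hs₀, hlow⟩ := exists_quadratic_le_rpow hp2.le hη0
  set m : ℝ := 4 * n + 4 with hm
  have hm0 : 0 < m := by positivity
  set t : ℝ := min (min s₀ 1) (ε / (36 * m * C * (n + 1) + ε)) with ht
  have ht0 : 0 < t := by positivity
  have hts : t ≤ s₀ := (min_le_left _ _).trans (min_le_left _ _)
  have ht1 : t ≤ 1 := (min_le_left _ _).trans (min_le_right _ _)
  have htε : m * C * (n + 1) * (9 * t ^ 2) ≤ ε / 4 := by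
    have h1 : t ^ 2 ≤ ε / (36 * m * C * (n + 1) + ε) := by
      calc t ^ 2 ≤ t := by nlinarith
        _ ≤ _ := min_le_right _ _
    have h2 : ε / (36 * m * C * (n + 1) + ε) ≤ ε / (36 * m * C * (n + 1)) := by
      gcongr; linarith
    calc m * C * (n + 1) * (9 * t ^ 2) ≤ m * C * (n + 1) * (9 * (ε / (36 * m * C * (n + 1)))) := by
          gcongr; exact h1.trans h2
      _ = ε / 4 := by field_simp; norm_num
  set δ : ℝ := ε / (4 * (n + 2) * (1 + m / t ^ 2)) with hδ
  have hδ0 : 0 < δ := by positivity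
  have hδε : δ * ((n + 2) * (1 + m / t ^ 2)) = ε / 4 := by
    rw [hδ]; field_simp
  refine ⟨δ, hδ0, fun u hu hs hN hcent hE => ?_⟩
  set β := p * (p - 1) / 2 - η with hβ
  have hβ0 : 0 ≤ β := by rw [hβ]; nlinarith
  have hβ3 : β ≤ 3 := by rw [hβ]; nlinarith
  set b : Option (Fin n) × Fin 4 → ℝ := fun j => ∫ g, |u g| ^ pS n * sph j g ^ 2 with hb
  have cw := continuous_abs_rpow hu.continuous (pS_pos (n := n)).le
  have sw := hasCompactSupport_abs_rpow hs (pS_pos (n := n)).ne'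
  have hbi : ∀ j : Option (Fin n) × Fin 4, Integrable (fun g => |u g| ^ pS n * sph j g ^ 2) :=
    fun j => (cw.mul ((contDiff_sph (m := 0) j).continuous.pow 2)).integrable_of_hasCompactSupport
      sw.mul_right
  have hbsum : ∑ j, b j = 1 := by
    rw [hb, ← integral_finsetSum _ fun j _ => hbi j]
    simp only [← Finset.mul_sum, sum_sph_sq, mul_one]
    exact hN
  have hb0 : ∀ j, 0 ≤ b j := fun j =>
    integral_nonneg fun g => mul_nonneg (Real.rpow_nonneg (abs_nonneg _) _) (sq_nonneg _)
  have hb1 : ∀ j, b j ≤ 1 := fun j =>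
    hbsum ▸ Finset.single_le_sum (fun i _ => hb0 i) (Finset.mem_univ j)
  have step : ∀ j, C * (1 + 2 / p * (β * t ^ 2 * b j) - 9 * t ^ 4)
      ≤ Ef n u + t ^ 2 * Ef n (fun x => sph j x * u x) := by
    intro j
    have hv : ContDiff ℝ 1 (fun x => sph j x * u x) := (contDiff_sph j).mul hu
    have hvs : HasCompactSupport (fun x => sph j x * u x) := hs.mul_left
    set y := β * t ^ 2 * b j with hy
    have hy0 : 0 ≤ y := mul_nonneg (mul_nonneg hβ0 (sq_nonneg _)) (hb0 j)
    have hy3 : y ≤ 3 * t ^ 2 := by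
      rw [hy]
      calc β * t ^ 2 * b j ≤ 3 * t ^ 2 * 1 := by gcongr; exact hb1 j
        _ = _ := mul_one _
    have one : ∀ r : ℝ, |r| = t → C * (1 + 2 / p * y - 9 * t ^ 4)
        ≤ Ef n (fun g => u g + r * (sph j g * u g)) := by
      intro r hr
      have h1 := Nf_mul_sph_ge hp hlow hu.continuous hs hN j (hcent j) (t := r) (hr ▸ hts)
        (hr ▸ ht1)
      have hr2 : r ^ 2 = t ^ 2 := by rw [← sq_abs, hr]
      rw [hr2] at h1
      refine le_trans ?_ (hineq _ (hu.add (contDiff_const.mul hv)) (hs.add hvs.mul_left))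
      refine mul_le_mul_of_nonneg_left ?_ hC.le
      have h2 : (1 + y) ^ (2 / p) ≤ Nf n (fun g => u g + r * (sph j g * u g)) ^ (2 / p) :=
        Real.rpow_le_rpow (by linarith) h1 (by positivity)
      refine le_trans ?_ h2
      refine le_trans ?_ (one_add_mul_sub_le_rpow hy0 (by positivity))
      have h3 : 2 / p ≤ 1 := by rw [div_le_one (by linarith)]; linarith
      have h4 : 2 / p * y ^ 2 ≤ 9 * t ^ 4 := by
        calc 2 / p * y ^ 2 ≤ 1 * (3 * t ^ 2) ^ 2 := by gcongr
          _ = _ := by ring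
      linarith
    have h1 := one t (abs_of_pos ht0)
    have h2 := one (-t) (by rw [abs_neg, abs_of_pos ht0])
    have h3 := Ef_add_sub hu hv hs hvs t
    linarith
  have hsum := Finset.sum_le_sum fun j (_ : j ∈ Finset.univ) => step j
  have hcard : ((Finset.univ : Finset (Option (Fin n) × Fin 4)).card : ℝ) = m := by
    simp [hm]; ring
  have e1 : ∑ j, C * (1 + 2 / p * (β * t ^ 2 * b j) - 9 * t ^ 4)
      = C * (m + 2 / p * (β * t ^ 2) - m * (9 * t ^ 4)) := by
    rw [← Finset.mul_sum, Finset.sum_sub_distrib, Finset.sum_add_distrib, ← Finset.mul_sum,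
      ← Finset.mul_sum, hbsum]
    simp only [Finset.sum_const, nsmul_eq_mul, hcard]
    ring
  have e2 : ∑ j, (Ef n u + t ^ 2 * Ef n (fun x => sph j x * u x))
      = m * Ef n u + t ^ 2 * (Ef n u + 16 * n * ∫ g, u g ^ 2 / Df g) := by
    rw [Finset.sum_add_distrib, ← Finset.mul_sum, sum_Ef_sph_mul hu hs]
    simp only [Finset.sum_const, nsmul_eq_mul, hcard]
  rw [e1, e2] at hsum
  rw [integral_defect hu hs]
  exact sub_le_of_second_variation hC hε n.cast_nonneg hp2 (by rw [hp, pS]; ring) hη0 ht0 hδ0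
    hm0 hηε htε hδε hE hsum

end SecondVariation

section LocalPoincare

variable {n : ℕ}

lemma exists_norm_op_le (r R : ℝ) : ∃ r' : ℝ, ∀ g h : QH n, ‖g‖ ≤ r → ‖h‖ ≤ R → ‖op n g h‖ ≤ r' := by
  have hK : IsCompact (Metric.closedBall (0 : QH n) r ×ˢ Metric.closedBall (0 : QH n) R) :=
    (isCompact_closedBall _ _).prod (isCompact_closedBall _ _)
  obtain ⟨r', h⟩ := (hK.image continuous_op).isBounded.exists_norm_le
  exact ⟨r', fun g k hg hk => h _ ⟨(g, k), ⟨by simpa using hg, by simpa using hk⟩, rfl⟩⟩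

lemma exists_norm_flow_le {R : ℝ} (hR : 1 ≤ R) (r : ℝ) : ∃ r' : ℝ, ∀ g : QH n, ‖g‖ ≤ r →
    ∀ a : Fin n → ℝ × ℝ × ℝ × ℝ, ∑ α, nsq (a α) ≤ R → ∀ s ∈ Set.Icc (0 : ℝ) 1,
      ‖g + s • hvec a g‖ ≤ r' := by
  obtain ⟨r', h⟩ := exists_norm_op_le (n := n) r R
  refine ⟨r', fun g hg a ha s hs => ?_⟩
  have e : g + s • hvec a g = op n g (s • (a, 0)) := by
    rw [← hvec_smul, ← op_horizontal]; simp
  rw [e]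
  refine h g _ hg ?_
  have h1 : ‖((a, 0) : QH n)‖ ≤ R := by
    refine norm_le_of_qSq_wSq (by linarith) ?_ ?_
    · rw [← sum_nsq_eq]
      exact ha.trans (by nlinarith)
    · simp [wSq]; positivity
  rw [norm_smul, Real.norm_of_nonneg hs.1]
  calc s * ‖((a, 0) : QH n)‖ ≤ 1 * R := by
        gcongr
        exact hs.2
    _ = R := one_mul R

lemma exists_transBound_ball (hn : 1 ≤ n) (r ρ : ℝ) : ∃ (r' : ℝ) (M : ENNReal), M < ⊤ ∧
    ∀ h : QH n, ‖h‖ ≤ ρ →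
      TransBound M (Metric.closedBall 0 r) (Metric.closedBall 0 r') h := by
  obtain ⟨R₁, hR₁⟩ := ((isCompact_closedBall (0 : QH n) ρ).image
    (continuous_qSq.max continuous_wSq)).isBounded.exists_norm_le
  set R := max 1 R₁ with hR
  have h1R : 1 ≤ R := le_max_left _ _
  choose f hf using fun r : ℝ => exists_norm_flow_le (n := n) h1R r
  refine ⟨f^[5] r, 62 * ENNReal.ofReal R, ENNReal.mul_lt_top (by simp) ENNReal.ofReal_lt_top,
    fun h hh => ?_⟩
  have hm : max (qSq n h) (wSq n h) ≤ R :=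
    ((le_abs_self _).trans (hR₁ _ ⟨h, by simpa using hh, rfl⟩)).trans (le_max_right _ _)
  refine transBound_chain hn (fun i => Metric.closedBall 0 (f^[i] r))
    (fun i => Metric.isClosed_closedBall.measurableSet) h1R ?_ h ((le_max_left _ _).trans hm) ?_
  · intro i g hg a ha s hs
    rw [mem_closedBall_zero_iff] at hg ⊢
    rw [Function.iterate_succ_apply']
    exact hf _ g hg a ha s hs
  · linarith [(le_max_right _ _).trans hm]

/-- Local Poincaré inequality with a constant depending on the ball. -/
lemma exists_poincare (hn : 1 ≤ n) {r : ℝ} (hr : 0 < r) : ∃ (r' : ℝ) (M : ENNReal), M < ⊤ ∧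
    ∀ v : QH n → ℝ, ContDiff ℝ 1 v → ∃ m : ℝ,
      ∫⁻ g in Metric.closedBall 0 r, ENNReal.ofReal ((v g - m) ^ 2)
        ≤ M * ∫⁻ g in Metric.closedBall 0 r', ENNReal.ofReal (hGradSq n v g) := by
  obtain ⟨ρ, hρ⟩ := exists_norm_op_le (n := n) r r
  obtain ⟨r', M, hM, hT⟩ := exists_transBound_ball hn r ρ
  set B := Metric.closedBall (0 : QH n) r with hB
  set H := Metric.closedBall (0 : QH n) ρ with hH
  have hBm : MeasurableSet B := Metric.isClosed_closedBall.measurableSet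
  have hHm : MeasurableSet H := Metric.isClosed_closedBall.measurableSet
  have hB0 : volume B ≠ 0 := (Metric.measure_closedBall_pos volume _ hr).ne'
  have hBt : volume B ≠ ⊤ := measure_closedBall_lt_top.ne
  have hHt : volume H ≠ ⊤ := measure_closedBall_lt_top.ne
  refine ⟨r', (volume B)⁻¹ * (volume H * M), ENNReal.mul_lt_top
    (ENNReal.inv_lt_top.2 (pos_iff_ne_zero.2 hB0)) (ENNReal.mul_lt_top hHt.lt_top hM),
    fun v hv => ?_⟩
  set A := ∫⁻ g in Metric.closedBall 0 r', ENNReal.ofReal (hGradSq n v g) with hA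
  have hmeas : Measurable (fun x : QH n × QH n => ENNReal.ofReal ((v x.1 - v x.2) ^ 2)) :=
    (((hv.continuous.comp continuous_fst).sub
      (hv.continuous.comp continuous_snd)).pow 2).measurable.ennreal_ofReal
  have hmeas2 : Measurable (fun x : QH n × QH n =>
      ENNReal.ofReal ((v (op n x.1 x.2) - v x.1) ^ 2)) :=
    (((hv.continuous.comp continuous_op).sub
      (hv.continuous.comp continuous_fst)).pow 2).measurable.ennreal_ofReal
  have hdouble : ∫⁻ k in B, ∫⁻ g in B, ENNReal.ofReal ((v k - v g) ^ 2) ≤ volume H * M * A := by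
    calc ∫⁻ k in B, ∫⁻ g in B, ENNReal.ofReal ((v k - v g) ^ 2)
        = ∫⁻ g in B, ∫⁻ k in B, ENNReal.ofReal ((v k - v g) ^ 2) :=
          lintegral_lintegral_swap hmeas.aemeasurable
      _ ≤ ∫⁻ g in B, ∫⁻ h in H, ENNReal.ofReal ((v (op n g h) - v g) ^ 2) := by
          refine setLIntegral_mono' hBm fun g hg => ?_
          rw [← (measurePreserving_op_left g).setLIntegral_comp_preimage_emb
            (opHomeo g).measurableEmbedding (fun k => ENNReal.ofReal ((v k - v g) ^ 2)) B]
          refine lintegral_mono_set fun h hh => ?_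
          rw [hH, mem_closedBall_zero_iff, ← inv_op_op g h]
          refine hρ _ _ ?_ (by simpa [hB] using hh)
          simpa [inv, hB] using hg
      _ = ∫⁻ h in H, ∫⁻ g in B, ENNReal.ofReal ((v (op n g h) - v g) ^ 2) :=
          lintegral_lintegral_swap hmeas2.aemeasurable
      _ ≤ ∫⁻ _ in H, M * A :=
          setLIntegral_mono' hHm fun h hh => hT h (by simpa [hH] using hh) v hv
      _ = volume H * M * A := by
          rw [setLIntegral_const]; ring
  obtain ⟨k, -, hk⟩ := exists_le_setLAverage (μ := volume) hB0 hBt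
    (f := fun k => ∫⁻ g in B, ENNReal.ofReal ((v k - v g) ^ 2))
    (hmeas.lintegral_prod_right' (ν := volume.restrict B)).aemeasurable
  refine ⟨v k, ?_⟩
  calc ∫⁻ g in B, ENNReal.ofReal ((v g - v k) ^ 2)
      = ∫⁻ g in B, ENNReal.ofReal ((v k - v g) ^ 2) := by simp only [sub_sq_comm]
    _ ≤ _ := hk
    _ = (volume B)⁻¹ * ∫⁻ k in B, ∫⁻ g in B, ENNReal.ofReal ((v k - v g) ^ 2) := by
        rw [setLAverage_eq, ENNReal.div_eq_inv_mul]
    _ ≤ (volume B)⁻¹ * (volume H * M * A) := by gcongr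
    _ = (volume B)⁻¹ * (volume H * M) * A := by ring

end LocalPoincare

section LocalConvergence

variable {n : ℕ}

/-- The ground state `D^{-(n+1)}`. -/
noncomputable def groundState (g : QH n) : ℝ := (Df g ^ (n + 1))⁻¹

lemma groundState_pos (g : QH n) : 0 < groundState g := inv_pos.2 (pow_pos (Df_pos g) _)

lemma contDiff_groundState {m : WithTop ℕ∞} : ContDiff ℝ m (groundState : QH n → ℝ) :=
  (contDiff_Df.pow (n + 1)).inv fun g => (pow_pos (Df_pos g) _).ne'

lemma hGradSq_mul_le {φ w : QH n → ℝ} (hφ : ContDiff ℝ 1 φ) (hw : ContDiff ℝ 1 w) (g : QH n) :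
    hGradSq n (fun x => φ x * w x) g
      ≤ 2 * φ g ^ 2 * hGradSq n w g + 2 * w g ^ 2 * hGradSq n φ g := by
  simp only [hGradSq_eq, Finset.mul_sum, ← Finset.sum_add_distrib]
  refine Finset.sum_le_sum fun α _ => Finset.sum_le_sum fun k _ => ?_
  rw [hd_mul (differentiableAt_of_contDiff hφ g) (differentiableAt_of_contDiff hw g)]
  set a := hd (Pi.single α (basisQ k)) φ g
  set b := hd (Pi.single α (basisQ k)) w g
  nlinarith [sq_nonneg (φ g * b - w g * a)]

lemma hGradSq_sub_const (v : QH n → ℝ) (m : ℝ) (g : QH n) :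
    hGradSq n (fun x => v x - m) g = hGradSq n v g := by
  simp only [hGradSq_eq, hd, fderiv_sub_const]

lemma hGradSq_of_notMem_tsupport {φ : QH n → ℝ} {g : QH n} (hg : g ∉ tsupport φ) :
    hGradSq n φ g = 0 := by
  simp [hGradSq_eq, hd, fderiv_of_notMem_tsupport (𝕜 := ℝ) hg]

lemma integrable_defect {u : QH n → ℝ} (hu : ContDiff ℝ 1 u) (hs : HasCompactSupport u) :
    Integrable (defect n u) := by
  have hv : ContDiff ℝ 1 (fun g => Df g ^ (n + 1) * u g) := (contDiff_Df.pow _).mul hu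
  have e : defect n u = fun g =>
      ((Df g ^ (n + 1)) ^ 2)⁻¹ * hGradSq n (fun g => Df g ^ (n + 1) * u g) g := by
    ext g
    rw [hGradSq_Df_pow_mul hu, inv_mul_cancel_left₀ (pow_pos (pow_pos (Df_pos g) _) 2).ne']
  rw [e]
  refine Continuous.integrable_of_hasCompactSupport ?_ ?_
  · exact ((((contDiff_Df (m := 0)).continuous.pow _).pow 2).inv₀
      fun g => (pow_pos (pow_pos (Df_pos g) _) 2).ne').mul (continuous_hGradSq hv)
  · exact (hasCompactSupport_hGradSq hs.mul_left).mul_left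

lemma exists_le_of_isCompact {K : Set (QH n)} (hK : IsCompact K) {f : QH n → ℝ}
    (hf : Continuous f) : ∃ L > 0, ∀ g ∈ K, f g ≤ L := by
  obtain ⟨L, hL⟩ := (hK.image hf).isBounded.exists_norm_le
  exact ⟨max 1 L, by positivity, fun g hg => ((le_abs_self _).trans (hL _ ⟨g, hg, rfl⟩)).trans
    (le_max_right _ _)⟩

/-- Functions with small defect are `L²`-close on balls, together with their gradients, to a
multiple of the ground state. -/
lemma exists_local_bound (hn : 1 ≤ n) {r : ℝ} (hr : 0 < r) : ∃ κ : ℝ, 0 < κ ∧ ∀ u : QH n → ℝ,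
    ContDiff ℝ 1 u → HasCompactSupport u → ∃ m : ℝ,
      ∫⁻ g in Metric.closedBall 0 r, ENNReal.ofReal ((Df g ^ (n + 1) * u g - m) ^ 2)
          ≤ ENNReal.ofReal (κ * ∫ g, defect n u g) ∧
      ∫⁻ g in Metric.closedBall 0 r, ENNReal.ofReal (hGradSq n (fun g => Df g ^ (n + 1) * u g) g)
          ≤ ENNReal.ofReal (κ * ∫ g, defect n u g) := by
  obtain ⟨r', M, hM, hP⟩ := exists_poincare hn hr
  obtain ⟨L, hL, hLD⟩ := exists_le_of_isCompact (isCompact_closedBall (0 : QH n) (max r r'))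
    (f := fun g => (Df g ^ (n + 1)) ^ 2) (((contDiff_Df (m := 0)).continuous.pow _).pow 2)
  refine ⟨(1 + M.toReal) * L, by positivity, fun u hu hs => ?_⟩
  have hv : ContDiff ℝ 1 (fun g => Df g ^ (n + 1) * u g) := (contDiff_Df.pow _).mul hu
  obtain ⟨m, hm⟩ := hP _ hv
  have hd0 : 0 ≤ ∫ g, defect n u g := integral_nonneg (defect_nonneg u)
  have key : ∫⁻ g in Metric.closedBall 0 (max r r'),
      ENNReal.ofReal (hGradSq n (fun g => Df g ^ (n + 1) * u g) g)
        ≤ ENNReal.ofReal (L * ∫ g, defect n u g) := by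
    calc _ ≤ ∫⁻ g in Metric.closedBall 0 (max r r'), ENNReal.ofReal (L * defect n u g) := by
          refine setLIntegral_mono' Metric.isClosed_closedBall.measurableSet fun g hg => ?_
          rw [hGradSq_Df_pow_mul hu]
          exact ENNReal.ofReal_le_ofReal
            (mul_le_mul_of_nonneg_right (hLD g hg) (defect_nonneg u g))
      _ ≤ ∫⁻ g, ENNReal.ofReal (L * defect n u g) := setLIntegral_le_lintegral _ _
      _ = _ := by
          rw [← integral_const_mul, ofReal_integral_eq_lintegral_ofReal
            ((integrable_defect hu hs).const_mul L)
            (Filter.Eventually.of_forall fun g => mul_nonneg hL.le (defect_nonneg u g))]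
  refine ⟨m, hm.trans ?_, ?_⟩
  · calc _ ≤ M * ENNReal.ofReal (L * ∫ g, defect n u g) := by
          gcongr
          exact (lintegral_mono_set (Metric.closedBall_subset_closedBall (le_max_right _ _))).trans
            key
      _ = ENNReal.ofReal (M.toReal * (L * ∫ g, defect n u g)) := by
          rw [ENNReal.ofReal_mul ENNReal.toReal_nonneg, ENNReal.ofReal_toReal hM.ne]
      _ ≤ _ := by
          refine ENNReal.ofReal_le_ofReal ?_
          rw [mul_assoc]
          gcongr
          linarith
  · refine ((lintegral_mono_set (Metric.closedBall_subset_closedBall (le_max_left _ _))).trans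
      key).trans (ENNReal.ofReal_le_ofReal ?_)
    rw [mul_assoc]
    exact le_mul_of_one_le_left (mul_nonneg hL.le hd0) (by linarith [M.toReal_nonneg])

/-- Functions with small defect are close on balls to a multiple of the ground state. -/
lemma exists_close (hn : 1 ≤ n) {C : ℝ} (hC : 0 < C) (hineq : ∀ u : QH n → ℝ, ContDiff ℝ 1 u →
    HasCompactSupport u → C * Nf n u ^ (2 / pS n) ≤ Ef n u) {s τ : ℝ} (hs0 : 0 < s) (hτ : 0 < τ) :
    ∃ δ > 0, ∀ u : QH n → ℝ, ContDiff ℝ 1 u → HasCompactSupport u → ∫ g, defect n u g ≤ δ →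
      ∃ m : ℝ, ∫ g in Metric.closedBall 0 s, |u g - m * groundState g| ^ pS n ≤ τ ∧
        ∫ g in Metric.closedBall 0 s, (u g - m * groundState g) ^ 2 / Df g ≤ τ := by
  obtain ⟨κ, hκ, hloc⟩ := exists_local_bound hn (r := s + 1) (by linarith)
  let χ : ContDiffBump (0 : QH n) := ⟨s, s + 1, hs0, by linarith⟩
  set φ : QH n → ℝ := fun g => χ g * groundState g with hφ
  have hφc : ContDiff ℝ 1 φ := χ.contDiff.mul contDiff_groundState
  have hφs : HasCompactSupport φ := χ.hasCompactSupport.mul_right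
  have hφt : tsupport φ ⊆ Metric.closedBall 0 (s + 1) := by
    rw [← χ.tsupport_eq]
    exact tsupport_mul_subset_left
  obtain ⟨L, hL, hLφ⟩ := exists_le_of_isCompact (isCompact_closedBall (0 : QH n) (s + 1))
    (f := fun g => max (φ g ^ 2) (hGradSq n φ g))
    ((hφc.continuous.pow 2).max (continuous_hGradSq hφc))
  have hp := pS_pos (n := n)
  refine ⟨min (τ / κ) (C * τ ^ (2 / pS n) / (4 * L * κ)), by positivity,
    fun u hu hs hdef => ?_⟩
  obtain ⟨m, hm1, hm2⟩ := hloc u hu hs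
  set Δ := ∫ g, defect n u g with hΔ
  have hΔ0 : 0 ≤ Δ := integral_nonneg (defect_nonneg u)
  set v : QH n → ℝ := fun g => Df g ^ (n + 1) * u g with hv
  have hvc : ContDiff ℝ 1 v := (contDiff_Df.pow _).mul hu
  have hw : ContDiff ℝ 1 (fun g => v g - m) := hvc.sub contDiff_const
  have hfact : ∀ g, u g - m * groundState g = groundState g * (v g - m) := fun g => by
    have : Df g ^ (n + 1) ≠ 0 := (pow_pos (Df_pos g) _).ne'
    simp only [hv, groundState]
    field_simp
  set z : QH n → ℝ := fun g => φ g * (v g - m) with hz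
  have hzc : ContDiff ℝ 1 z := hφc.mul hw
  have hzs : HasCompactSupport z := hφs.mul_right
  have hBm : ∀ r, MeasurableSet (Metric.closedBall (0 : QH n) r) := fun r =>
    Metric.isClosed_closedBall.measurableSet
  have hE : Ef n z ≤ 4 * L * κ * Δ := by
    have h1 : ENNReal.ofReal (Ef n z) ≤ ENNReal.ofReal (4 * L * κ * Δ) := by
      rw [ofReal_Ef hzc hzs]
      calc ∫⁻ g, ENNReal.ofReal (hGradSq n z g)
          ≤ ∫⁻ g in Metric.closedBall 0 (s + 1), (ENNReal.ofReal (2 * L) *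
            (ENNReal.ofReal (hGradSq n v g) + ENNReal.ofReal ((v g - m) ^ 2))) := by
            rw [← lintegral_indicator (hBm _)]
            refine lintegral_mono fun g => ?_
            by_cases hg : g ∈ Metric.closedBall (0 : QH n) (s + 1)
            · rw [Set.indicator_of_mem hg, ← ENNReal.ofReal_add (hGradSq_nonneg _ _)
                (sq_nonneg _), ← ENNReal.ofReal_mul (by positivity)]
              refine ENNReal.ofReal_le_ofReal ((hGradSq_mul_le hφc hw g).trans ?_)
              rw [hGradSq_sub_const v]
              have h2 := hLφ g hg
              have h3 := mul_le_mul_of_nonneg_right ((le_max_left _ _).trans h2)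
                (hGradSq_nonneg v g)
              have h4 := mul_le_mul_of_nonneg_left ((le_max_right _ _).trans h2)
                (sq_nonneg (v g - m))
              linarith
            · rw [hGradSq_of_notMem_tsupport fun h => hg (hφt (tsupport_mul_subset_left h))]
              simp
        _ = ENNReal.ofReal (2 * L) * ((∫⁻ g in Metric.closedBall 0 (s + 1),
              ENNReal.ofReal (hGradSq n v g)) + ∫⁻ g in Metric.closedBall 0 (s + 1),
              ENNReal.ofReal ((v g - m) ^ 2)) := by
            rw [lintegral_const_mul' _ _ ENNReal.ofReal_ne_top, lintegral_add_left
              (continuous_hGradSq hvc).measurable.ennreal_ofReal]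
        _ ≤ ENNReal.ofReal (2 * L) * (ENNReal.ofReal (κ * Δ) + ENNReal.ofReal (κ * Δ)) := by
            gcongr
        _ = _ := by
            rw [← ENNReal.ofReal_add (by positivity) (by positivity),
              ← ENNReal.ofReal_mul (by positivity)]
            congr 1
            ring
    exact (ENNReal.ofReal_le_ofReal_iff (by positivity)).1 h1
  refine ⟨m, ?_, ?_⟩
  · have h1 : C * Nf n z ^ (2 / pS n) ≤ C * τ ^ (2 / pS n) := by
      refine ((hineq z hzc hzs).trans hE).trans ?_
      have := hdef.trans (min_le_right _ _)
      rwa [le_div_iff₀ (by positivity), mul_comm] at this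
    have h2 : Nf n z ≤ τ := by
      have h3 := le_of_mul_le_mul_left h1 hC
      exact (Real.rpow_le_rpow_iff (Nf_nonneg z) hτ.le (by positivity)).1 h3
    refine le_trans ?_ h2
    calc _ = ∫ g in Metric.closedBall 0 s, |z g| ^ pS n := by
          refine setIntegral_congr_fun (hBm s) fun g hg => ?_
          simp only [hz, hφ, hfact]
          rw [χ.one_of_mem_closedBall hg, one_mul]
      _ ≤ _ := setIntegral_le_integral (integrable_abs_rpow hzc.continuous hzs hp)
          (Filter.Eventually.of_forall fun g => Real.rpow_nonneg (abs_nonneg _) _)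
  · have h2 : ENNReal.ofReal (∫ g in Metric.closedBall 0 s, (u g - m * groundState g) ^ 2 / Df g)
        ≤ ENNReal.ofReal τ := by
      have hcont : Continuous (fun g => (u g - m * groundState g) ^ 2 / Df g) :=
        ((hu.continuous.sub (continuous_const.mul
          (contDiff_groundState (m := 0)).continuous)).pow 2).div
            (contDiff_Df (m := 0)).continuous Df_ne
      rw [ofReal_integral_eq_lintegral_ofReal
        (hcont.continuousOn.integrableOn_compact (isCompact_closedBall _ _))
        (Filter.Eventually.of_forall fun g => div_nonneg (sq_nonneg _) (Df_pos g).le)]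
      calc _ ≤ ∫⁻ g in Metric.closedBall 0 s, ENNReal.ofReal ((v g - m) ^ 2) := by
            refine lintegral_mono fun g => ENNReal.ofReal_le_ofReal ?_
            rw [hfact, mul_pow]
            refine (div_le_self (by positivity) (one_le_Df g)).trans
              (mul_le_of_le_one_left (sq_nonneg _) (pow_le_one₀ (groundState_pos g).le ?_))
            exact inv_le_one_of_one_le₀ (one_le_pow₀ (one_le_Df g))
        _ ≤ ∫⁻ g in Metric.closedBall 0 (s + 1), ENNReal.ofReal ((v g - m) ^ 2) :=
            lintegral_mono_set (Metric.closedBall_subset_closedBall (by linarith))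
        _ ≤ _ := hm1
        _ ≤ _ := by
            refine ENNReal.ofReal_le_ofReal ?_
            have := hdef.trans (min_le_left _ _)
            rwa [le_div_iff₀ hκ, mul_comm] at this
    exact (ENNReal.ofReal_le_ofReal_iff hτ.le).1 h2

end LocalConvergence

section LowerBound

variable {n : ℕ}

lemma rpow_integral_add_le {α : Type*} [MeasurableSpace α] {μ : Measure α} {q : ℝ} (hq : 1 ≤ q)
    {f g : α → ℝ} (hf : MemLp f (ENNReal.ofReal q) μ) (hg : MemLp g (ENNReal.ofReal q) μ) :
    (∫ x, |f x + g x| ^ q ∂μ) ^ (1 / q) ≤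
      (∫ x, |f x| ^ q ∂μ) ^ (1 / q) + (∫ x, |g x| ^ q ∂μ) ^ (1 / q) := by
  have hq0 : 0 < q := by linarith
  have hq' : ENNReal.ofReal q ≠ 0 := by simpa using hq0
  have key := eLpNorm_add_le hf.1 hg.1 (p := ENNReal.ofReal q) (by simpa using hq)
  have h : ∀ f : α → ℝ, MemLp f (ENNReal.ofReal q) μ → eLpNorm f (ENNReal.ofReal q) μ
      = ENNReal.ofReal ((∫ x, |f x| ^ q ∂μ) ^ (1 / q)) := fun f hf => by
    rw [hf.eLpNorm_eq_integral_rpow_norm hq' ENNReal.ofReal_ne_top, ENNReal.toReal_ofReal hq0.le,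
      one_div]
    rfl
  have h0 : ∀ f : α → ℝ, 0 ≤ (∫ x, |f x| ^ q ∂μ) ^ (1 / q) := fun f =>
    Real.rpow_nonneg (integral_nonneg fun x => Real.rpow_nonneg (abs_nonneg _) _) _
  rw [h _ (hf.add hg), h _ hf, h _ hg, ← ENNReal.ofReal_add (h0 _) (h0 _)] at key
  exact (ENNReal.ofReal_le_ofReal_iff (add_nonneg (h0 _) (h0 _))).1 key

lemma memLp_restrict_of_continuous {K : Set (QH n)} (hK : IsCompact K) {f : QH n → ℝ}
    (hf : Continuous f) (q : ENNReal) : MemLp f q (volume.restrict K) := by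
  obtain ⟨L, hL⟩ := (hK.image hf).isBounded.exists_norm_le
  have : IsFiniteMeasure (volume.restrict K) := ⟨by simpa using hK.measure_lt_top⟩
  exact MemLp.of_bound hf.aestronglyMeasurable L
    (ae_restrict_of_forall_mem hK.measurableSet fun g hg => hL _ ⟨g, hg, rfl⟩)

lemma sq_le_Df {s : ℝ} (hs : 1 ≤ s) {g : QH n} (hg : s < ‖g‖) : s ^ 2 ≤ Df g := by
  by_contra hD
  push Not at hD
  refine hg.not_ge (norm_le_of_qSq_wSq (by linarith) ?_ ?_)
  · have := one_le_Af g
    unfold Df Af at *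
    nlinarith [wSq_nonneg g, qSq_nonneg g]
  · unfold Df at hD
    nlinarith [sq_nonneg (Af g)]

lemma sph_none_zero_le {s : ℝ} (hs : 1 ≤ s) {g : QH n} (hg : s < ‖g‖) :
    sph (none, 0) g ≤ 2 / s - 1 := by
  have h1 : sph (none, 0) g = 2 * Af g / Df g - 1 := by simp [sph, wComp]
  rw [h1]
  have hD := Df_pos g
  have hA := one_le_Af g
  have : Af g / Df g ≤ 1 / s := by
    rw [div_le_div_iff₀ hD (by linarith), one_mul]
    refine abs_le_of_sq_le_sq' ?_ hD.le |>.2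
    have h2 : Af g ^ 2 ≤ Df g := by unfold Df; linarith [wSq_nonneg g]
    rw [mul_pow, sq (Df g)]
    exact mul_le_mul h2 (sq_le_Df hs hg) (sq_nonneg _) hD.le
  rw [mul_div_assoc, ← mul_one_div 2 s]
  linarith

lemma half_le_mass {s : ℝ} (hs : 2 ≤ s) {u : QH n → ℝ} (hu : Continuous u)
    (hsu : HasCompactSupport u) (hN : Nf n u = 1)
    (hc : ∫ g, |u g| ^ pS n * sph (none, 0) g = 0) :
    (1 - 2 / s) / 2 ≤ ∫ g in Metric.closedBall 0 s, |u g| ^ pS n := by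
  set B := Metric.closedBall (0 : QH n) s with hB
  have hBm : MeasurableSet B := Metric.isClosed_closedBall.measurableSet
  have i0 := integrable_abs_rpow hu hsu (pS_pos (n := n))
  have i1 : Integrable (fun g => |u g| ^ pS n * sph (none, 0) g) :=
    ((continuous_abs_rpow hu (pS_pos (n := n)).le).mul
      (contDiff_sph (m := 0) _).continuous).integrable_of_hasCompactSupport
      (hasCompactSupport_abs_rpow hsu (pS_pos (n := n)).ne').mul_right
  have h1 := integral_add_compl hBm i1
  have h2 := integral_add_compl hBm i0
  have h3 : ∫ g in B, |u g| ^ pS n * sph (none, 0) g ≤ ∫ g in B, |u g| ^ pS n :=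
    integral_mono i1.integrableOn i0.integrableOn fun g =>
      mul_le_of_le_one_right (Real.rpow_nonneg (abs_nonneg _) _)
        ((le_abs_self _).trans (abs_sph_le _ g))
  have h4 : ∫ g in Bᶜ, |u g| ^ pS n * sph (none, 0) g
      ≤ ∫ g in Bᶜ, |u g| ^ pS n * (2 / s - 1) := by
    refine setIntegral_mono_on i1.integrableOn (i0.mul_const _).integrableOn hBm.compl
      fun g hg => ?_
    refine mul_le_mul_of_nonneg_left (sph_none_zero_le (by linarith) ?_)
      (Real.rpow_nonneg (abs_nonneg _) _)
    simpa [hB] using hg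
  rw [integral_mul_const] at h4
  rw [hc] at h1
  change _ = Nf n u at h2
  rw [hN] at h2
  set M := ∫ g in B, |u g| ^ pS n
  set M' := ∫ g in Bᶜ, |u g| ^ pS n
  have hM : 0 ≤ M := integral_nonneg fun g => Real.rpow_nonneg (abs_nonneg _) _
  have e : 0 ≤ 2 / s := by positivity
  have e2 : M' = 1 - M := by linarith
  rw [e2] at h4
  nlinarith

end LowerBound

section BestConstant

variable {n : ℕ}

lemma pS_mul : pS n * ((n : ℝ) + 1) = ((2 * n + 3 : ℕ) : ℝ) := by
  unfold pS
  push_cast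
  field_simp
  ring

lemma groundState_rpow (g : QH n) : |groundState g| ^ pS n = (Df g ^ (2 * n + 3))⁻¹ := by
  have hD := (Df_pos g).le
  rw [abs_of_pos (groundState_pos g), groundState, Real.inv_rpow (pow_nonneg hD _),
    ← Real.rpow_natCast, ← Real.rpow_mul hD, ← Real.rpow_natCast (Df g) (2 * n + 3), ← pS_mul]
  push_cast
  rw [mul_comm]

lemma groundState_sq_div (g : QH n) : groundState g ^ 2 / Df g = (Df g ^ (2 * n + 3))⁻¹ := by
  rw [groundState, inv_pow, ← pow_mul, div_eq_mul_inv, ← mul_inv, ← pow_succ]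
  ring_nf

lemma rpow_le_of_ball {s τ m : ℝ} {u : QH n → ℝ} (hu : Continuous u)
    (hτ : ∫ g in Metric.closedBall 0 s, |u g - m * groundState g| ^ pS n ≤ τ) :
    (∫ g in Metric.closedBall 0 s, |u g| ^ pS n) ^ (1 / pS n) ≤
      |m| * (∫ g in Metric.closedBall (0 : QH n) s, (Df g ^ (2 * n + 3))⁻¹) ^ (1 / pS n)
        + τ ^ (1 / pS n) := by
  have hK := isCompact_closedBall (0 : QH n) s
  have hG : Continuous (fun g : QH n => m * groundState g) :=
    continuous_const.mul (contDiff_groundState (m := 0)).continuous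
  have hp := pS_pos (n := n)
  have h := rpow_integral_add_le (μ := volume.restrict (Metric.closedBall (0 : QH n) s))
    (q := pS n) (by linarith [two_lt_pS (n := n)]) (memLp_restrict_of_continuous hK hG _)
    (memLp_restrict_of_continuous hK (hu.sub hG) _)
  simp only [Pi.sub_apply, add_sub_cancel] at h
  refine h.trans (add_le_add (le_of_eq ?_) (Real.rpow_le_rpow
    (integral_nonneg fun g => Real.rpow_nonneg (abs_nonneg _) _) hτ (by positivity)))
  simp only [abs_mul, Real.mul_rpow (abs_nonneg _) (abs_nonneg _), groundState_rpow]
  rw [integral_const_mul, Real.mul_rpow (Real.rpow_nonneg (abs_nonneg _) _)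
    (integral_nonneg fun g => inv_nonneg.2 (pow_nonneg (Df_pos g).le _)),
    ← Real.rpow_mul (abs_nonneg _), mul_one_div_cancel hp.ne', Real.rpow_one]

lemma sqrt_le_of_ball {s τ m : ℝ} {u : QH n → ℝ} (hu : Continuous u)
    (hτ : ∫ g in Metric.closedBall 0 s, (u g - m * groundState g) ^ 2 / Df g ≤ τ) :
    |m| * (∫ g in Metric.closedBall (0 : QH n) s, (Df g ^ (2 * n + 3))⁻¹) ^ ((1 : ℝ) / 2)
      ≤ √(∫ g in Metric.closedBall 0 s, u g ^ 2 / Df g) + √τ := by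
  have hK := isCompact_closedBall (0 : QH n) s
  have hD : Continuous (fun g : QH n => √(Df g)) := (contDiff_Df (m := 0)).continuous.sqrt
  have hD0 : ∀ g : QH n, √(Df g) ≠ 0 := fun g => (Real.sqrt_pos.2 (Df_pos g)).ne'
  have hG : Continuous (fun g : QH n => m * groundState g) :=
    continuous_const.mul (contDiff_groundState (m := 0)).continuous
  have h := rpow_integral_add_le (μ := volume.restrict (Metric.closedBall (0 : QH n) s))
    (q := 2) (by norm_num) (memLp_restrict_of_continuous hK (hu.div hD hD0) _)
    (memLp_restrict_of_continuous hK ((hG.sub hu).div hD hD0) _)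
  have hsq : ∀ x y : ℝ, 0 < y → |x / √y| ^ (2 : ℝ) = x ^ 2 / y := fun x y hy => by
    rw [Real.rpow_two, sq_abs, div_pow, Real.sq_sqrt hy.le]
  simp only [Pi.div_apply, Pi.sub_apply, ← add_div, add_sub_cancel,
    hsq _ _ (Df_pos _)] at h
  simp only [mul_pow, mul_div_assoc, groundState_sq_div] at h
  rw [integral_const_mul, Real.mul_rpow (sq_nonneg _)
    (integral_nonneg fun g => inv_nonneg.2 (pow_nonneg (Df_pos g).le _)), ← Real.sqrt_eq_rpow,
    Real.sqrt_sq_eq_abs, ← Real.sqrt_eq_rpow, ← Real.sqrt_eq_rpow, ← Real.sqrt_eq_rpow] at h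
  rw [← Real.sqrt_eq_rpow]
  refine h.trans (add_le_add le_rfl (Real.sqrt_le_sqrt ?_))
  simpa only [← mul_pow, sub_sq_comm] using hτ

/-- Lower bound for the best constant from the mass captured by a ball. -/
lemma le_best_of_ball (hn : 1 ≤ n) {C : ℝ} (hC : 0 < C) (hineq : ∀ u : QH n → ℝ, ContDiff ℝ 1 u →
    HasCompactSupport u → C * Nf n u ^ (2 / pS n) ≤ Ef n u)
    (hnear : ∀ δ > 0, ∃ u : QH n → ℝ, ContDiff ℝ 1 u ∧ HasCompactSupport u ∧ Nf n u = 1 ∧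
      Ef n u < C + δ) {s : ℝ} (hs : 2 ≤ s) :
    ((1 - 2 / s) / 2) ^ (1 / pS n) ≤
      (∫ g in Metric.closedBall (0 : QH n) s, (Df g ^ (2 * n + 3))⁻¹) ^ (1 / pS n - 1 / 2)
        * √(C / (16 * n * (n + 1))) := by
  have hp := pS_pos (n := n)
  have hn0 : (0 : ℝ) < n := by exact_mod_cast hn
  set I := ∫ g in Metric.closedBall (0 : QH n) s, (Df g ^ (2 * n + 3))⁻¹ with hI
  have hI0 : 0 < I := by
    have hcont : Continuous (fun g : QH n => (Df g ^ (2 * n + 3))⁻¹) :=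
      ((contDiff_Df (m := 0)).continuous.pow _).inv₀ fun g => (pow_pos (Df_pos g) _).ne'
    rw [hI, setIntegral_pos_iff_support_of_nonneg_ae
      (Filter.Eventually.of_forall fun g => inv_nonneg.2 (pow_nonneg (Df_pos g).le _))
      (hcont.continuousOn.integrableOn_compact (isCompact_closedBall _ _))]
    have : Function.support (fun g : QH n => (Df g ^ (2 * n + 3))⁻¹) = Set.univ :=
      Set.eq_univ_of_forall fun g => (inv_pos.2 (pow_pos (Df_pos g) _)).ne'
    rw [this, Set.univ_inter]
    exact Metric.measure_closedBall_pos _ _ (by linarith)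
  have key : ∀ τ > 0, ((1 - 2 / s) / 2) ^ (1 / pS n) ≤
      I ^ (1 / pS n - 1 / 2) * (√((C + τ) / (16 * n * (n + 1))) + √τ) + τ ^ (1 / pS n) := by
    intro τ hτ
    obtain ⟨δ₁, hδ₁, hclose⟩ := exists_close hn hC hineq (s := s) (by linarith) hτ
    obtain ⟨δ₂, hδ₂, hdef⟩ := exists_defect_le hC hineq hδ₁
    obtain ⟨u', hu', hsu', hNu', hEu'⟩ := hnear (min τ δ₂) (by positivity)
    obtain ⟨u, hu, hsu, hN, hE, hcent⟩ := exists_centered hu' hsu' hNu'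
    have hEu : Ef n u < C + min τ δ₂ := hE ▸ hEu'
    obtain ⟨m, hm1, hm2⟩ := hclose u hu hsu
      (hdef u hu hsu hN hcent (hEu.le.trans (by linarith [min_le_right τ δ₂])))
    have hV : Integrable (fun g => u g ^ 2 / Df g) := by
      refine Continuous.integrable_of_hasCompactSupport ((hu.continuous.pow 2).div
        (contDiff_Df (m := 0)).continuous Df_ne) ?_
      simp only [sq, mul_div_assoc]
      exact hsu.mul_right
    have hVs : ∫ g in Metric.closedBall 0 s, u g ^ 2 / Df g ≤ (C + τ) / (16 * n * (n + 1)) := by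
      refine (setIntegral_le_integral hV
        (Filter.Eventually.of_forall fun g => div_nonneg (sq_nonneg _) (Df_pos g).le)).trans ?_
      rw [le_div_iff₀ (by positivity)]
      have h1 := integral_defect hu hsu
      have h2 : 0 ≤ ∫ g, defect n u g := integral_nonneg (defect_nonneg u)
      rw [h1] at h2
      change 0 ≤ Ef n u - _ at h2
      linarith [min_le_left τ δ₂]
    have hmass := half_le_mass hs hu.continuous hsu hN (hcent _)
    have h1 := rpow_le_of_ball hu.continuous hm1
    have h2 := sqrt_le_of_ball hu.continuous hm2
    have h3 : ((1 - 2 / s) / 2) ^ (1 / pS n)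
        ≤ (∫ g in Metric.closedBall 0 s, |u g| ^ pS n) ^ (1 / pS n) := by
      refine Real.rpow_le_rpow ?_ hmass (by positivity)
      have : 2 / s ≤ 1 := by rw [div_le_one (by linarith)]; exact hs
      linarith
    have h4 : |m| * I ^ (1 / pS n) = I ^ (1 / pS n - 1 / 2) * (|m| * I ^ ((1 : ℝ) / 2)) := by
      rw [mul_left_comm, ← Real.rpow_add hI0, sub_add_cancel]
    rw [← hI, h4] at h1
    have h5 : |m| * I ^ ((1 : ℝ) / 2) ≤ √((C + τ) / (16 * n * (n + 1))) + √τ :=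
      h2.trans (add_le_add (Real.sqrt_le_sqrt hVs) le_rfl)
    refine h3.trans (h1.trans (add_le_add ?_ le_rfl))
    exact mul_le_mul_of_nonneg_left h5 (by positivity)
  have hlim : Filter.Tendsto (fun τ : ℝ =>
      I ^ (1 / pS n - 1 / 2) * (√((C + τ) / (16 * n * (n + 1))) + √τ) + τ ^ (1 / pS n))
      (nhdsWithin 0 (Set.Ioi 0)) (nhds (I ^ (1 / pS n - 1 / 2) * √(C / (16 * n * (n + 1))))) := by
    have hc : ContinuousAt (fun τ : ℝ =>
      I ^ (1 / pS n - 1 / 2) * (√((C + τ) / (16 * n * (n + 1))) + √τ) + τ ^ (1 / pS n)) 0 := by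
      refine ContinuousAt.add (by fun_prop) ?_
      exact Real.continuousAt_rpow_const _ _ (Or.inr (by positivity))
    have h := hc.tendsto
    simp only [add_zero, Real.sqrt_zero, Real.zero_rpow (one_div_pos.2 hp).ne'] at h
    exact h.mono_left nhdsWithin_le_nhds
  exact ge_of_tendsto hlim (Filter.eventually_of_mem self_mem_nhdsWithin key)

/-- Lower bound for the best constant. -/
lemma le_best (hn : 1 ≤ n) {C : ℝ} (hC : 0 < C) (hineq : ∀ u : QH n → ℝ, ContDiff ℝ 1 u →
    HasCompactSupport u → C * Nf n u ^ (2 / pS n) ≤ Ef n u)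
    (hnear : ∀ δ > 0, ∃ u : QH n → ℝ, ContDiff ℝ 1 u ∧ HasCompactSupport u ∧ Nf n u = 1 ∧
      Ef n u < C + δ) {I : ℝ} (hI0 : 0 < I) (hint : Integrable (fun g : QH n => (Df g ^ (2 * n + 3))⁻¹))
    (hI : ∫ g : QH n, (Df g ^ (2 * n + 3))⁻¹ = I) :
    8 * n * (n + 1) * I ^ ((1 : ℝ) / (2 * n + 3)) ≤ C := by
  have hp := pS_pos (n := n)
  have hp2 := two_lt_pS (n := n)
  have hn0 : (0 : ℝ) < n := by exact_mod_cast hn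
  have h1 : Filter.Tendsto (fun s : ℝ => ((1 - 2 / s) / 2) ^ (1 / pS n)) Filter.atTop
      (nhds ((1 / 2) ^ (1 / pS n))) := by
    have h : Filter.Tendsto (fun s : ℝ => (1 - 2 / s) / 2) Filter.atTop (nhds ((1 - 0) / 2)) :=
      ((tendsto_const_nhds.sub (tendsto_const_nhds.div_atTop Filter.tendsto_id)).div_const 2)
    rw [sub_zero] at h
    exact h.rpow_const (Or.inl (by norm_num))
  have h2 : Filter.Tendsto (fun s : ℝ =>
      (∫ g in Metric.closedBall (0 : QH n) s, (Df g ^ (2 * n + 3))⁻¹) ^ (1 / pS n - 1 / 2)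
        * √(C / (16 * n * (n + 1)))) Filter.atTop
      (nhds (I ^ (1 / pS n - 1 / 2) * √(C / (16 * n * (n + 1))))) := by
    have h := (aecover_closedBall (μ := volume) (x := (0 : QH n))
      Filter.tendsto_id).integral_tendsto_of_countably_generated hint
    rw [hI] at h
    exact (h.rpow_const (Or.inl hI0.ne')).mul_const _
  have h3 := le_of_tendsto_of_tendsto h1 h2 ((Filter.eventually_ge_atTop 2).mono fun s hs =>
    le_best_of_ball hn hC hineq hnear hs)
  have h4 := pow_le_pow_left₀ (by positivity) h3 2
  have hhalf : (1 : ℝ) / 2 ≤ ((1 / 2 : ℝ) ^ (1 / pS n)) ^ 2 := by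
    rw [← Real.rpow_natCast, ← Real.rpow_mul (by norm_num)]
    calc (1 : ℝ) / 2 = (1 / 2) ^ (1 : ℝ) := (Real.rpow_one _).symm
      _ ≤ _ := by
        refine Real.rpow_le_rpow_of_exponent_ge (by norm_num) (by norm_num) ?_
        rw [one_div_mul_eq_div, div_le_one hp]
        push_cast
        exact hp2.le
  have hexp : (1 / pS n - 1 / 2) * ((2 : ℕ) : ℝ) = -((1 : ℝ) / (2 * n + 3)) := by
    have h5 : pS n = (2 * n + 3) / (n + 1) := by
      rw [eq_div_iff (by positivity), pS_mul]; push_cast; ring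
    rw [h5]
    field_simp
    push_cast
    ring
  rw [mul_pow, Real.sq_sqrt (by positivity), ← Real.rpow_natCast (I ^ _), ← Real.rpow_mul hI0.le,
    hexp, Real.rpow_neg hI0.le] at h4
  have h5 := hhalf.trans h4
  have hX : 0 < I ^ ((1 : ℝ) / (2 * n + 3)) := by positivity
  rw [inv_mul_eq_div, le_div_iff₀ hX, le_div_iff₀ (by positivity)] at h5
  linarith

end BestConstant

section GroundStateIntegral

variable {n : ℕ}

lemma lintegral_rpow_mul_exp_neg {a c : ℝ} (ha : 0 < a) (hc : 0 < c) :
    ∫⁻ t in Set.Ioi (0 : ℝ), ENNReal.ofReal (t ^ (a - 1) * exp (-(c * t)))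
      = ENNReal.ofReal (c ^ (-a) * Gamma a) := by
  have h := Real.integral_rpow_mul_exp_neg_mul_Ioi ha hc
  have hpos : 0 < (1 / c) ^ a * Gamma a := by have := Gamma_pos_of_pos ha; positivity
  rw [← ofReal_integral_eq_lintegral_ofReal, h, one_div, Real.inv_rpow hc.le, Real.rpow_neg hc.le]
  · by_contra hi
    rw [integral_undef hi] at h
    exact hpos.ne h
  · refine (ae_restrict_iff' measurableSet_Ioi).2 (Filter.Eventually.of_forall fun t ht => ?_)
    have : (0 : ℝ) < t := ht
    positivity

/-- Integrals of powers from Gaussian integrals, through the Gamma function. -/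
lemma lintegral_add_rpow_neg {X : Type*} [MeasurableSpace X] {μ : Measure X} [SFinite μ] {q : X → ℝ}
    (hqm : Measurable q) (hq : ∀ x, 0 ≤ q x) {d a b : ℝ} (hd : 0 ≤ d) (hb : 0 < b) (had : d < a)
    (hgauss : ∀ t : ℝ, 0 < t → ∫⁻ x, ENNReal.ofReal (exp (-(t * q x))) ∂μ
      = ENNReal.ofReal ((π / t) ^ d)) :
    ∫⁻ x, ENNReal.ofReal ((b + q x) ^ (-a)) ∂μ
      = ENNReal.ofReal (π ^ d * (b ^ (-(a - d)) * Gamma (a - d)) / Gamma a) := by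
  have ha : 0 < a := by linarith
  have hG := Gamma_pos_of_pos ha
  have hm : Measurable (fun z : X × ℝ =>
      ENNReal.ofReal (z.2 ^ (a - 1) * exp (-((b + q z.1) * z.2)))) := by fun_prop
  have e1 : ∀ x, ENNReal.ofReal ((b + q x) ^ (-a)) = ENNReal.ofReal (Gamma a)⁻¹ *
      ∫⁻ t in Set.Ioi (0 : ℝ), ENNReal.ofReal (t ^ (a - 1) * exp (-((b + q x) * t))) := fun x => by
    rw [lintegral_rpow_mul_exp_neg ha (by linarith [hq x]), ← ENNReal.ofReal_mul (by positivity)]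
    congr 1
    field_simp
  have e2 : ∀ t ∈ Set.Ioi (0 : ℝ),
      ∫⁻ x, ENNReal.ofReal (t ^ (a - 1) * exp (-((b + q x) * t))) ∂μ
        = ENNReal.ofReal (π ^ d) * ENNReal.ofReal (t ^ (a - d - 1) * exp (-(b * t))) := by
    intro t ht
    have ht0 : (0 : ℝ) < t := ht
    have e3 : ∀ x, ENNReal.ofReal (t ^ (a - 1) * exp (-((b + q x) * t)))
        = ENNReal.ofReal (t ^ (a - 1) * exp (-(b * t))) * ENNReal.ofReal (exp (-(t * q x))) :=
      fun x => by
        rw [← ENNReal.ofReal_mul (by positivity), mul_assoc, ← Real.exp_add]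
        ring_nf
    simp only [e3]
    rw [lintegral_const_mul' _ _ ENNReal.ofReal_ne_top, hgauss t ht0,
      ← ENNReal.ofReal_mul (by positivity), ← ENNReal.ofReal_mul (by positivity)]
    congr 1
    rw [Real.div_rpow pi_pos.le ht0.le, show a - d - 1 = (a - 1) - d by ring,
      Real.rpow_sub ht0 (a - 1) d]
    ring
  simp only [e1]
  rw [lintegral_const_mul' _ _ ENNReal.ofReal_ne_top, lintegral_lintegral_swap hm.aemeasurable,
    setLIntegral_congr_fun measurableSet_Ioi e2, lintegral_const_mul' _ _ ENNReal.ofReal_ne_top,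
    lintegral_rpow_mul_exp_neg (by linarith) hb, ← ENNReal.ofReal_mul (by positivity),
    ← ENNReal.ofReal_mul (by positivity)]
  congr 1
  ring

lemma lintegral_exp_eq_of_integral {X : Type*} [MeasurableSpace X] {μ : Measure X} {f : X → ℝ}
    {c : ℝ} (hc : 0 < c) (h : ∫ x, exp (f x) ∂μ = c) :
    ∫⁻ x, ENNReal.ofReal (exp (f x)) ∂μ = ENNReal.ofReal c := by
  rw [← h, ofReal_integral_eq_lintegral_ofReal]
  · by_contra hi
    rw [integral_undef hi] at h
    exact hc.ne h
  · exact Filter.Eventually.of_forall fun x => (exp_pos _).le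

lemma integral_exp_neg_mul_sq (t : ℝ) : ∫ x : ℝ, exp (-(t * x ^ 2)) = √(π / t) := by
  simpa only [neg_mul] using integral_gaussian t

lemma integral_prod_exp {X Y : Type*} [MeasureSpace X] [MeasureSpace Y]
    [SFinite (volume : Measure X)] [SFinite (volume : Measure Y)] (f : X → ℝ) (g : Y → ℝ) (t : ℝ) :
    ∫ z : X × Y, exp (-(t * (f z.1 + g z.2)))
      = (∫ x, exp (-(t * f x))) * ∫ y, exp (-(t * g y)) := by
  rw [← integral_prod_mul, ← Measure.volume_eq_prod]
  congr 1
  ext z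
  rw [← Real.exp_add]
  ring_nf

lemma integral_exp_imaginary (t : ℝ) :
    ∫ w : ℝ × ℝ × ℝ, exp (-(t * (w.1 ^ 2 + (w.2.1 ^ 2 + w.2.2 ^ 2)))) = √(π / t) ^ 3 := by
  rw [integral_prod_exp (fun x : ℝ => x ^ 2) (fun w : ℝ × ℝ => w.1 ^ 2 + w.2 ^ 2),
    integral_prod_exp (fun x : ℝ => x ^ 2) (fun x : ℝ => x ^ 2), integral_exp_neg_mul_sq]
  ring

lemma integral_exp_nsq (t : ℝ) : ∫ a : ℝ × ℝ × ℝ × ℝ, exp (-(t * nsq a)) = √(π / t) ^ 4 := by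
  have h := integral_prod_exp (fun x : ℝ => x ^ 2)
    (fun w : ℝ × ℝ × ℝ => w.1 ^ 2 + (w.2.1 ^ 2 + w.2.2 ^ 2)) t
  rw [integral_exp_imaginary, integral_exp_neg_mul_sq, ← pow_succ'] at h
  rw [← h]
  simp only [nsq, tC, xC, yC, zC, add_assoc]

lemma integral_exp_sum_nsq (t : ℝ) :
    ∫ q : Fin n → ℝ × ℝ × ℝ × ℝ, exp (-(t * ∑ α, nsq (q α))) = √(π / t) ^ (4 * n) := by
  have h := integral_fintype_prod_volume_eq_pow (ι := Fin n)
    (fun a : ℝ × ℝ × ℝ × ℝ => exp (-(t * nsq a)))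
  rw [integral_exp_nsq, Fintype.card_fin, ← pow_mul] at h
  rw [← h]
  congr 1
  ext q
  rw [← Real.exp_sum, Finset.sum_neg_distrib, Finset.mul_sum]

lemma sqrt_pow_eq {x : ℝ} (hx : 0 ≤ x) (k : ℕ) : √x ^ k = x ^ ((k : ℝ) / 2) := by
  rw [Real.sqrt_eq_rpow, ← Real.rpow_natCast, ← Real.rpow_mul hx]
  ring_nf

lemma lintegral_inv_Df_pow : ∫⁻ g : QH n, ENNReal.ofReal ((Df g ^ (2 * n + 3))⁻¹)
    = ENNReal.ofReal (π ^ (2 * n + 2) / ((2 * n + 1).factorial * 2 ^ (4 * n + 2))) := by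
  have hw : ∀ q : Fin n → ℝ × ℝ × ℝ × ℝ,
      ∫⁻ w : ℝ × ℝ × ℝ, ENNReal.ofReal ((Df ((q, w) : QH n) ^ (2 * n + 3))⁻¹)
        = ENNReal.ofReal (π ^ ((3 : ℝ) / 2) * Gamma (2 * n + 3 / 2) / Gamma (2 * n + 3)) *
          ENNReal.ofReal ((1 + ∑ α, nsq (q α)) ^ (-(4 * (n : ℝ) + 3))) := by
    intro q
    have hA : 0 < 1 + ∑ α, nsq (q α) := by
      have : 0 ≤ ∑ α, nsq (q α) := Finset.sum_nonneg fun α _ => nsq_nonneg _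
      linarith
    have h := lintegral_add_rpow_neg (μ := (volume : Measure (ℝ × ℝ × ℝ)))
      (q := fun w => w.1 ^ 2 + (w.2.1 ^ 2 + w.2.2 ^ 2)) (by fun_prop) (fun w => by positivity)
      (d := 3 / 2) (a := 2 * n + 3) (b := (1 + ∑ α, nsq (q α)) ^ 2) (by norm_num) (by positivity)
      (by linarith [(Nat.cast_nonneg n : (0 : ℝ) ≤ n)]) (fun t ht =>
        lintegral_exp_eq_of_integral (by positivity) (by
          rw [integral_exp_imaginary, sqrt_pow_eq (by positivity)]; norm_num))
    have e : ∀ w : ℝ × ℝ × ℝ, (Df ((q, w) : QH n) ^ (2 * n + 3))⁻¹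
        = ((1 + ∑ α, nsq (q α)) ^ 2 + (w.1 ^ 2 + (w.2.1 ^ 2 + w.2.2 ^ 2))) ^ (-(2 * (n : ℝ) + 3)) := by
      intro w
      have e3 : 2 * (n : ℝ) + 3 = ((2 * n + 3 : ℕ) : ℝ) := by push_cast; ring
      rw [Real.rpow_neg (by positivity), e3, Real.rpow_natCast]
      congr 2
      simp only [Df, Af, wSq, ← sum_nsq_eq]
      ring
    simp only [e]
    rw [h, ← ENNReal.ofReal_mul (by have := Gamma_pos_of_pos (s := 2 * n + 3 / 2) (by positivity)
                                    have := Gamma_pos_of_pos (s := 2 * n + 3) (by positivity)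
                                    positivity)]
    congr 1
    have e2 : ((1 + ∑ α, nsq (q α)) ^ 2) ^ (-(2 * (n : ℝ) + 3 - 3 / 2))
        = (1 + ∑ α, nsq (q α)) ^ (-(4 * (n : ℝ) + 3)) := by
      rw [← Real.rpow_natCast, ← Real.rpow_mul hA.le]
      congr 1
      push_cast
      ring
    rw [e2, show 2 * (n : ℝ) + 3 - 3 / 2 = 2 * n + 3 / 2 by ring]
    ring
  have hq := lintegral_add_rpow_neg (μ := (volume : Measure (Fin n → ℝ × ℝ × ℝ × ℝ)))
    (q := fun q => ∑ α, nsq (q α)) (by unfold nsq tC xC yC zC; fun_prop)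
    (fun q => Finset.sum_nonneg fun α _ => nsq_nonneg _)
    (d := 2 * n) (a := 4 * n + 3) (b := 1) (by positivity) (by norm_num)
    (by linarith [(Nat.cast_nonneg n : (0 : ℝ) ≤ n)]) (fun t ht =>
      lintegral_exp_eq_of_integral (by positivity) (by
        rw [integral_exp_sum_nsq, sqrt_pow_eq (by positivity)]; push_cast; ring_nf))
  have hmeas : Measurable (fun g : QH n => ENNReal.ofReal ((Df g ^ (2 * n + 3))⁻¹)) :=
    ((contDiff_Df (m := 0)).continuous.pow _).measurable.inv.ennreal_ofReal
  have hg1 := Gamma_pos_of_pos (s := 2 * n + 3 / 2) (by positivity)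
  have hg2 := Gamma_pos_of_pos (s := 2 * n + 3) (by positivity)
  have hg3 := Gamma_pos_of_pos (s := 4 * n + 3) (by positivity)
  calc ∫⁻ g : QH n, ENNReal.ofReal ((Df g ^ (2 * n + 3))⁻¹)
      = ∫⁻ q : Fin n → ℝ × ℝ × ℝ × ℝ, ∫⁻ w : ℝ × ℝ × ℝ,
          ENNReal.ofReal ((Df ((q, w) : QH n) ^ (2 * n + 3))⁻¹) :=
        lintegral_prod _ hmeas.aemeasurable
    _ = _ := by
        simp only [hw]
        rw [lintegral_const_mul' _ _ ENNReal.ofReal_ne_top, hq,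
          ← ENNReal.ofReal_mul (by positivity)]
        congr 1
        have hdup := Real.Gamma_mul_Gamma_add_half (2 * n + 3 / 2)
        have hf : Gamma (2 * (n : ℝ) + 3 / 2 + 1 / 2) = (2 * n + 1).factorial := by
          rw [← Real.Gamma_nat_eq_factorial]; congr 1; push_cast; ring
        have hpw : (2 : ℝ) ^ (1 - 2 * (2 * (n : ℝ) + 3 / 2)) = (2 ^ (4 * n + 2))⁻¹ := by
          rw [← Real.rpow_natCast, ← Real.rpow_neg (by norm_num)]; congr 1; push_cast; ring
        have hpi : π ^ ((3 : ℝ) / 2) * π ^ (2 * (n : ℝ)) * √π = π ^ (2 * n + 2) := by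
          rw [Real.sqrt_eq_rpow, ← Real.rpow_add pi_pos, ← Real.rpow_add pi_pos,
            ← Real.rpow_natCast]
          congr 1
          push_cast
          ring
        rw [hf, hpw, show 2 * (2 * (n : ℝ) + 3 / 2) = 4 * n + 3 by ring] at hdup
        have hfac : (0 : ℝ) < (2 * n + 1).factorial := by exact_mod_cast Nat.factorial_pos _
        rw [Real.one_rpow, one_mul, show 4 * (n : ℝ) + 3 - 2 * n = 2 * n + 3 by ring, ← hpi]
        field_simp
        field_simp at hdup
        linear_combination hdup

lemma integrable_inv_Df_pow : Integrable (fun g : QH n => (Df g ^ (2 * n + 3))⁻¹) := by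
  refine ⟨((contDiff_Df (m := 0)).continuous.pow _).measurable.inv.aestronglyMeasurable, ?_⟩
  rw [hasFiniteIntegral_iff_ofReal (Filter.Eventually.of_forall fun g =>
    inv_nonneg.2 (pow_nonneg (Df_pos g).le _)), lintegral_inv_Df_pow]
  exact ENNReal.ofReal_lt_top

lemma integral_inv_Df_pow : ∫ g : QH n, (Df g ^ (2 * n + 3))⁻¹
    = π ^ (2 * n + 2) / ((2 * n + 1).factorial * 2 ^ (4 * n + 2)) := by
  rw [integral_eq_lintegral_of_nonneg_ae (Filter.Eventually.of_forall fun g =>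
    inv_nonneg.2 (pow_nonneg (Df_pos g).le _)) integrable_inv_Df_pow.1, lintegral_inv_Df_pow,
    ENNReal.toReal_ofReal (by positivity)]

end GroundStateIntegral

section FollandStein

variable {n : ℕ}

/-- The Folland–Stein inequality in exponents normalised by `pS`. -/
lemma le_Ef (hn : 1 ≤ n) {u : QH n → ℝ} (hu : ContDiff ℝ 1 u) (hs : HasCompactSupport u) :
    8 * n * (n + 1) * (π ^ (2 * n + 2) / ((2 * n + 1).factorial * 2 ^ (4 * n + 2))) ^
      ((1 : ℝ) / (2 * n + 3)) * Nf n u ^ (2 / pS n) ≤ Ef n u := by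
  have hp := pS_pos (n := n)
  rcases (Nf_nonneg u).eq_or_lt with h0 | h0
  · rw [← h0, Real.zero_rpow (by positivity), mul_zero]
    exact Ef_nonneg u
  · obtain ⟨C, hC, hineq, hnear⟩ := exists_best hn hu hs h0
    refine le_trans ?_ (hineq u hu hs)
    gcongr
    exact le_best hn hC hineq hnear (by positivity) integrable_inv_Df_pow integral_inv_Df_pow

end FollandStein

end QH

/-- Folland–Stein inequality with the optimal constant, $L^2$ case.
Let `n ≥ 1`, `Q = 4n+6`, `2* = 2Q/(Q−2)`.  For every `u ∈ C_c^∞(ℝ^{4n+3})`,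
`(∫ |u|^{2*} dH)^{1/2*} ≤ S₂ (∫ |∇u|² dH)^{1/2}` where
`S₂ = [2^{−2n} ω_{4n+3}]^{−1/(4n+6)} / (2√(n(n+1)))` and
`ω_{4n+3} = 2π^{2n+2}/(2n+1)!`. -/
theorem folland_stein_optimal_L2 (n : ℕ) (hn : 1 ≤ n)
    (Q p w S₂ : ℝ)
    (hQ : Q = 4 * n + 6)
    (hp : p = 2 * Q / (Q - 2))
    (hw : w = 2 * Real.pi ^ (2 * n + 2) / (2 * n + 1).factorial)
    (hS : S₂ = ((2 : ℝ) ^ (-(2 * (n : ℝ))) * w) ^ (-(1 / (4 * (n : ℝ) + 6)))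
      / (2 * Real.sqrt (n * (n + 1))))
    (u : QH n → ℝ) (hu : ContDiff ℝ (⊤ : ℕ∞) u) (hsupp : HasCompactSupport u) :
    (∫ g : QH n, |u g| ^ p) ^ (1 / p) ≤ S₂ * (∫ g : QH n, QH.hGradSq n u g) ^ ((1 : ℝ) / 2) := by
  have hn0 : (0 : ℝ) < n := by exact_mod_cast hn
  have hpp : p = QH.pS n := by
    rw [hp, hQ, QH.pS, show (4 * (n : ℝ) + 6 - 2) = 4 * (n + 1) by ring]
    field_simp
    ring
  have hfac : (0 : ℝ) < (2 * n + 1).factorial := by exact_mod_cast Nat.factorial_pos _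
  have hp0 : 0 < QH.pS n := QH.pS_pos
  have key := QH.le_Ef hn (hu.of_le (by exact_mod_cast le_top)) hsupp
  set I : ℝ := π ^ (2 * n + 2) / ((2 * n + 1).factorial * 2 ^ (4 * n + 2)) with hI
  have hI0 : 0 < I := by positivity
  have hW : (2 : ℝ) ^ (-(2 * (n : ℝ))) * w = 2 ^ (2 * n + 3) * I := by
    rw [hw, hI, Real.rpow_neg (by norm_num), show 2 * (n : ℝ) = ((2 * n : ℕ) : ℝ) by push_cast; ring,
      Real.rpow_natCast]
    field_simp
    ring
  set r : ℝ := I ^ ((1 : ℝ) / (2 * n + 3)) with hr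
  have hr0 : 0 < r := by positivity
  have hWr : ((2 : ℝ) ^ (2 * n + 3) * I) ^ (-(1 / (4 * (n : ℝ) + 6))) = (√(2 * r))⁻¹ := by
    have e2 : ((2 : ℝ) ^ (2 * n + 3)) ^ ((1 : ℝ) / (2 * n + 3)) = 2 := by
      rw [← Real.rpow_natCast, ← Real.rpow_mul (by norm_num)]
      push_cast
      rw [mul_one_div_cancel (by positivity), Real.rpow_one]
    rw [Real.rpow_neg (by positivity), Real.sqrt_eq_rpow,
      show 1 / (4 * (n : ℝ) + 6) = 1 / (2 * n + 3) * (1 / 2) by field_simp; ring,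
      Real.rpow_mul (by positivity), Real.mul_rpow (by positivity) hI0.le, e2]
  have hN := QH.Nf_nonneg u
  have hE := QH.Ef_nonneg u
  have hSE : S₂ * QH.Ef n u ^ ((1 : ℝ) / 2) = √(QH.Ef n u / (8 * n * (n + 1) * r)) := by
    have e : √(8 * (n : ℝ) * (n + 1) * r) = 2 * √(n * (n + 1)) * √(2 * r) := by
      rw [show 8 * (n : ℝ) * (n + 1) * r = 2 ^ 2 * (n * (n + 1)) * (2 * r) by ring,
        Real.sqrt_mul (by positivity), Real.sqrt_mul (by norm_num), Real.sqrt_sq (by norm_num)]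
    rw [hS, hW, hWr, ← Real.sqrt_eq_rpow, Real.sqrt_div hE, e]
    field_simp
  rw [hpp]
  change QH.Nf n u ^ (1 / QH.pS n) ≤ S₂ * QH.Ef n u ^ ((1 : ℝ) / 2)
  rw [hSE]
  refine Real.le_sqrt_of_sq_le ?_
  rw [← Real.rpow_natCast, ← Real.rpow_mul hN, le_div_iff₀ (by positivity), mul_comm,
    show 1 / QH.pS n * ((2 : ℕ) : ℝ) = 2 / QH.pS n by push_cast; ring]
  exact key
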